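/- Assume the AG₂ setup and the definition of the operator D₂ below, and let λ_τ = 8βⱼ² for τ = ±4βⱼ, λ_τ = 9m(m+1)βⱼ² for τ = ±2βⱼ, λ_τ = m(m+1)αⱼ² for τ = ±2αⱼ, and μ₂(x) = ∑_{τ : τ/2 ∈ AG₂} λ_τ(exp⟨x,τ⟩ − 1). Let x ∈ ℂ² satisfy sinh⟨γ,x⟩ ≠ 0 for every γ ∈ AG₂₊, and let ψ be a Baker–Akhiezer function for AG₂ at x. Then ψ is an eigenfunction of D₂ with eigenvalue μ₂(x): for every D₂-regular z ∈ ℂ², ∑_{τ : τ/2 ∈ AG₂} a_τ(z)·(ψ(z+τ) − ψ(z)) = μ₂(x)·ψ(z). -/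

import Mathlib

noncomputable section

open Complex

/-- The bilinear extension of the Euclidean inner product on `ℂ²`. -/
def bil (z w : Fin 2 → ℂ) : ℂ := z 0 * w 0 + z 1 * w 1

/-- `√3` as a complex number. -/
def rt3 : ℂ := (Real.sqrt 3 : ℝ)

def vα₁ : Fin 2 → ℂ := ![0, rt3]
def vα₂ : Fin 2 → ℂ := ![-(3/2), rt3 / 2]
def vα₃ : Fin 2 → ℂ := ![3/2, rt3 / 2]
def vβ₁ : Fin 2 → ℂ := ![1, 0]
def vβ₂ : Fin 2 → ℂ := ![1/2, rt3 / 2]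
def vβ₃ : Fin 2 → ℂ := ![-(1/2), rt3 / 2]

/-- Positive roots of `G₂`: `α₁, α₂, α₃, β₁, β₂, β₃`. -/
def G2plus : List (Fin 2 → ℂ) := [vα₁, vα₂, vα₃, vβ₁, vβ₂, vβ₃]
/-- The six short roots `±βᵢ` of `G₂`. -/
def shortRoots : List (Fin 2 → ℂ) := [vβ₁, vβ₂, vβ₃, -vβ₁, -vβ₂, -vβ₃]
/-- The six long roots `±αᵢ` of `G₂`. -/
def longRoots : List (Fin 2 → ℂ) := [vα₁, vα₂, vα₃, -vα₁, -vα₂, -vα₃]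
/-- All twelve roots of `G₂`. -/
def G2all : List (Fin 2 → ℂ) := longRoots ++ shortRoots
/-- The twelve vectors `2γ`, `γ ∈ G₂`. -/
def twoG2 : List (Fin 2 → ℂ) := G2all.map (fun γ => (2 : ℂ) • γ)
/-- The six vectors `±2βⱼ`. -/
def twoShort : List (Fin 2 → ℂ) := shortRoots.map (fun γ => (2 : ℂ) • γ)
/-- The six vectors `±2αⱼ`. -/
def twoLong : List (Fin 2 → ℂ) := longRoots.map (fun γ => (2 : ℂ) • γ)
/-- The six vectors `±4βⱼ`. -/
def fourShort : List (Fin 2 → ℂ) := shortRoots.map (fun γ => (4 : ℂ) • γ)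
/-- The eighteen vectors `2γ`, `γ ∈ AG₂`. -/
def twoAG2 : List (Fin 2 → ℂ) := twoG2 ++ fourShort

/-- The quasi-invariance conditions for the configuration `AG₂` with
multiplicities `m_{αᵢ} = m`, `m_{βᵢ} = 3m`, `m_{2βᵢ} = 1`. -/
def QuasiInvAG2 (m : ℕ) (ψ : (Fin 2 → ℂ) → ℂ) : Prop :=
  (∀ α ∈ [vα₁, vα₂, vα₃], ∀ s : ℕ, 1 ≤ s → s ≤ m →
    ∀ z : Fin 2 → ℂ, bil α z = 0 →
      ψ (z + (s : ℂ) • α) = ψ (z - (s : ℂ) • α)) ∧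
  (∀ β ∈ [vβ₁, vβ₂, vβ₃], ∀ s : ℕ, ((1 ≤ s ∧ s ≤ 3 * m) ∨ s = 3 * m + 2) →
    ∀ z : Fin 2 → ℂ, bil β z = 0 →
      ψ (z + (s : ℂ) • β) = ψ (z - (s : ℂ) • β))

/-- The linear form `z ↦ ⟨γ, z⟩` as a polynomial in `z₁, z₂`. -/
def linForm (γ : Fin 2 → ℂ) : MvPolynomial (Fin 2) ℂ :=
  MvPolynomial.C (γ 0) * MvPolynomial.X 0 + MvPolynomial.C (γ 1) * MvPolynomial.X 1

/-- The highest-order term `∏ᵢ ⟨αᵢ,z⟩^m ⟨βᵢ,z⟩^{3m} ⟨2βᵢ,z⟩` of the polynomial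
part of the Baker–Akhiezer function for `AG₂`. -/
def topTerm (m : ℕ) : MvPolynomial (Fin 2) ℂ :=
  (linForm vα₁ * linForm vα₂ * linForm vα₃) ^ m *
    (linForm vβ₁ * linForm vβ₂ * linForm vβ₃) ^ (3 * m) *
    (linForm ((2 : ℂ) • vβ₁) * linForm ((2 : ℂ) • vβ₂) * linForm ((2 : ℂ) • vβ₃))

/-- A Baker–Akhiezer function for `AG₂` at `x`. -/
def IsBAFunction (m : ℕ) (x : Fin 2 → ℂ) (ψ : (Fin 2 → ℂ) → ℂ) : Prop :=
  ∃ P : MvPolynomial (Fin 2) ℂ,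
    P.totalDegree = 12 * m + 3 ∧
    MvPolynomial.homogeneousComponent (12 * m + 3) P = topTerm m ∧
    (∀ z, ψ z = MvPolynomial.eval z P * Complex.exp (bil z x)) ∧
    QuasiInvAG2 m ψ

/-- `z` is `D₂`-regular: `⟨γ,z⟩ ∉ {0, ±γ², ±2γ², ±3γ²}` for every `γ ∈ G₂₊`. -/
def D2Reg (z : Fin 2 → ℂ) : Prop :=
  ∀ γ ∈ G2plus, bil γ z ≠ 0 ∧ bil γ z ≠ bil γ γ ∧ bil γ z ≠ -bil γ γ ∧
    bil γ z ≠ 2 * bil γ γ ∧ bil γ z ≠ -(2 * bil γ γ) ∧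
    bil γ z ≠ 3 * bil γ γ ∧ bil γ z ≠ -(3 * bil γ γ)

open scoped Classical in
/-- The coefficient functions `a_τ` (for `τ/2 ∈ AG₂`) of the dual
Macdonald–Ruijsenaars operator `D₂` for `AG₂`. -/
noncomputable def aD2 (m : ℕ) (τ z : Fin 2 → ℂ) : ℂ :=
  if τ ∈ fourShort then
    let h : Fin 2 → ℂ := (4⁻¹ : ℂ) • τ
    8 * bil h h *
      ((longRoots.filter (fun γ => bil τ γ = 2 * bil γ γ)).map (fun γ =>
        (1 - (m : ℂ) * bil γ γ / bil γ z) *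
        (1 - (m : ℂ) * bil γ γ / (bil γ z + bil γ γ)))).prod *
      ((shortRoots.filter (fun γ => bil τ γ = 2 * bil γ γ)).map (fun γ =>
        (1 - (3 * (m : ℂ) + 2) * bil γ γ / bil γ z) *
        (1 - 3 * (m : ℂ) * bil γ γ / (bil γ z + bil γ γ)))).prod *
      ((1 - (3 * (m : ℂ) + 2) * bil h h / bil h z) *
        (1 - 3 * (m : ℂ) * bil h h / (bil h z + bil h h)) *
        (1 - (3 * (m : ℂ) + 2) * bil h h / (bil h z + 2 * bil h h)) *
        (1 - 3 * (m : ℂ) * bil h h / (bil h z + 3 * bil h h)))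
  else if τ ∈ twoShort then
    let h : Fin 2 → ℂ := (2⁻¹ : ℂ) • τ
    9 * (m : ℂ) * ((m : ℂ) + 1) * bil h h *
      ((longRoots.filter (fun γ => bil τ γ = 0)).map (fun γ =>
        1 - (2 / 3 : ℂ) * bil γ γ / (bil γ z - bil γ γ))).prod *
      ((longRoots.filter (fun γ => bil τ γ = bil γ γ)).map (fun γ =>
        1 - (m : ℂ) * bil γ γ / bil γ z)).prod *
      ((shortRoots.filter (fun γ => bil τ γ = bil γ γ)).map (fun γ =>
        (1 - (3 * (m : ℂ) + 2) * bil γ γ / bil γ z) *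
        (1 + 3 * (m : ℂ) * bil γ γ / (bil γ z + 2 * bil γ γ)) *
        (1 - (3 * (m : ℂ) - 1) * bil γ γ / (bil γ z - bil γ γ)))).prod *
      ((1 - (3 * (m : ℂ) + 2) * bil h h / bil h z) *
        (1 - 3 * (m : ℂ) * bil h h / (bil h z + bil h h)) *
        (1 + 4 * bil h h / (bil h z + 3 * bil h h)) *
        (1 - 4 * bil h h / (bil h z - bil h h)))
  else
    let h : Fin 2 → ℂ := (2⁻¹ : ℂ) • τ
    (m : ℂ) * ((m : ℂ) + 1) * bil h h *
      ((shortRoots.filter (fun γ => bil τ γ = 3 * bil γ γ)).map (fun γ =>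
        (1 - (3 * (m : ℂ) + 2) * bil γ γ / bil γ z) *
        (1 - (3 * (m : ℂ) + 1) * bil γ γ / (bil γ z + bil γ γ)) *
        (1 - 3 * (m : ℂ) * bil γ γ / (bil γ z + 2 * bil γ γ)))).prod *
      ((shortRoots.filter (fun γ => bil τ γ = 0)).map (fun γ =>
        1 - 6 * bil γ γ / (bil γ z - bil γ γ))).prod *
      ((longRoots.filter (fun γ => bil τ γ = bil γ γ)).map (fun γ =>
        1 - (m : ℂ) * bil γ γ / bil γ z)).prod *
      ((1 - (m : ℂ) * bil h h / bil h z) *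
        (1 - (m : ℂ) * bil h h / (bil h z + bil h h)))

open scoped Classical in
/-- The constant `λ_τ`: `8βⱼ²` for `τ = ±4βⱼ`, `9m(m+1)βⱼ²` for `τ = ±2βⱼ`,
and `m(m+1)αⱼ²` for `τ = ±2αⱼ`. -/
noncomputable def lamD2 (m : ℕ) (τ : Fin 2 → ℂ) : ℂ :=
  if τ ∈ fourShort then 8 * bil ((4⁻¹ : ℂ) • τ) ((4⁻¹ : ℂ) • τ)
  else if τ ∈ twoShort then
    9 * (m : ℂ) * ((m : ℂ) + 1) * bil ((2⁻¹ : ℂ) • τ) ((2⁻¹ : ℂ) • τ)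
  else (m : ℂ) * ((m : ℂ) + 1) * bil ((2⁻¹ : ℂ) • τ) ((2⁻¹ : ℂ) • τ)

/-- The eigenvalue `μ₂(x) = ∑_{τ : τ/2 ∈ AG₂} λ_τ (exp⟨x,τ⟩ − 1)` of `D₂`. -/
noncomputable def muD2 (m : ℕ) (x : Fin 2 → ℂ) : ℂ :=
  (twoAG2.map (fun τ => lamD2 m τ * (Complex.exp (bil x τ) - 1))).sum

/-- The positive half `AG₂₊` of the configuration `AG₂`. -/
noncomputable def AG2plus : List (Fin 2 → ℂ) :=
  G2plus ++ [(2 : ℂ) • vβ₁, (2 : ℂ) • vβ₂, (2 : ℂ) • vβ₃]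

section
open Polynomial

theorem degree_C_mul_le' (w : ℂ) (A : ℂ[X]) : (C w * A).degree ≤ A.degree := by
  rw [← smul_eq_C_mul]; exact degree_smul_le _ _

theorem poly_zero_of_roots (A : ℂ[X]) (a : ℕ) (hA : A.degree < a)
    (h : ∀ i : ℕ, i < a → A.eval (i : ℂ) = 0) : A = 0 := by
  by_contra hne
  have h1 : (Finset.image (fun i : ℕ => (i : ℂ)) (Finset.range a)).card ≤ A.natDegree := by
    apply Polynomial.card_le_degree_of_subset_roots
    intro x hx
    simp only [Finset.image_val, Multiset.mem_dedup, Multiset.mem_map] at hx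
    obtain ⟨i, hi, rfl⟩ := hx
    rw [mem_roots hne]
    exact h i (by simpa using hi)
  rw [Finset.card_image_of_injective _ Nat.cast_injective, Finset.card_range] at h1
  have := (Polynomial.natDegree_lt_iff_degree_lt hne).2 hA
  omega

theorem degree_diff_lt (B : ℂ[X]) (b : ℕ) (hB : B.degree < (b + 1 : ℕ)) :
    (B.comp (X + C 1) - B).degree < b := by
  by_cases h0 : B.natDegree = 0
  · rw [Polynomial.eq_C_of_natDegree_eq_zero h0]
    simp
  · have hne : B ≠ 0 := by rintro rfl; simp at h0
    have hlt : (B.comp (X + C 1) - B).degree < B.degree := by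
      have hd : (B.comp (X + C 1)).natDegree = B.natDegree := by
        rw [natDegree_comp, natDegree_X_add_C, mul_one]
      have hc : B.comp (X + C 1) ≠ 0 := by
        intro h; rw [h] at hd; simp at hd; omega
      have := degree_sub_lt_left (p := B.comp (X + C 1)) (q := B) ?_ hc ?_
      · rwa [degree_eq_natDegree hc, hd, ← degree_eq_natDegree hne] at this
      · rw [degree_eq_natDegree hc, hd, ← degree_eq_natDegree hne]
      · rw [leadingCoeff_comp (by rw [natDegree_X_add_C]; exact one_ne_zero), leadingCoeff_X_add_C, one_pow, mul_one]
    have h2 := (Polynomial.natDegree_lt_iff_degree_lt hne).2 hB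
    refine lt_of_lt_of_le hlt ?_
    rw [degree_eq_natDegree hne]
    exact_mod_cast Nat.lt_succ_iff.1 h2

theorem degree_wdiff_lt (A : ℂ[X]) (a : ℕ) (w : ℂ) (hA : A.degree < a) :
    (C w * A.comp (X + C 1) - A).degree < a := by
  refine lt_of_le_of_lt (degree_sub_le _ _) (max_lt ?_ hA)
  refine lt_of_le_of_lt (degree_C_mul_le' _ _) ?_
  by_cases hne : A = 0
  · simpa [hne] using hA
  refine lt_of_le_of_lt degree_le_natDegree ?_
  rw [natDegree_comp, natDegree_X_add_C, mul_one, ← degree_eq_natDegree hne]; exact hA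

theorem wdiff_zero (A : ℂ[X]) (w : ℂ) (hw : w ≠ 1)
    (h : C w * A.comp (X + C 1) - A = 0) : A = 0 := by
  have := congrArg Polynomial.leadingCoeff (sub_eq_zero.1 h)
  rw [leadingCoeff_mul, leadingCoeff_comp (by rw [natDegree_X_add_C]; exact one_ne_zero), leadingCoeff_C, leadingCoeff_X_add_C,
    one_pow, mul_one] at this
  by_contra hne
  have h3 : A.leadingCoeff ≠ 0 := leadingCoeff_ne_zero.2 hne
  apply hw
  exact mul_right_cancel₀ h3 (by rw [this, one_mul])

theorem expPoly_zero (w : ℂ) (hw0 : w ≠ 0) (hw : w ≠ 1) (a : ℕ) : ∀ (b : ℕ) (A B : ℂ[X]),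
    A.degree < a → B.degree < b →
    (∀ i : ℕ, i < a + b → A.eval (i : ℂ) * w ^ i + B.eval (i : ℂ) = 0) → A = 0 := by
  intro b
  induction b with
  | zero =>
    intro A B hA hB h
    have hB0 : B = 0 := by
      rw [← degree_eq_bot]; simpa using hB
    apply poly_zero_of_roots A a hA
    intro i hi
    have := h i (by omega)
    simpa [hB0, hw0] using this
  | succ b ih =>
    intro A B hA hB h
    apply wdiff_zero A w hw
    apply ih _ (B.comp (X + C 1) - B) (degree_wdiff_lt A a w hA) (degree_diff_lt B b hB)
    intro i hi
    have h1 := h i (by omega)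
    have h2 := h (i + 1) (by omega)
    push_cast at h2
    simp only [eval_sub, eval_mul, eval_C, eval_comp, eval_add, eval_X]
    rw [pow_succ] at h2
    linear_combination h2 - h1

theorem expPoly_next0 (w : ℂ) : ∀ (a : ℕ) (A : ℂ[X]),
    A.degree < a → 
    (∀ i : ℕ, i + 1 < a → A.eval (i : ℂ) * w ^ i = 0) →
    A.eval (a : ℂ) * w ^ a = (a * w) * (A.eval ((a - 1 : ℕ) : ℂ) * w ^ (a - 1)) := by
  intro a
  induction a with
  | zero =>
    intro A hA h
    have hB0 : A = 0 := by
      rw [← degree_eq_bot]; simpa using hA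
    simp [hB0]
  | succ a ih =>
    intro A hA h
    have := ih (C w * (A.comp (X + C 1) - A)) (lt_of_le_of_lt (degree_C_mul_le' _ _) (degree_diff_lt A a hA)) ?_
    · rcases a with _ | k
      · simp [sub_eq_zero] at this ⊢
        rcases this with h | h
        · simp [h]
        · rw [h]; ring
      · have h0 := h k (by omega)
        simp only [eval_sub, eval_mul, eval_C, eval_comp, eval_add, eval_X] at this
        simp only [Nat.add_sub_cancel] at this ⊢
        push_cast at this ⊢
        linear_combination this - ((k:ℂ)+1) * w^2 * h0
    · intro i hi
      have h1 := h i (by omega)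
      have h2 := h (i + 1) (by omega)
      push_cast at h2
      simp only [eval_sub, eval_mul, eval_C, eval_comp, eval_add, eval_X]
      rw [pow_succ] at h2
      linear_combination h2 - w * h1

theorem expPoly_next (w : ℂ) (a : ℕ) : ∀ (b : ℕ) (A B : ℂ[X]),
    A.degree < a → B.degree < b →
    (∀ i : ℕ, i + 1 < a + b → A.eval (i : ℂ) * w ^ i + B.eval (i : ℂ) = 0) →
    A.eval ((a + b : ℕ) : ℂ) * w ^ (a + b) + B.eval ((a + b : ℕ) : ℂ) =
      (a * w + b) * (A.eval ((a + b - 1 : ℕ) : ℂ) * w ^ (a + b - 1)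
        + B.eval ((a + b - 1 : ℕ) : ℂ)) := by
  intro b
  induction b with
  | zero =>
    intro A B hA hB h
    have hB0 : B = 0 := by
      rw [← degree_eq_bot]; simpa using hB
    subst hB0
    have := expPoly_next0 w a A hA (by simpa using h)
    simpa using this
  | succ b ih =>
    intro A B hA hB h
    have := ih _ (B.comp (X + C 1) - B) (degree_wdiff_lt A a w hA) (degree_diff_lt B b hB) ?_
    · rcases hab : a + b with _ | k
      · obtain ⟨rfl, rfl⟩ : a = 0 ∧ b = 0 := by omega
        simp at this ⊢
        have hA0 : A = 0 := by
          rw [← degree_eq_bot]; simpa using hA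
        subst hA0
        simp at this ⊢
        linear_combination this
      · have h0 := h k (by omega)
        have hc : (a : ℂ) + b = k + 1 := by exact_mod_cast hab
        rw [← add_assoc, hab]
        rw [hab] at this
        simp only [eval_sub, eval_mul, eval_C, eval_comp, eval_add, eval_X] at this
        simp only [Nat.add_sub_cancel] at this ⊢
        push_cast at this ⊢
        linear_combination this - ((a : ℂ) * w + b) * h0
    · intro i hi
      have h1 := h i (by omega)
      have h2 := h (i + 1) (by omega)
      push_cast at h2
      simp only [eval_sub, eval_mul, eval_C, eval_comp, eval_add, eval_X]
      rw [pow_succ] at h2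
      linear_combination h2 - h1

theorem degree_comp_lin (g : ℂ[X]) (k : ℕ) (hg : g.degree < k) (l : ℂ[X]) (hl : l.natDegree = 1) :
    (g.comp l).degree < k := by
  by_cases hne : g = 0
  · simpa [hne] using hg
  refine lt_of_le_of_lt degree_le_natDegree ?_
  rw [natDegree_comp, hl, mul_one, ← degree_eq_natDegree hne]; exact hg

theorem exp_facts (a : ℂ) (ha : Complex.sinh a ≠ 0) :
    Complex.exp (2 * a) ≠ 1 := by
  intro h
  apply ha
  have h1 : Complex.exp (2 * a) = Complex.exp a * Complex.exp a := by rw [two_mul, Complex.exp_add]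
  have h2 : Complex.exp a * Complex.exp (-a) = 1 := by rw [← Complex.exp_add]; simp
  have h4 : Complex.exp a * (Complex.exp a - Complex.exp (-a)) = 0 := by
    linear_combination h - h1 - h2
  rcases mul_eq_zero.1 h4 with h5 | h5
  · exact absurd h5 (Complex.exp_ne_zero _)
  · rw [Complex.sinh, h5]; simp

theorem exp_facts2 (a : ℂ) (ha : Complex.sinh (2 * a) ≠ 0) :
    Complex.exp (2 * a) ≠ -1 := by
  intro h
  have h1 := exp_facts (2 * a) ha
  apply h1
  rw [two_mul, Complex.exp_add, h]; ring

theorem core_setup (a : ℂ) (g : ℂ[X]) (n : ℕ) (s : ℕ) (j : ℂ)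
    (hj : j = (s : ℂ) ∨ j = -(s : ℂ)) (i : ℕ) (hi : (i : ℂ) = j + n)
    (h : g.eval (s : ℂ) * Complex.exp (a * s) = g.eval (-(s : ℂ)) * Complex.exp (-(a * s))) :
    (g.comp (X - C (n : ℂ))).eval (i : ℂ) * (Complex.exp (2 * a)) ^ i +
      (C (-(Complex.exp (2 * a)) ^ n) * g.comp (C (n : ℂ) - X)).eval (i : ℂ) = 0 := by
  simp only [eval_sub, eval_mul, eval_C, eval_comp, eval_X, ← Complex.exp_nat_mul, hi]
  have e1 : Complex.exp ((j + n) * (2 * a)) = Complex.exp (n * (2 * a)) * (Complex.exp (a * j) * Complex.exp (a * j)) := by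
    rw [← Complex.exp_add, ← Complex.exp_add]; congr 1; ring
  rw [e1]
  have e2 : j + n - n = j := by ring
  have e3 : (n : ℂ) - (j + n) = -j := by ring
  rw [e2, e3]
  have e4 : Complex.exp (a * j) * Complex.exp (-(a * j)) = 1 := by rw [← Complex.exp_add]; simp
  have h' : g.eval j * Complex.exp (a * j) = g.eval (-j) * Complex.exp (-(a * j)) := by
    rcases hj with rfl | rfl
    · exact h
    · simp only [neg_neg, mul_neg]; exact h.symm
  linear_combination Complex.exp (n * (2 * a)) * Complex.exp (a * j) * h' + Complex.exp (n * (2 * a)) * g.eval (-j) * e4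

theorem natDegree_C_sub_X' (n : ℂ) : (C n - X : ℂ[X]).natDegree = 1 := by
  rw [← neg_sub, natDegree_neg, natDegree_X_sub_C]

theorem comp_sub_zero (g : ℂ[X]) (n : ℂ) (h : g.comp (X - C n) = 0) : g = 0 := by
  rw [← leadingCoeff_eq_zero] at h ⊢
  rwa [leadingCoeff_comp (by simp), leadingCoeff_X_sub_C, one_pow, mul_one] at h

theorem core_alpha (a : ℂ) (ha : Complex.sinh a ≠ 0) (m : ℕ) (g : ℂ[X]) (hg : g.degree < m)
    (h : ∀ s : ℕ, 1 ≤ s → s ≤ m →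
      g.eval (s : ℂ) * Complex.exp (a * s) = g.eval (-(s : ℂ)) * Complex.exp (-(a * s))) :
    g = 0 := by
  apply comp_sub_zero g (m : ℂ)
  apply expPoly_zero (Complex.exp (2 * a)) (Complex.exp_ne_zero _) (exp_facts a ha) m m _
    (C (-(Complex.exp (2 * a)) ^ m) * g.comp (C (m : ℂ) - X))
    (degree_comp_lin g m hg _ (natDegree_X_sub_C _))
    (lt_of_le_of_lt (degree_C_mul_le' _ _) (degree_comp_lin g m hg _ (natDegree_C_sub_X' _)))
  intro i hi
  rcases le_total m i with him | him
  · obtain ⟨s, rfl⟩ := Nat.exists_eq_add_of_le him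
    apply core_setup a g m s (s : ℂ) (Or.inl rfl) _ (by push_cast; ring)
    rcases Nat.eq_zero_or_pos s with rfl | hs
    · simp
    · exact h s hs (by omega)
  · obtain ⟨s, hs⟩ := Nat.exists_eq_add_of_le him
    apply core_setup a g m s (-s : ℂ) (Or.inr rfl) _ (by rw [hs]; push_cast; ring)
    rcases Nat.eq_zero_or_pos s with rfl | hs
    · simp
    · exact h s hs (by omega)

theorem core_beta (a : ℂ) (ha : Complex.sinh a ≠ 0) (ha2 : Complex.sinh (2 * a) ≠ 0) (n : ℕ)
    (g : ℂ[X]) (hg : g.degree < (n + 1 : ℕ))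
    (h : ∀ s : ℕ, ((1 ≤ s ∧ s ≤ n) ∨ s = n + 2) →
      g.eval (s : ℂ) * Complex.exp (a * s) = g.eval (-(s : ℂ)) * Complex.exp (-(a * s))) :
    g = 0 := by
  set A := g.comp (X - C (n : ℂ)) with hA
  set B := (C (-(Complex.exp (2 * a)) ^ n) * g.comp (C (n : ℂ) - X)) with hB
  have dA : A.degree < (n + 1 : ℕ) := degree_comp_lin g _ hg _ (natDegree_X_sub_C _)
  have dB : B.degree < (n + 1 : ℕ) :=
    lt_of_le_of_lt (degree_C_mul_le' _ _) (degree_comp_lin g _ hg _ (natDegree_C_sub_X' _))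
  have key : ∀ i : ℕ, i ≤ 2 * n ∨ i = 2 * n + 2 →
      A.eval (i : ℂ) * (Complex.exp (2 * a)) ^ i + B.eval (i : ℂ) = 0 := by
    intro i hi
    rcases le_total n i with him | him
    · obtain ⟨s, rfl⟩ := Nat.exists_eq_add_of_le him
      apply core_setup a g n s (s : ℂ) (Or.inl rfl) _ (by push_cast; ring)
      rcases Nat.eq_zero_or_pos s with rfl | hs
      · simp
      · exact h s (by omega)
    · obtain ⟨s, hs⟩ := Nat.exists_eq_add_of_le him
      apply core_setup a g n s (-s : ℂ) (Or.inr rfl) _ (by rw [hs]; push_cast; ring)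
      rcases Nat.eq_zero_or_pos s with rfl | hs
      · simp
      · exact h s (by omega)
  have nx := expPoly_next (Complex.exp (2 * a)) (n + 1) (n + 1) A B dA dB
    (fun i hi => key i (by omega))
  have e1 : n + 1 + (n + 1) = 2 * n + 2 := by ring
  rw [e1, key (2 * n + 2) (Or.inr rfl)] at nx
  have hne : ((n + 1 : ℕ) : ℂ) * Complex.exp (2 * a) + ((n + 1 : ℕ) : ℂ) ≠ 0 := by
    have h1 : ((n + 1 : ℕ) : ℂ) * (Complex.exp (2 * a) + 1) ≠ 0 := by
      apply mul_ne_zero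
      · exact_mod_cast Nat.succ_ne_zero n
      · intro h
        exact exp_facts2 a ha2 (eq_neg_of_add_eq_zero_left h)
    rwa [mul_add, mul_one] at h1
  have k1 := (mul_eq_zero.1 nx.symm).resolve_left hne
  apply comp_sub_zero g (n : ℂ)
  apply expPoly_zero (Complex.exp (2 * a)) (Complex.exp_ne_zero _) (exp_facts a ha) (n + 1) (n + 1) _
    B dA dB
  intro i hi
  by_cases h : i = 2 * n + 1
  · subst h; exact k1
  · exact key i (by omega)
end

section
open Polynomial

/-- The span of the monomials `X^i Y^j` with `(i, j)` in a given set. -/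
def SP (s : Set (ℕ × ℕ)) : Submodule ℂ (ℂ → ℂ → ℂ) :=
  Submodule.span ℂ ((fun p : ℕ × ℕ => (fun X Y : ℂ => X ^ p.1 * Y ^ p.2)) '' s)

/-- Polynomial functions of total degree less than `d`. -/
def QQ (d : ℕ) : Submodule ℂ (ℂ → ℂ → ℂ) := SP {p | p.1 + p.2 < d}
/-- Homogeneous polynomial functions of degree `d`. -/
def HH (d : ℕ) : Submodule ℂ (ℂ → ℂ → ℂ) := SP {p | p.1 + p.2 = d}

theorem SP_mono_mem (s : Set (ℕ × ℕ)) (i j : ℕ) (h : (i, j) ∈ s) :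
    (fun X Y : ℂ => X ^ i * Y ^ j) ∈ SP s :=
  Submodule.subset_span ⟨(i, j), h, rfl⟩

theorem SP_le {s t : Set (ℕ × ℕ)} (h : s ⊆ t) : SP s ≤ SP t :=
  Submodule.span_mono (Set.image_mono h)

theorem SP_mul {s t u : Set (ℕ × ℕ)} (h : ∀ p ∈ s, ∀ q ∈ t, p + q ∈ u)
    {F G : ℂ → ℂ → ℂ} (hF : F ∈ SP s) (hG : G ∈ SP t) : F * G ∈ SP u := by
  have h1 := Submodule.mul_mem_mul hF hG
  rw [SP, SP, Submodule.span_mul_span] at h1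
  refine Submodule.span_mono ?_ h1
  rintro _ ⟨_, ⟨p, hp, rfl⟩, _, ⟨q, hq, rfl⟩, rfl⟩
  refine ⟨p + q, h p hp q hq, ?_⟩
  funext X Y
  simp [pow_add]; ring

theorem QQ_mono {d e : ℕ} (h : d ≤ e) : QQ d ≤ QQ e :=
  SP_le (fun _ hp => lt_of_lt_of_le hp h)

theorem HH_le (d : ℕ) : HH d ≤ QQ (d + 1) :=
  SP_le (fun _ hp => Nat.lt_succ_of_le (le_of_eq hp))

theorem QQ_mul {d e : ℕ} {F G : ℂ → ℂ → ℂ} (hF : F ∈ QQ d) (hG : G ∈ QQ (e + 1)) :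
    F * G ∈ QQ (d + e) :=
  SP_mul (by rintro ⟨a, b⟩ hp ⟨c, e⟩ hq; simp at *; omega) hF hG

theorem HH_mul {d e : ℕ} {F G : ℂ → ℂ → ℂ} (hF : F ∈ HH d) (hG : G ∈ HH e) :
    F * G ∈ HH (d + e) :=
  SP_mul (by rintro ⟨a, b⟩ hp ⟨c, e⟩ hq; simp at *; omega) hF hG

theorem HH_one : (1 : ℂ → ℂ → ℂ) ∈ HH 0 := by
  have := SP_mono_mem {p | p.1 + p.2 = 0} 0 0 rfl
  have e : (1 : ℂ → ℂ → ℂ) = fun X Y : ℂ => X ^ 0 * Y ^ 0 := by funext X Y; simp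
  rw [e]; exact this

theorem HH_pow {F : ℂ → ℂ → ℂ} {d : ℕ} (hF : F ∈ HH d) (i : ℕ) : F ^ i ∈ HH (i * d) := by
  induction i with
  | zero => simpa using HH_one
  | succ i ih =>
    rw [pow_succ, add_mul, one_mul]; exact HH_mul ih hF

theorem HH_lin (a b : ℂ) : (fun X Y : ℂ => a * X + b * Y) ∈ HH 1 := by
  have h1 := SP_mono_mem {p | p.1 + p.2 = 1} 1 0 rfl
  have h2 := SP_mono_mem {p | p.1 + p.2 = 1} 0 1 rfl
  have := Submodule.add_mem _ (Submodule.smul_mem _ a h1) (Submodule.smul_mem _ b h2)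
  have e : (fun X Y : ℂ => a * X + b * Y) = (a • fun X Y : ℂ => X ^ 1 * Y ^ 0) +
      b • fun X Y : ℂ => X ^ 0 * Y ^ 1 := by funext X Y; simp
  rw [e]; exact this

theorem QQ_const (c : ℂ) : (fun _ _ : ℂ => c) ∈ QQ 1 := by
  have := Submodule.smul_mem _ c (HH_le 0 HH_one)
  convert this using 1
  funext X Y; simp

theorem mono_lin_comp (a b c e : ℂ) (i j : ℕ) :
    (fun X Y : ℂ => (a * X + b * Y) ^ i * (c * X + e * Y) ^ j) ∈ HH (i + j) := by
  have := HH_mul (HH_pow (HH_lin a b) i) (HH_pow (HH_lin c e) j)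
  rw [mul_one, mul_one] at this
  exact this

theorem HH_comp (a b c e : ℂ) {d : ℕ} {F : ℂ → ℂ → ℂ} (hF : F ∈ HH d) :
    (fun X Y : ℂ => F (a * X + b * Y) (c * X + e * Y)) ∈ HH d := by
  refine Submodule.span_induction (p := fun F _ =>
    (fun X Y : ℂ => F (a * X + b * Y) (c * X + e * Y)) ∈ HH d) ?_ ?_ ?_ ?_ hF
  · rintro _ ⟨⟨i, j⟩, hp, rfl⟩
    have := mono_lin_comp a b c e i j
    rwa [show i + j = d from hp] at this
  · exact Submodule.zero_mem _
  · intro x y _ _ hx hy; exact Submodule.add_mem _ hx hy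
  · intro r x _ hx; exact Submodule.smul_mem _ r hx

theorem QQ_comp (a b c e : ℂ) {d : ℕ} {F : ℂ → ℂ → ℂ} (hF : F ∈ QQ d) :
    (fun X Y : ℂ => F (a * X + b * Y) (c * X + e * Y)) ∈ QQ d := by
  refine Submodule.span_induction (p := fun F _ =>
    (fun X Y : ℂ => F (a * X + b * Y) (c * X + e * Y)) ∈ QQ d) ?_ ?_ ?_ ?_ hF
  · rintro _ ⟨⟨i, j⟩, hp, rfl⟩
    have := mono_lin_comp a b c e i j
    exact QQ_mono hp (HH_le _ this)
  · exact Submodule.zero_mem _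
  · intro x y _ _ hx hy; exact Submodule.add_mem _ hx hy
  · intro r x _ hx; exact Submodule.smul_mem _ r hx

theorem QQ_split {d : ℕ} {F : ℂ → ℂ → ℂ} (hF : F ∈ QQ (d + 1)) : ∃ T ∈ HH d, F - T ∈ QQ d := by
  refine Submodule.span_induction (p := fun F _ => ∃ T ∈ HH d, F - T ∈ QQ d) ?_ ?_ ?_ ?_ hF
  · rintro _ ⟨⟨i, j⟩, hp, rfl⟩
    by_cases h : i + j = d
    · exact ⟨_, SP_mono_mem _ i j h, by simp⟩
    · refine ⟨0, Submodule.zero_mem _, ?_⟩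
      rw [sub_zero]
      exact SP_mono_mem _ i j (by simp at *; omega)
  · exact ⟨0, Submodule.zero_mem _, by simp⟩
  · rintro x y _ _ ⟨T, hT, h⟩ ⟨T', hT', h'⟩
    refine ⟨T + T', Submodule.add_mem _ hT hT', ?_⟩
    rw [add_sub_add_comm]; exact Submodule.add_mem _ h h'
  · rintro r x _ ⟨T, hT, h⟩
    refine ⟨r • T, Submodule.smul_mem _ r hT, ?_⟩
    rw [← smul_sub]; exact Submodule.smul_mem _ r h

theorem QQ_zero {F : ℂ → ℂ → ℂ} (hF : F ∈ QQ 0) : F = 0 := by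
  have : ({p : ℕ × ℕ | p.1 + p.2 < 0}) = ∅ := by ext; simp
  rw [QQ, SP, this] at hF
  simpa using hF

theorem HH_coef {d : ℕ} {T : ℂ → ℂ → ℂ} (hT : T ∈ HH d) : ∃ t : ℕ → ℂ, ∀ X Y,
    T X Y = ∑ i ∈ Finset.range (d + 1), t i * X ^ i * Y ^ (d - i) := by
  refine Submodule.span_induction (p := fun T _ => ∃ t : ℕ → ℂ, ∀ X Y,
    T X Y = ∑ i ∈ Finset.range (d + 1), t i * X ^ i * Y ^ (d - i)) ?_ ?_ ?_ ?_ hT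
  · rintro _ ⟨⟨i, j⟩, hp, rfl⟩
    simp at hp
    refine ⟨fun k => if k = i then 1 else 0, fun X Y => ?_⟩
    rw [Finset.sum_eq_single i]
    · simp [← hp]
    · intro b _ hb; simp [hb]
    · intro h; exfalso; simp at h; omega
  · exact ⟨0, by simp⟩
  · rintro x y _ _ ⟨t, ht⟩ ⟨u, hu⟩
    refine ⟨t + u, fun X Y => ?_⟩
    simp only [Pi.add_apply, ht, hu, ← Finset.sum_add_distrib]
    exact Finset.sum_congr rfl (fun _ _ => by ring)
  · rintro r x _ ⟨t, ht⟩
    refine ⟨r • t, fun X Y => ?_⟩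
    simp only [Pi.smul_apply, ht, smul_eq_mul, Finset.mul_sum]
    exact Finset.sum_congr rfl (fun _ _ => by ring)

theorem QQ_coef {d : ℕ} {T : ℂ → ℂ → ℂ} (hT : T ∈ QQ d) : ∃ c : ℕ → ℕ → ℂ,
    (∀ i j, d ≤ i + j → c i j = 0) ∧ ∀ X Y,
    T X Y = ∑ j ∈ Finset.range (d + 1), ∑ i ∈ Finset.range (d + 1), c i j * X ^ i * Y ^ j := by
  refine Submodule.span_induction (p := fun T _ => ∃ c : ℕ → ℕ → ℂ,
    (∀ i j, d ≤ i + j → c i j = 0) ∧ ∀ X Y,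
    T X Y = ∑ j ∈ Finset.range (d + 1), ∑ i ∈ Finset.range (d + 1), c i j * X ^ i * Y ^ j)
    ?_ ?_ ?_ ?_ hT
  · rintro _ ⟨⟨i, j⟩, hp, rfl⟩
    simp at hp
    refine ⟨fun k l => if k = i ∧ l = j then 1 else 0, fun k l hkl => ?_, fun X Y => ?_⟩
    · exact if_neg (by rintro ⟨rfl, rfl⟩; omega)
    rw [Finset.sum_eq_single j, Finset.sum_eq_single i]
    · simp
    · intro b _ hb; simp [hb]
    · intro h; exfalso; simp at h; omega
    · intro b _ hb; simp [hb]
    · intro h; exfalso; simp at h; omega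
  · exact ⟨0, by simp⟩
  · rintro x y _ _ ⟨t, ht0, ht⟩ ⟨u, hu0, hu⟩
    refine ⟨t + u, fun i j h => by simp [ht0 i j h, hu0 i j h], fun X Y => ?_⟩
    simp only [Pi.add_apply, ht, hu, ← Finset.sum_add_distrib]
    exact Finset.sum_congr rfl (fun _ _ => Finset.sum_congr rfl (fun _ _ => by ring))
  · rintro r x _ ⟨t, ht0, ht⟩
    refine ⟨r • t, fun i j h => by simp [ht0 i j h], fun X Y => ?_⟩
    simp only [Pi.smul_apply, ht, smul_eq_mul, Finset.mul_sum]
    exact Finset.sum_congr rfl (fun _ _ => Finset.sum_congr rfl (fun _ _ => by ring))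

theorem polyY_zero (n : ℕ) (v : ℕ → ℂ) (h : ∀ Y : ℂ, ∑ j ∈ Finset.range n, v j * Y ^ j = 0) :
    ∀ j, j < n → v j = 0 := by
  intro j hj
  have h0 : (∑ j ∈ Finset.range n, C (v j) * X ^ j : ℂ[X]) = 0 := by
    apply Polynomial.funext
    intro Y
    simp [eval_finsetSum, h]
  have := congrArg (fun p => Polynomial.coeff p j) h0
  simpa [finsetSum_coeff, coeff_C_mul, coeff_X_pow, hj] using this

theorem QQ_line {d : ℕ} {G : ℂ → ℂ → ℂ} (hG : G ∈ QQ d) (a b c e : ℂ) :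
    ∃ w : ℂ[X], ∀ r, w.eval r = G (a * r + b) (c * r + e) := by
  obtain ⟨k, _, hk⟩ := QQ_coef hG
  refine ⟨∑ j ∈ Finset.range (d + 1), ∑ i ∈ Finset.range (d + 1),
    C (k i j) * (C a * X + C b) ^ i * (C c * X + C e) ^ j, fun r => ?_⟩
  simp [eval_finsetSum, hk]

theorem HH_line {d : ℕ} {T : ℂ → ℂ → ℂ} (hT : T ∈ HH d) (a b c e : ℂ) :
    ∃ w : ℂ[X], w.natDegree ≤ d ∧ ∀ r, w.eval r = T (a * r + b) (c * r + e) := by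
  obtain ⟨k, hk⟩ := HH_coef hT
  refine ⟨∑ i ∈ Finset.range (d + 1),
    C (k i) * (C a * X + C b) ^ i * (C c * X + C e) ^ (d - i), ?_, fun r => ?_⟩
  · apply natDegree_sum_le_of_forall_le
    intro i hi
    have hi' : i ≤ d := by simp at hi; omega
    have h1 : ∀ u v : ℂ, (C u * X + C v).natDegree ≤ 1 := fun u v => natDegree_linear_le
    refine (natDegree_mul_le_of_le (m := i) (n := d - i) ?_ ?_).trans (by omega)
    · refine (natDegree_C_mul_le _ _).trans ?_
      simpa using natDegree_pow_le_of_le i (h1 a b)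
    · simpa using natDegree_pow_le_of_le (d - i) (h1 c e)
  · simp [eval_finsetSum, hk]

theorem HH_zero_of_line {d : ℕ} {T : ℂ → ℂ → ℂ} (hT : T ∈ HH d)
    (h : ∀ r : ℂ, T r (2 * r + 1) = 0) : T = 0 := by
  obtain ⟨t, ht⟩ := HH_coef hT
  have hom : ∀ s X Y : ℂ, T (s * X) (s * Y) = s ^ d * T X Y := by
    intro s X Y
    rw [ht, ht, Finset.mul_sum]
    refine Finset.sum_congr rfl (fun i hi => ?_)
    have hi' : i ≤ d := by simp at hi; omega
    have : s ^ d = s ^ i * s ^ (d - i) := by rw [← pow_add]; congr 1; omega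
    rw [this]; ring
  have h1 : ∀ X : ℂ, X ≠ 1 / 2 → T X 1 = 0 := by
    intro X hX
    have hs : (1 - 2 * X) ≠ 0 := by
      intro h; apply hX; linear_combination -h / 2
    have := hom (1 - 2 * X) (X / (1 - 2 * X)) (2 * (X / (1 - 2 * X)) + 1)
    rw [h, mul_zero] at this
    rw [← this]
    have e1 : (1 - 2 * X) * (X / (1 - 2 * X)) = X := mul_div_cancel₀ _ hs
    have e2 : (1 - 2 * X) * (2 * (X / (1 - 2 * X)) + 1) = 1 := by
      linear_combination 2 * e1
    rw [e1, e2]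
  have h2 : (∑ i ∈ Finset.range (d + 1), C (t i) * X ^ i : ℂ[X]) = 0 := by
    apply Polynomial.eq_zero_of_infinite_isRoot
    refine Set.Infinite.mono (s := {x : ℂ | x ≠ 1 / 2}) ?_ ?_
    · intro x hx
      have := h1 x hx
      rw [ht] at this
      simpa [IsRoot, eval_finsetSum] using this
    · exact (Set.finite_singleton (1 / 2 : ℂ)).infinite_compl
  have h3 : ∀ j, j < d + 1 → t j = 0 := by
    intro j hj
    have := congrArg (fun p => Polynomial.coeff p j) h2
    simpa [finsetSum_coeff, coeff_C_mul, coeff_X_pow, hj] using this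
  funext X Y
  rw [ht]
  exact Finset.sum_eq_zero (fun i hi => by rw [h3 i (by simpa using hi)]; ring)

theorem dir_lemma (p : ℂ[X]) (K M : ℕ) (hpK : p.natDegree = K) (hp0 : p ≠ 0)
    (hodd : ∀ x, p.eval (-x) = - p.eval x)
    (Z : Finset ℂ) (hpZ : ∀ f : ℂ[X], (∀ k ∈ Z, f.eval k = 0) → p ∣ f) (S : Set ℕ)
    (hS : ∀ s ∈ S, p.eval (s : ℂ) ≠ 0 ∨ p.derivative.eval (s : ℂ) ≠ 0) (a b : ℂ)
    (core : ∀ g : ℂ[X], g.degree < M → (∀ s ∈ S,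
      g.eval (s : ℂ) * Complex.exp (a * s) = g.eval (-(s : ℂ)) * Complex.exp (-(a * s))) → g = 0)
    (F T : ℂ → ℂ → ℂ) (d : ℕ) (hT : T ∈ HH d) (hFT : F - T ∈ QQ d)
    (h1 : ∀ k ∈ Z, ∀ Y, F k Y = 0)
    (h2 : ∀ s ∈ S, ∀ Y, F (s : ℂ) Y * Complex.exp (a * s + b * Y) +
      F (-(s : ℂ)) Y * Complex.exp (a * (-(s : ℂ)) + b * Y) = 0)
    (h3 : ∀ s ∈ S, p.eval (s : ℂ) = 0 → ∀ Y, HasDerivAt (fun X => F X Y * Complex.exp (a * X + b * Y) +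
      F (-X) Y * Complex.exp (a * (-X) + b * Y)) 0 (s : ℂ)) :
    ∃ N, ∃ G ∈ QQ N, ∀ X Y, T X Y = X ^ (M + K) * G X Y := by
  obtain ⟨t, ht⟩ := HH_coef hT
  obtain ⟨c, hc0, hc⟩ := QQ_coef hFT
  set f : ℕ → ℂ[X] := fun j => (∑ i ∈ Finset.range (d + 1), C (c i j) * X ^ i)
    + C (t (d - j)) * X ^ (d - j) with hf
  have hF : ∀ x Y, F x Y = ∑ j ∈ Finset.range (d + 1), (f j).eval x * Y ^ j := by
    intro x Y
    have e1 : F x Y = (F - T) x Y + T x Y := by simp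
    rw [e1, hc, ht, ← Finset.sum_range_reflect (fun i => t i * x ^ i * Y ^ (d - i)),
      ← Finset.sum_add_distrib]
    refine Finset.sum_congr rfl (fun j hj => ?_)
    have hj' : j ≤ d := by simp at hj; omega
    have e2 : d + 1 - 1 - j = d - j := by omega
    have e3 : d - (d - j) = j := by omega
    simp only [hf, eval_add, eval_finsetSum, eval_mul, eval_C, eval_pow, eval_X, add_mul,
      Finset.sum_mul, e2, e3]
  have hfd : ∀ j, (f j).natDegree ≤ d - j := by
    intro j
    refine natDegree_add_le_of_degree_le (natDegree_sum_le_of_forall_le _ _ (fun i _ => ?_))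
      (natDegree_C_mul_X_pow_le _ _)
    by_cases h : d ≤ i + j
    · rw [hc0 i j h]; simp
    · exact (natDegree_C_mul_X_pow_le _ _).trans (by omega)
  have hfc : ∀ j, j ≤ d → (f j).coeff (d - j) = t (d - j) := by
    intro j hj
    simp only [hf, coeff_add, finsetSum_coeff, coeff_C_mul_X_pow]
    rw [Finset.sum_eq_zero, zero_add]
    · simp
    intro i _
    by_cases h : d - j = i
    · rw [if_pos h, hc0 i j (by omega)]
    · rw [if_neg h]
  have hdvd : ∀ j, j < d + 1 → p ∣ f j := by
    intro j hj
    apply hpZ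
    intro k hk
    exact polyY_zero (d + 1) (fun j => (f j).eval k) (fun Y => by rw [← hF]; exact h1 k hk Y) j hj
  have hex : ∀ j, ∃ g : ℂ[X], j < d + 1 → f j = p * g := by
    intro j
    by_cases hj : j < d + 1
    · obtain ⟨g, hg⟩ := hdvd j hj
      exact ⟨g, fun _ => hg⟩
    · exact ⟨0, fun h => absurd h hj⟩
  choose g hg using hex
  have hFg : ∀ x Y, F x Y = p.eval x * ∑ j ∈ Finset.range (d + 1), (g j).eval x * Y ^ j := by
    intro x Y
    rw [hF, Finset.mul_sum]
    refine Finset.sum_congr rfl (fun j hj => ?_)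
    rw [hg j (by simpa using hj), eval_mul]; ring
  have hW : ∀ s ∈ S, ∀ Y, ∑ j ∈ Finset.range (d + 1), ((g j).eval (s : ℂ) * Complex.exp (a * s)
      - (g j).eval (-(s : ℂ)) * Complex.exp (-(a * s))) * Y ^ j = 0 := by
    intro s hs Y
    set W : ℂ → ℂ := fun x => (∑ j ∈ Finset.range (d + 1), (g j).eval x * Y ^ j) *
        Complex.exp (a * x + b * Y) - (∑ j ∈ Finset.range (d + 1), (g j).eval (-x) * Y ^ j) *
        Complex.exp (a * (-x) + b * Y) with hWdef
    have hEW : ∀ x, F x Y * Complex.exp (a * x + b * Y) +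
      F (-x) Y * Complex.exp (a * (-x) + b * Y) = p.eval x * W x := by
      intro x
      rw [hFg, hFg, hodd]; simp only [hWdef]; ring
    have hW0 : W s = 0 := by
      by_cases hps : p.eval (s : ℂ) = 0
      · have hd := h3 s hs hps Y
        have hWd : DifferentiableAt ℂ W (s : ℂ) := by
          have hp : ∀ q : ℂ[X], Differentiable ℂ (fun x => q.eval x) := fun q => q.differentiable
          have hp2 : ∀ q : ℂ[X], Differentiable ℂ (fun x => q.eval (-x)) :=
            fun q => q.differentiable.comp differentiable_neg
          simp only [hWdef]
          have d1 : ∀ j, Differentiable ℂ (fun x => eval x (g j) * Y ^ j) :=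
            fun j => (hp (g j)).mul_const _
          have d2 : ∀ j, Differentiable ℂ (fun x => eval (-x) (g j) * Y ^ j) :=
            fun j => (hp2 (g j)).mul_const _
          have d3 : Differentiable ℂ (fun x => ∑ j ∈ Finset.range (d + 1), eval x (g j) * Y ^ j) := by
            fun_prop
          have d4 : Differentiable ℂ (fun x => ∑ j ∈ Finset.range (d + 1), eval (-x) (g j) * Y ^ j) := by
            fun_prop
          exact ((d3.mul (by fun_prop)).sub (d4.mul (by fun_prop))) _
        have hd2 := (p.hasDerivAt (s : ℂ)).mul hWd.hasDerivAt
        have hd3 : HasDerivAt (fun x => p.eval x * W x) 0 (s : ℂ) := by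
          simpa only [hEW] using hd
        have := hd2.unique hd3
        rw [hps, zero_mul, add_zero] at this
        rcases hS s hs with h | h
        · exact absurd hps h
        · exact (mul_eq_zero.1 this).resolve_left h
      · have := h2 s hs Y
        rw [hEW] at this
        exact (mul_eq_zero.1 this).resolve_left hps
    have e1 : W s = Complex.exp (b * Y) * ∑ j ∈ Finset.range (d + 1), ((g j).eval (s : ℂ) * Complex.exp (a * s)
      - (g j).eval (-(s : ℂ)) * Complex.exp (-(a * s))) * Y ^ j := by
      simp only [hWdef, Complex.exp_add, sub_mul, Finset.sum_sub_distrib, mul_sub, Finset.sum_mul,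
        Finset.mul_sum, mul_neg]
      congr 1 <;> exact Finset.sum_congr rfl (fun _ _ => by ring)
    rw [e1] at hW0
    exact (mul_eq_zero.1 hW0).resolve_left (Complex.exp_ne_zero _)
  have hg0 : ∀ j, j ≤ d → d - j < M + K → t (d - j) = 0 := by
    intro j hj hlt
    have hj' : j < d + 1 := by omega
    have : g j = 0 := by
      by_contra hne
      apply hne
      apply core
      · rw [← natDegree_lt_iff_degree_lt hne]
        have h5 := hfd j
        rw [hg j hj', natDegree_mul hp0 hne, hpK] at h5
        omega
      · intro s hs
        have := polyY_zero (d + 1) _ (hW s hs) j hj'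
        exact sub_eq_zero.1 this
    rw [← hfc j hj, hg j hj', this]; simp
  refine ⟨d + 1, fun x Y => ∑ i ∈ Finset.range (d + 1),
    if M + K ≤ i then t i * (x ^ (i - (M + K)) * Y ^ (d - i)) else 0, ?_, ?_⟩
  · have : (fun x Y : ℂ => ∑ i ∈ Finset.range (d + 1),
      if M + K ≤ i then t i * (x ^ (i - (M + K)) * Y ^ (d - i)) else 0) =
      ∑ i ∈ Finset.range (d + 1), (if M + K ≤ i then t i else 0) •
        (fun x Y : ℂ => x ^ (i - (M + K)) * Y ^ (d - i)) := by
      funext x Y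
      simp only [Finset.sum_apply, Pi.smul_apply, smul_eq_mul, ite_mul, zero_mul]
    rw [this]
    refine Submodule.sum_mem _ (fun i hi => Submodule.smul_mem _ _ (SP_mono_mem _ _ _ ?_))
    simp at hi ⊢; omega
  · intro x Y
    rw [ht, Finset.mul_sum]
    refine Finset.sum_congr rfl (fun i hi => ?_)
    have hi' : i ≤ d := by simp at hi; omega
    by_cases h : M + K ≤ i
    · rw [if_pos h]
      have : x ^ i = x ^ (M + K) * x ^ (i - (M + K)) := by rw [← pow_add]; congr 1; omega
      rw [this]; ring
    · have := hg0 (d - i) (by omega) (by omega)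
      rw [show d - (d - i) = i by omega] at this
      rw [if_neg h, this]; ring
end

section
def p7 (t : ℂ) : ℂ := t * (t - 1) * (t + 1) * (t - 2) * (t + 2) * (t - 3) * (t + 3)
def p3 (t : ℂ) : ℂ := t * (t - 1) * (t + 1)
def ph4 (m t : ℂ) : ℂ := (t - 3 * m - 2) * (t + 1 - 3 * m) * (t - 3 * m) * (t + 3 - 3 * m)
  * (t - 1) * (t - 2) * (t - 3)
def ph2 (m t : ℂ) : ℂ := (t - 3 * m - 2) * (t + 1 - 3 * m) * (t + 7) * (t - 5)
  * (t - 2) * (t + 2) * (t - 3)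
def pg2 (m t : ℂ) : ℂ := (t - 3 * m - 2) * (t + 1 - 3 * m) * (t - 1) * (t - 2) * (t + 2)
  * (t - 3) * (t + 3)
def ph1 (m t : ℂ) : ℂ := (t - 3 * m - 2) * (t + 3 * m + 2) * (t - 3 * m) * (t + 1) * (t - 2)
  * (t - 3) * (t + 3)
def ph3 (m t : ℂ) : ℂ := (t - 3 * m - 2) * (t - 3 * m) * (t + 2 - 3 * m) * (t - 1) * (t - 2)
  * (t - 3) * (t + 3)
def ph0 (t : ℂ) : ℂ := (t - 7) * (t + 7) * t * (t - 2) * (t + 2) * (t - 3) * (t + 3)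
def ch2 (m t : ℂ) : ℂ := (t - m) * (t + 1 - m) * (t - 1)
def ch1 (m t : ℂ) : ℂ := (t - m) * (t - 1) * (t + 1)
noncomputable def ch0 (t : ℂ) : ℂ := t * (t - 5 / 3) * (t + 5 / 3)

/-- Common denominator. -/
noncomputable def Den (x y : ℂ) : ℂ := p7 x * p7 ((x + 3 * y) / 2) * p7 ((x - 3 * y) / 2) *
  p3 y * p3 ((x + y) / 2) * p3 ((x - y) / 2)
noncomputable def T40 (m x y : ℂ) : ℂ := 8 * ph4 m x * pg2 m ((x + 3 * y) / 2) *
  pg2 m ((x - 3 * y) / 2) * p3 y * ch2 m ((x + y) / 2) * ch2 m ((x - y) / 2)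
noncomputable def T22 (m x y : ℂ) : ℂ := 8 * pg2 m x * ph4 m ((x + 3 * y) / 2) *
  pg2 m ((3 * y - x) / 2) * ch2 m y * ch2 m ((x + y) / 2) * p3 ((y - x) / 2)
noncomputable def T20 (m x y : ℂ) : ℂ := 9 * m * (m + 1) * ph2 m x * ph1 m ((x + 3 * y) / 2) *
  ph1 m ((x - 3 * y) / 2) * ch0 y * ch1 m ((x + y) / 2) * ch1 m ((x - y) / 2)
noncomputable def T11 (m x y : ℂ) : ℂ := 9 * m * (m + 1) * ph1 m x * ph2 m ((x + 3 * y) / 2) *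
  ph1 m ((3 * y - x) / 2) * ch1 m y * ch1 m ((x + y) / 2) * ch0 ((y - x) / 2)
noncomputable def T02 (m x y : ℂ) : ℂ := 3 * m * (m + 1) * ph0 x * ph3 m ((x + 3 * y) / 2) *
  ph3 m ((3 * y - x) / 2) * ch2 m y * ch1 m ((x + y) / 2) * ch1 m ((y - x) / 2)
noncomputable def T31 (m x y : ℂ) : ℂ := 3 * m * (m + 1) * ph3 m x * ph3 m ((x + 3 * y) / 2) *
  ph0 ((x - 3 * y) / 2) * ch1 m y * ch2 m ((x + y) / 2) * ch1 m ((x - y) / 2)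

set_option maxHeartbeats 2000000
set_option maxRecDepth 10000
theorem R1 (m y : ℂ) : T22 m (-1) y + T02 m (-1) y = 0 := by
  unfold T22 T02 pg2 ph4 ph3 ph0 ch1 ch2 p3
  ring
theorem R2 (m y : ℂ) : T11 m 1 y = T31 m (-1) y := by
  unfold T11 T31 ph1 ph2 ph3 ph0 ch1 ch2 ch0
  ring
theorem R3 (m y : ℂ) : T11 m (-2) y + T31 m (-2) y = 0 := by
  unfold T11 T31 ph1 ph2 ph3 ph0 ch1 ch2 ch0
  ring
theorem R4 (m y : ℂ) : T20 m 1 y = T40 m (-1) y := by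
  unfold T20 T40 ph1 ph2 ph4 pg2 ch1 ch2 ch0 p3
  ring
theorem R5 (m y : ℂ) : T20 m (-3) y + T40 m (-3) y = 0 := by
  unfold T20 T40 ph1 ph2 ph4 pg2 ch1 ch2 ch0 p3
  ring
theorem R6 (m y : ℂ) : T22 m y (-1) + T20 m y (-1) = 0 := by
  unfold T22 T20 ph1 ph2 ph4 pg2 ch1 ch2 ch0 p3
  ring
end

section
def trm (u F f0 : ℂ → ℂ) (p : ℕ) (X : ℂ) : ℂ :=
  u X * (F (X + p) - f0 X) - u (-X) * (F (X - p) - f0 X)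

def Ev (S : Set ℕ) (F : ℂ → ℂ) : Prop :=
  ∀ k : ℤ, (k = 0 ∨ k.natAbs ∈ S) → F k = F (-k)

structure Good (r : ℕ) (S : Set ℕ) (G : ℂ → ℂ) : Prop where
  z : ∀ k : ℕ, k ≤ r → G k = 0
  v : ∀ s ∈ S, G (s : ℂ) + G (-(s : ℂ)) = 0
  d : ∀ s ∈ S, s ≤ r → HasDerivAt (fun X => G X + G (-X)) 0 (s : ℂ)

theorem Good.add {r S G H} (hG : Good r S G) (hH : Good r S H) : Good r S (fun X => G X + H X) where
  z k hk := by simp [hG.z k hk, hH.z k hk]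
  v s hs := by linear_combination hG.v s hs + hH.v s hs
  d s hs hr := by
    have := (hG.d s hs hr).add (hH.d s hs hr)
    simp only [add_zero] at this
    refine this.congr_of_eventuallyEq (Filter.Eventually.of_forall fun X => ?_)
    simp only [Pi.add_apply]; ring

theorem Good.smul {r S G} (c : ℂ) (hG : Good r S G) : Good r S (fun X => c * G X) where
  z k hk := by simp [hG.z k hk]
  v s hs := by linear_combination c * hG.v s hs
  d s hs hr := by
    have := (hG.d s hs hr).const_mul c
    simp only [mul_zero] at this
    refine this.congr_of_eventuallyEq (Filter.Eventually.of_forall fun X => ?_)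
    simp only; ring

theorem Good.den {r S} {D f0 : ℂ → ℂ} (hD : Differentiable ℂ D) (hodd : ∀ X, D (-X) = - D X)
    (hz : ∀ k : ℕ, k ≤ r → D k = 0) (hf : Differentiable ℂ f0) (he : Ev S f0) :
    Good r S (fun X => D X * f0 X) where
  z k hk := by simp [hz k hk]
  v s hs := by
    have := he s (Or.inr (by simpa using hs))
    push_cast at this
    rw [hodd, this]; ring
  d s hs hr := by
    have h0 := he s (Or.inr (by simpa using hs))
    push_cast at h0
    have h1 : HasDerivAt (fun X => f0 X - f0 (-X)) (deriv f0 s + deriv f0 (-s)) (s : ℂ) := by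
      have a1 := (hf (s : ℂ)).hasDerivAt
      have a2 : HasDerivAt (fun X => f0 (-X)) (deriv f0 (-(s:ℂ)) * (-1)) (s : ℂ) :=
        HasDerivAt.comp (s : ℂ) (hf (-(s : ℂ))).hasDerivAt (hasDerivAt_neg (s : ℂ))
      exact (a1.sub a2).congr_deriv (by ring)
    have h2 := (hD (s : ℂ)).hasDerivAt.mul h1
    rw [hz s hr, h0, sub_self] at h2
    simp only [mul_zero, zero_mul, add_zero] at h2
    refine h2.congr_of_eventuallyEq (Filter.Eventually.of_forall fun X => ?_)
    simp only [hodd, Pi.mul_apply]; ring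

def InS (S : Set ℕ) (k : ℤ) : Prop := k = 0 ∨ k.natAbs ∈ S

def CondT (r : ℕ) (S : Set ℕ) (u : ℂ → ℂ) (p : ℕ) : Prop := ∀ s ∈ S,
  ((u (s : ℂ) = 0 ∧ (s ≤ r → HasDerivAt u 0 (s : ℂ))) ∨ InS S ((s : ℤ) + p)) ∧
  ((u (-(s : ℂ)) = 0 ∧ (s ≤ r → HasDerivAt u 0 (-(s : ℂ)))) ∨ InS S ((s : ℤ) - p))

noncomputable def sd (F : ℂ → ℂ) (x : ℂ) : ℂ := deriv F x + deriv F (-x)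

theorem Ev_sd (S F) : Ev S (sd F) := by
  intro k _; unfold sd; rw [neg_neg]; ring

theorem trm_val {r S u p F f0} (hc : CondT r S u p) (hF : Ev S F) (h0 : Ev S f0) (s : ℕ) (hs : s ∈ S) :
    trm u F f0 p s + trm u F f0 p (-s) = 0 := by
  have e0 := h0 s (Or.inr (by simpa using hs))
  push_cast at e0
  have key : trm u F f0 p s + trm u F f0 p (-s) =
      u s * (F (s + p) - F (-(s + p)) - (f0 s - f0 (-s)))
      - u (-s) * (F (s - p) - F (-(s - p)) - (f0 s - f0 (-s))) := by
    unfold trm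
    rw [neg_neg, show -(s:ℂ) - p = -(s + p) by ring, show -(s:ℂ) + p = -(s - p) by ring]; ring
  rw [key, e0, sub_self]
  obtain ⟨c1, c2⟩ := hc s hs
  have a1 : u s * (F (s + p) - F (-(s + p)) - 0) = 0 := by
    rcases c1 with c | c
    · rw [c.1]; ring
    · have := hF _ c
      push_cast at this
      rw [this]; ring
  have a2 : u (-s) * (F (s - p) - F (-(s - p)) - 0) = 0 := by
    rcases c2 with c | c
    · rw [c.1]; ring
    · have := hF _ c
      push_cast at this
      rw [this]; ring
  rw [a1, a2, sub_zero]

theorem hasDerivAt_H {F : ℂ → ℂ} (hF : Differentiable ℂ F) (c x : ℂ) :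
    HasDerivAt (fun X => F (X + c) - F (-(X + c))) (sd F (x + c)) x := by
  have a1 : HasDerivAt (fun X => F (X + c)) (deriv F (x + c)) x :=
    HasDerivAt.comp_add_const x c (hF (x + c)).hasDerivAt
  have a3 : HasDerivAt (fun X => -(X + c)) (-1) x := ((hasDerivAt_id x).add_const c).neg
  have a2 : HasDerivAt (fun X => F (-(X + c))) (deriv F (-(x + c)) * (-1)) x :=
    HasDerivAt.comp x (hF (-(x + c))).hasDerivAt a3
  exact (a1.sub a2).congr_deriv (by unfold sd; ring)

theorem trm_deriv {r S u p F f0} (hc : CondT r S u p) (hF : Ev S F) (h0 : Ev S f0)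
    (du : Differentiable ℂ u) (dF : Differentiable ℂ F) (d0 : Differentiable ℂ f0)
    (s : ℕ) (hs : s ∈ S) (hr : s ≤ r) :
    HasDerivAt (fun X => trm u F f0 p X + trm u F f0 p (-X)) (trm u (sd F) (sd f0) p s) (s : ℂ) := by
  have e0 := h0 s (Or.inr (by simpa using hs))
  push_cast at e0
  obtain ⟨c1, c2⟩ := hc s hs
  have hU := (du (s : ℂ)).hasDerivAt
  have hU2 : HasDerivAt (fun X => u (-X)) (deriv u (-(s:ℂ)) * (-1)) (s : ℂ) :=
    HasDerivAt.comp (s : ℂ) (du (-(s : ℂ))).hasDerivAt (hasDerivAt_neg (s : ℂ))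
  have hH0 := hasDerivAt_H d0 0 (s : ℂ)
  have hH1 := (hasDerivAt_H dF (p : ℂ) (s : ℂ)).sub hH0
  have hH2 := (hasDerivAt_H dF (-(p : ℂ)) (s : ℂ)).sub hH0
  have h := (hU.mul hH1).sub (hU2.mul hH2)
  have a1 : deriv u s * (F (s + p) - F (-(s + p))) = 0 := by
    rcases c1 with c | c
    · rw [(c.2 hr).deriv]; ring
    · have := hF _ c
      push_cast at this
      rw [this]; ring
  have a2 : deriv u (-s) * (F (s + -p) - F (-(s + -p))) = 0 := by
    rcases c2 with c | c
    · rw [(c.2 hr).deriv]; ring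
    · have := hF _ c
      push_cast at this
      rw [← sub_eq_add_neg, this]; ring
  refine (h.congr_of_eventuallyEq (Filter.Eventually.of_forall fun X => ?_)).congr_deriv ?_
  · simp only [trm, Pi.mul_apply, Pi.sub_apply, neg_neg, add_zero]
    rw [show -X - (p:ℂ) = -(X + p) by ring, show -X + (p:ℂ) = -(X + -p) by ring,
      show X - (p:ℂ) = X + -p by ring]; ring
  · simp only [trm, Pi.sub_apply, add_zero]
    rw [← sub_eq_add_neg] at a2 ⊢
    linear_combination a1 + a2 + (-deriv u s - deriv u (-s)) * e0

theorem good_of_group {r S u p v q F f0} (hcu : CondT r S u p) (hcv : CondT r S v q)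
    (du : Differentiable ℂ u) (dv : Differentiable ℂ v)
    (alg : ∀ A B : ℂ → ℂ, (F = f0 → A = B) → Ev S A → Ev S B → ∀ k : ℕ, k ≤ r → trm u A B p k + trm v A B q k = 0)
    (hF : Ev S F) (h0 : Ev S f0) (dF : Differentiable ℂ F) (d0 : Differentiable ℂ f0) :
    Good r S (fun X => trm u F f0 p X + trm v F f0 q X) where
  z := alg F f0 id hF h0
  v s hs := by linear_combination trm_val hcu hF h0 s hs + trm_val hcv hF h0 s hs
  d s hs hr := by
    have := (trm_deriv hcu hF h0 du dF d0 s hs hr).add (trm_deriv hcv hF h0 dv dF d0 s hs hr)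
    rw [alg _ _ (fun h => by rw [h]) (Ev_sd S F) (Ev_sd S f0) s hr] at this
    refine this.congr_of_eventuallyEq (Filter.Eventually.of_forall fun X => ?_)
    simp only [Pi.add_apply]; ring
end

section
theorem T02_odd (m x y : ℂ) : T02 m (-x) y = - T02 m x y := by
  unfold T02
  rw [show ph0 (-x) = - ph0 x by unfold ph0; ring,
    show (-x + 3 * y) / 2 = (3 * y - x) / 2 by ring, show (3 * y - -x) / 2 = (x + 3 * y) / 2 by ring,
    show (-x + y) / 2 = (y - x) / 2 by ring, show (y - -x) / 2 = (x + y) / 2 by ring]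
  ring
theorem T40_odd (m x y : ℂ) : T40 m x (-y) = - T40 m x y := by
  unfold T40
  rw [show p3 (-y) = - p3 y by unfold p3; ring,
    show (x + 3 * -y) / 2 = (x - 3 * y) / 2 by ring, show (x - 3 * -y) / 2 = (x + 3 * y) / 2 by ring,
    show (x + -y) / 2 = (x - y) / 2 by ring, show (x - -y) / 2 = (x + y) / 2 by ring]
  ring
theorem T20_odd (m x y : ℂ) : T20 m x (-y) = - T20 m x y := by
  unfold T20
  rw [show ch0 (-y) = - ch0 y by unfold ch0; ring,
    show (x + 3 * -y) / 2 = (x - 3 * y) / 2 by ring, show (x - 3 * -y) / 2 = (x + 3 * y) / 2 by ring,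
    show (x + -y) / 2 = (x - y) / 2 by ring, show (x - -y) / 2 = (x + y) / 2 by ring]
  ring
theorem p7_odd (t : ℂ) : p7 (-t) = - p7 t := by unfold p7; ring
theorem p3_odd (t : ℂ) : p3 (-t) = - p3 t := by unfold p3; ring
theorem ph0_odd (t : ℂ) : ph0 (-t) = - ph0 t := by unfold ph0; ring
theorem ch0_odd (t : ℂ) : ch0 (-t) = - ch0 t := by unfold ch0; ring
theorem Den_oddX (x y : ℂ) : Den (-x) y = - Den x y := by
  unfold Den
  rw [p7_odd, show (-x + 3 * y) / 2 = -((x - 3 * y) / 2) by ring,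
    show (-x - 3 * y) / 2 = -((x + 3 * y) / 2) by ring,
    show (-x + y) / 2 = -((x - y) / 2) by ring, show (-x - y) / 2 = -((x + y) / 2) by ring]
  simp only [p7_odd, p3_odd]
  ring
theorem Den_oddY (x y : ℂ) : Den x (-y) = - Den x y := by
  unfold Den
  rw [p3_odd, show (x + 3 * -y) / 2 = ((x - 3 * y) / 2) by ring,
    show (x - 3 * -y) / 2 = ((x + 3 * y) / 2) by ring,
    show (x + -y) / 2 = ((x - y) / 2) by ring, show (x - -y) / 2 = ((x + y) / 2) by ring]
  ring

/-- The operator with cleared denominators. -/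
noncomputable def opE (m μ : ℂ) (f : ℂ → ℂ → ℂ) (X Y : ℂ) : ℂ :=
  T40 m X Y * (f (X + 4) Y - f X Y) - T40 m (-X) Y * (f (X - 4) Y - f X Y)
  + (T20 m X Y * (f (X + 2) Y - f X Y) - T20 m (-X) Y * (f (X - 2) Y - f X Y))
  + (T22 m X Y * (f (X + 2) (Y + 2) - f X Y) - T22 m (-X) Y * (f (X - 2) (Y + 2) - f X Y)
    - T22 m X (-Y) * (f (X + 2) (Y - 2) - f X Y) + T22 m (-X) (-Y) * (f (X - 2) (Y - 2) - f X Y))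
  + (T11 m X Y * (f (X + 1) (Y + 1) - f X Y) - T11 m (-X) Y * (f (X - 1) (Y + 1) - f X Y)
    - T11 m X (-Y) * (f (X + 1) (Y - 1) - f X Y) + T11 m (-X) (-Y) * (f (X - 1) (Y - 1) - f X Y))
  + (T31 m X Y * (f (X + 3) (Y + 1) - f X Y) - T31 m (-X) Y * (f (X - 3) (Y + 1) - f X Y)
    - T31 m X (-Y) * (f (X + 3) (Y - 1) - f X Y) + T31 m (-X) (-Y) * (f (X - 3) (Y - 1) - f X Y))
  + (T02 m X Y * (f X (Y + 2) - f X Y) - T02 m X (-Y) * (f X (Y - 2) - f X Y))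
  - μ * (Den X Y * f X Y)

theorem dbl {u : ℂ → ℂ} (s : ℂ) (P g : ℂ → ℂ) (hg : Differentiable ℂ g)
    (h : ∀ X, u X = (X - s) * P X * g X) (hP : Differentiable ℂ P) (hPs : P s = 0) :
    HasDerivAt u 0 s := by
  have h1 : HasDerivAt (fun X => (X - s)) 1 s := (hasDerivAt_id s).sub_const s
  have h2 := (h1.mul (hP s).hasDerivAt).mul (hg s).hasDerivAt
  refine (h2.congr_of_eventuallyEq (Filter.Eventually.of_forall fun X => ?_)).congr_deriv ?_
  · simp [h]
  · simp [hPs]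

/-- `S` for the short direction. -/
def Sb (m : ℕ) : Set ℕ := {s | (1 ≤ s ∧ s ≤ 3 * m) ∨ s = 3 * m + 2}
def Sa (m : ℕ) : Set ℕ := {s | 1 ≤ s ∧ s ≤ m}

theorem dbl_cases {r : ℕ} {u ph R : ℂ → ℂ} (hu : u = fun X => ph X * R X) (s : ℂ) (hR : Differentiable ℂ R)
    (n : ℕ) (h0 : ph s = 0) (hd : n ≤ r → ∃ P : ℂ → ℂ, Differentiable ℂ P ∧ P s = 0 ∧ ∀ X, ph X = (X - s) * P X) :
    u s = 0 ∧ (n ≤ r → HasDerivAt u 0 s) := by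
  subst hu
  refine ⟨by simp [h0], fun h => ?_⟩
  obtain ⟨P, h1, h2, h3⟩ := hd h
  exact dbl s P R hR (fun X => by rw [h3]) h1 h2

theorem cond_ph4 (m : ℕ) (hm : 1 ≤ m) (u R : ℂ → ℂ) (hu : u = fun X => ph4 m X * R X)
    (hR : Differentiable ℂ R) : CondT 3 (Sb m) u 4 := by
  intro s hs
  constructor
  · by_cases hb : s + 4 ∈ Sb m
    · right; right; exact_mod_cast hb
    left
    have hc : s = 3 * m - 3 ∨ s = 3 * m - 1 ∨ s = 3 * m ∨ s = 3 * m + 2 := by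
      simp only [Sb, Set.mem_ofPred_eq] at hs hb; omega
    have hm' : 1 ≤ s := by simp only [Sb, Set.mem_ofPred_eq] at hs; omega
    refine dbl_cases hu s hR s ?_ ?_
    · unfold ph4
      rcases hc with hc | hc | hc | hc
      · have : (3 * m : ℂ) = s + 3 := by norm_cast; omega
        simp [this]
      · have : (3 * m : ℂ) = s + 1 := by norm_cast; omega
        simp [this]
      · have : (3 * m : ℂ) = s := by norm_cast; omega
        simp [this]
      · have : (s : ℂ) = 3 * m + 2 := by norm_cast
        rw [this]; ring
    · intro h3
      have : (m = 1 ∧ s = 2) ∨ (m = 1 ∧ s = 3) ∨ (m = 2 ∧ s = 3) := by omega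
      rcases this with ⟨rfl, rfl⟩ | ⟨rfl, rfl⟩ | ⟨rfl, rfl⟩
      · refine ⟨fun X => (X - 2) * ((X - 5) * (X - 3) * X * (X - 1) * (X - 3)), by fun_prop, by simp, fun X => ?_⟩
        unfold ph4; push_cast; ring
      · refine ⟨fun X => (X - 3) * ((X - 5) * (X - 2) * X * (X - 1) * (X - 2)), by fun_prop, by simp, fun X => ?_⟩
        unfold ph4; push_cast; ring
      · refine ⟨fun X => (X - 3) * ((X - 8) * (X - 5) * (X - 6) * (X - 1) * (X - 2)), by fun_prop, by simp, fun X => ?_⟩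
        unfold ph4; push_cast; ring
  · right
    simp only [Sb, Set.mem_ofPred_eq, InS] at hs ⊢; omega

theorem cond_p2 (m : ℕ) (hm : 1 ≤ m) (u R : ℂ → ℂ)
    (hu : u = fun X => ((X - 3 * m - 2) * (X + 1 - 3 * m) * (X - 2)) * R X)
    (hR : Differentiable ℂ R) : CondT 3 (Sb m) u 2 := by
  intro s hs
  constructor
  · by_cases hb : s + 2 ∈ Sb m
    · right; right; exact_mod_cast hb
    left
    have hc : s = 3 * m - 1 ∨ s = 3 * m + 2 := by
      simp only [Sb, Set.mem_ofPred_eq] at hs hb; omega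
    refine dbl_cases hu s hR s ?_ ?_
    · rcases hc with hc | hc
      · have : (3 * m : ℂ) = s + 1 := by norm_cast; omega
        simp [this]
      · have : (s : ℂ) = 3 * m + 2 := by norm_cast
        rw [this]; ring
    · intro h3
      have : (m = 1 ∧ s = 2) := by omega
      rcases this with ⟨rfl, rfl⟩
      refine ⟨fun X => (X - 2) * (X - 5), by fun_prop, by simp, fun X => ?_⟩
      push_cast; ring
  · right
    simp only [Sb, Set.mem_ofPred_eq, InS] at hs ⊢; omega

theorem cond_ph1 (m : ℕ) (hm : 1 ≤ m) (u R : ℂ → ℂ) (hu : u = fun X => ph1 m X * R X)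
    (hR : Differentiable ℂ R) : CondT 3 (Sb m) u 1 := by
  intro s hs
  constructor
  · by_cases hb : s + 1 ∈ Sb m
    · right; right; exact_mod_cast hb
    left
    have hc : s = 3 * m ∨ s = 3 * m + 2 := by
      simp only [Sb, Set.mem_ofPred_eq] at hs hb; omega
    refine dbl_cases hu s hR s ?_ ?_
    · unfold ph1
      rcases hc with hc | hc
      · have : (3 * m : ℂ) = s := by norm_cast; omega
        simp [this]
      · have : (s : ℂ) = 3 * m + 2 := by norm_cast
        rw [this]; ring
    · intro h3
      have : (m = 1 ∧ s = 3) := by omega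
      rcases this with ⟨rfl, rfl⟩
      refine ⟨fun X => (X - 3) * ((X - 5) * (X + 5) * (X + 1) * (X - 2) * (X + 3)), by fun_prop, by simp, fun X => ?_⟩
      unfold ph1; push_cast; ring
  · by_cases hb : s = 3 * m + 2
    · left
      refine dbl_cases hu _ hR s ?_ (fun h => by omega)
      have : (s : ℂ) = 3 * m + 2 := by norm_cast
      unfold ph1; rw [this]; ring
    · right
      simp only [Sb, Set.mem_ofPred_eq, InS] at hs ⊢; omega

theorem cond_ph3 (m : ℕ) (hm : 1 ≤ m) (u R : ℂ → ℂ) (hu : u = fun X => ph3 m X * R X)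
    (hR : Differentiable ℂ R) : CondT 3 (Sb m) u 3 := by
  intro s hs
  constructor
  · by_cases hb : s + 3 ∈ Sb m
    · right; right; exact_mod_cast hb
    left
    have hc : s = 3 * m - 2 ∨ s = 3 * m ∨ s = 3 * m + 2 := by
      simp only [Sb, Set.mem_ofPred_eq] at hs hb; omega
    refine dbl_cases hu s hR s ?_ ?_
    · unfold ph3
      rcases hc with hc | hc | hc
      · have : (3 * m : ℂ) = s + 2 := by norm_cast; omega
        simp [this]
      · have : (3 * m : ℂ) = s := by norm_cast; omega
        simp [this]
      · have : (s : ℂ) = 3 * m + 2 := by norm_cast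
        rw [this]; ring
    · intro h3
      have : (m = 1 ∧ s = 1) ∨ (m = 1 ∧ s = 3) := by omega
      rcases this with ⟨rfl, rfl⟩ | ⟨rfl, rfl⟩
      · refine ⟨fun X => (X - 1) * ((X - 5) * (X - 3) * (X - 2) * (X - 3) * (X + 3)), by fun_prop, by simp, fun X => ?_⟩
        unfold ph3; push_cast; ring
      · refine ⟨fun X => (X - 3) * ((X - 5) * (X - 1) * (X - 1) * (X - 2) * (X + 3)), by fun_prop, by simp, fun X => ?_⟩
        unfold ph3; push_cast; ring
  · right
    simp only [Sb, Set.mem_ofPred_eq, InS] at hs ⊢; omega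

theorem cond_p0 (r : ℕ) (S : Set ℕ) (u : ℂ → ℂ) : CondT r S u 0 := by
  intro s hs
  constructor <;> right <;> right <;> simpa using hs
end

section
theorem dph4 (m : ℂ) : Differentiable ℂ (ph4 m) := by unfold ph4; fun_prop
theorem dph2 (m : ℂ) : Differentiable ℂ (ph2 m) := by unfold ph2; fun_prop
theorem dpg2 (m : ℂ) : Differentiable ℂ (pg2 m) := by unfold pg2; fun_prop
theorem dph1 (m : ℂ) : Differentiable ℂ (ph1 m) := by unfold ph1; fun_prop
theorem dph3 (m : ℂ) : Differentiable ℂ (ph3 m) := by unfold ph3; fun_prop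
theorem dph0 : Differentiable ℂ ph0 := by unfold ph0; fun_prop
theorem dp7 : Differentiable ℂ p7 := by unfold p7; fun_prop
theorem dp3 : Differentiable ℂ p3 := by unfold p3; fun_prop
theorem dch2 (m : ℂ) : Differentiable ℂ (ch2 m) := by unfold ch2; fun_prop
theorem dch1 (m : ℂ) : Differentiable ℂ (ch1 m) := by unfold ch1; fun_prop
theorem dch0 : Differentiable ℂ ch0 := by unfold ch0; fun_prop

theorem DcompX {g : ℂ → ℂ} (hg : Differentiable ℂ g) {l : ℂ → ℂ} (hl : Differentiable ℂ l) :
    Differentiable ℂ (fun X => g (l X)) := hg.comp hl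

theorem dT40 (m : ℂ) {a b : ℂ → ℂ} (ha : Differentiable ℂ a) (hb : Differentiable ℂ b) :
    Differentiable ℂ (fun X => T40 m (a X) (b X)) := by
  have h1 := dph4 m; have h2 := dpg2 m; have h3 := dp3; have h4 := dch2 m
  unfold T40; fun_prop
theorem dT22 (m : ℂ) {a b : ℂ → ℂ} (ha : Differentiable ℂ a) (hb : Differentiable ℂ b) :
    Differentiable ℂ (fun X => T22 m (a X) (b X)) := by
  have h1 := dph4 m; have h2 := dpg2 m; have h3 := dp3; have h4 := dch2 m
  unfold T22; fun_prop
theorem dT20 (m : ℂ) {a b : ℂ → ℂ} (ha : Differentiable ℂ a) (hb : Differentiable ℂ b) :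
    Differentiable ℂ (fun X => T20 m (a X) (b X)) := by
  have h1 := dph1 m; have h2 := dph2 m; have h3 := dch0; have h4 := dch1 m
  unfold T20; fun_prop
theorem dT11 (m : ℂ) {a b : ℂ → ℂ} (ha : Differentiable ℂ a) (hb : Differentiable ℂ b) :
    Differentiable ℂ (fun X => T11 m (a X) (b X)) := by
  have h1 := dph1 m; have h2 := dph2 m; have h3 := dch0; have h4 := dch1 m
  unfold T11; fun_prop
theorem dT02 (m : ℂ) {a b : ℂ → ℂ} (ha : Differentiable ℂ a) (hb : Differentiable ℂ b) :
    Differentiable ℂ (fun X => T02 m (a X) (b X)) := by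
  have h1 := dph3 m; have h2 := dph0; have h3 := dch2 m; have h4 := dch1 m
  unfold T02; fun_prop
theorem dT31 (m : ℂ) {a b : ℂ → ℂ} (ha : Differentiable ℂ a) (hb : Differentiable ℂ b) :
    Differentiable ℂ (fun X => T31 m (a X) (b X)) := by
  have h1 := dph3 m; have h2 := dph0; have h3 := dch2 m; have h4 := dch1 m
  unfold T31; fun_prop
theorem dDen {a b : ℂ → ℂ} (ha : Differentiable ℂ a) (hb : Differentiable ℂ b) :
    Differentiable ℂ (fun X => Den (a X) (b X)) := by
  have h1 := dp7; have h2 := dp3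
  unfold Den; fun_prop

theorem cast_cases3 {k : ℕ} (hk : k ≤ 3) {P : ℂ → Prop} (h0 : P 0) (h1 : P 1) (h2 : P 2) (h3 : P 3) :
    P k := by
  have : k = 0 ∨ k = 1 ∨ k = 2 ∨ k = 3 := by omega
  rcases this with rfl | rfl | rfl | rfl
  · simpa using h0
  · simpa using h1
  · simpa using h2
  · simpa using h3

theorem Ev_nat {S : Set ℕ} {F : ℂ → ℂ} (h : Ev S F) (k : ℕ) (hk : k ∈ S) : F (-k) = F k := by
  have := h k (Or.inr (by simpa using hk))
  push_cast at this
  exact this.symm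

theorem groupA (m : ℕ) (hm : 1 ≤ m) (Y : ℂ) {F f0 : ℂ → ℂ}
    (hF : Ev (Sb m) F) (h0 : Ev (Sb m) f0) (dF : Differentiable ℂ F) (d0 : Differentiable ℂ f0) :
    Good 3 (Sb m) (fun X => trm (fun X => T22 m X Y) F f0 2 X
      + trm (fun X => T02 m X Y / 2) F f0 0 X) := by
  have dv := dT02 m (a := fun X => X) (b := fun _ => Y) (by fun_prop) (by fun_prop)
  refine good_of_group (cond_p2 m hm _ (fun X => 8 * ((X - 1) * (X + 2) * (X - 3) * (X + 3)) *
    ph4 m ((X + 3 * Y) / 2) * pg2 m ((3 * Y - X) / 2) * ch2 m Y * ch2 m ((X + Y) / 2) *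
    p3 ((Y - X) / 2)) ?_ ?_) (cond_p0 _ _ _) (dT22 m (by fun_prop) (by fun_prop))
    (by fun_prop) ?_ hF h0 dF d0
  · funext X; unfold T22
    rw [show pg2 m X = ((X - 3 * m - 2) * (X + 1 - 3 * m) * (X - 2)) * ((X - 1) * (X + 2) * (X - 3) * (X + 3)) by unfold pg2; ring]
    ring
  · have h1 := dph4 m; have h2 := dpg2 m; have h3 := dp3; have h4 := dch2 m
    fun_prop
  · intro A B _ hA hB k hk
    have z : ∀ t : ℂ, t = 1 ∨ t = 2 ∨ t = 3 ∨ t = -2 ∨ t = -3 → T22 m t Y = 0 := by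
      intro t ht
      have : pg2 m t = 0 := by unfold pg2; rcases ht with rfl | rfl | rfl | rfl | rfl <;> ring
      unfold T22; rw [this]; ring
    have zv : ∀ t : ℂ, t = 0 ∨ t = 2 ∨ t = 3 ∨ t = -2 ∨ t = -3 → T02 m t Y = 0 := by
      intro t ht
      have : ph0 t = 0 := by unfold ph0; rcases ht with rfl | rfl | rfl | rfl | rfl <;> ring
      unfold T02; rw [this]; ring
    have hA1 := Ev_nat hA 1 (by simp [Sb]; omega)
    have hA2 := Ev_nat hA 2 (by simp [Sb]; omega)
    have r1 := R1 m Y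
    have o1 := T02_odd m 1 Y
    refine cast_cases3 (P := fun t => trm (fun X => T22 m X Y) A B 2 t + trm (fun X => T02 m X Y / 2) A B 0 t = 0) hk ?_ ?_ ?_ ?_
    · simp only [trm, neg_zero, zv 0 (by simp)]
      push_cast at hA2 ⊢
      rw [zero_sub, hA2]; ring_nf
    · simp only [trm, z 1 (by simp)]
      push_cast at hA1 ⊢
      norm_num at hA1 ⊢
      rw [hA1]
      linear_combination (- (A 1 - B 1)) * r1 + (-(A 1 - B 1)/2) * (-o1)
    · simp [trm, z 2, z (-2), zv 2, zv (-2)]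
    · simp [trm, z 3, z (-3), zv 3, zv (-3)]

theorem groupB (m : ℕ) (hm : 1 ≤ m) (Y : ℂ) {F f0 : ℂ → ℂ}
    (hF : Ev (Sb m) F) (h0 : Ev (Sb m) f0) (dF : Differentiable ℂ F) (d0 : Differentiable ℂ f0) :
    Good 3 (Sb m) (fun X => trm (fun X => T11 m X Y) F f0 1 X
      + trm (fun X => T31 m X Y) F f0 3 X) := by
  refine good_of_group (cond_ph1 m hm _ (fun X => 9 * m * (m + 1) * ph2 m ((X + 3 * Y) / 2) *
    ph1 m ((3 * Y - X) / 2) * ch1 m Y * ch1 m ((X + Y) / 2) * ch0 ((Y - X) / 2)) ?_ ?_)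
    (cond_ph3 m hm _ (fun X => 3 * m * (m + 1) * ph3 m ((X + 3 * Y) / 2) *
    ph0 ((X - 3 * Y) / 2) * ch1 m Y * ch2 m ((X + Y) / 2) * ch1 m ((X - Y) / 2)) ?_ ?_)
    (dT11 m (by fun_prop) (by fun_prop))
    (dT31 m (by fun_prop) (by fun_prop)) ?_ hF h0 dF d0
  · funext X; unfold T11; ring
  · have h1 := dph1 m; have h2 := dph2 m; have h3 := dch0; have h4 := dch1 m
    fun_prop
  · funext X; unfold T31; ring
  · have h1 := dph3 m; have h2 := dph0; have h3 := dch2 m; have h4 := dch1 m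
    fun_prop
  · intro A B _ hA hB k hk
    have z : ∀ t : ℂ, t = -1 ∨ t = 2 ∨ t = 3 ∨ t = -3 → T11 m t Y = 0 := by
      intro t ht
      have : ph1 m t = 0 := by unfold ph1; rcases ht with rfl | rfl | rfl | rfl <;> ring
      unfold T11; rw [this]; ring
    have zv : ∀ t : ℂ, t = 1 ∨ t = 2 ∨ t = 3 ∨ t = -3 → T31 m t Y = 0 := by
      intro t ht
      have : ph3 m t = 0 := by unfold ph3; rcases ht with rfl | rfl | rfl | rfl <;> ring
      unfold T31; rw [this]; ring
    have hA1 := Ev_nat hA 1 (by simp [Sb]; omega)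
    have hA2 := Ev_nat hA 2 (by simp [Sb]; omega)
    have hA3 := Ev_nat hA 3 (by simp [Sb]; omega)
    have r1 := R2 m Y
    have r2 := R3 m Y
    refine cast_cases3 (P := fun t => trm (fun X => T11 m X Y) A B 1 t + trm (fun X => T31 m X Y) A B 3 t = 0) hk ?_ ?_ ?_ ?_
    · simp only [trm, neg_zero]
      push_cast at hA1 hA3 ⊢
      rw [zero_sub, zero_sub, hA1, hA3]; ring_nf
    · simp only [trm, z (-1) (by simp), zv 1 (by simp)]
      push_cast at hA2 ⊢
      norm_num at hA2 ⊢
      rw [hA2]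
      linear_combination (A 2 - B 1) * r1
    · simp only [trm, z 2 (by simp), zv 2 (by simp)]
      push_cast at hA1 ⊢
      norm_num at hA1 ⊢
      rw [hA1]
      linear_combination -(A 1 - B 2) * r2
    · simp [trm, z 3, z (-3), zv 3, zv (-3)]

theorem groupC (m : ℕ) (hm : 1 ≤ m) (Y : ℂ) {F : ℂ → ℂ}
    (hF : Ev (Sb m) F) (dF : Differentiable ℂ F) :
    Good 3 (Sb m) (fun X => trm (fun X => T40 m X Y) F F 4 X
      + trm (fun X => T20 m X Y) F F 2 X) := by
  refine good_of_group (cond_ph4 m hm _ (fun X => 8 * pg2 m ((X + 3 * Y) / 2) *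
    pg2 m ((X - 3 * Y) / 2) * p3 Y * ch2 m ((X + Y) / 2) * ch2 m ((X - Y) / 2)) ?_ ?_)
    (cond_p2 m hm _ (fun X => 9 * m * (m + 1) * ((X + 7) * (X - 5) * (X + 2) * (X - 3)) * ph1 m ((X + 3 * Y) / 2) *
      ph1 m ((X - 3 * Y) / 2) * ch0 Y * ch1 m ((X + Y) / 2) * ch1 m ((X - Y) / 2)) ?_ ?_)
    (dT40 m (by fun_prop) (by fun_prop))
    (dT20 m (by fun_prop) (by fun_prop)) ?_ hF hF dF dF
  · funext X; unfold T40; ring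
  · have h1 := dph4 m; have h2 := dpg2 m; have h3 := dp3; have h4 := dch2 m
    fun_prop
  · funext X; unfold T20
    rw [show ph2 m X = ((X - 3 * m - 2) * (X + 1 - 3 * m) * (X - 2)) * ((X + 7) * (X - 5) * (X + 2) * (X - 3)) by unfold ph2; ring]
    ring
  · have h1 := dph1 m; have h2 := dph2 m; have h3 := dch0; have h4 := dch1 m
    fun_prop
  · intro A B hAB hA hB k hk
    obtain rfl := hAB rfl
    have z : ∀ t : ℂ, t = 1 ∨ t = 2 ∨ t = 3 → T40 m t Y = 0 := by
      intro t ht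
      have : ph4 m t = 0 := by unfold ph4; rcases ht with rfl | rfl | rfl <;> ring
      unfold T40; rw [this]; ring
    have zv : ∀ t : ℂ, t = 2 ∨ t = 3 ∨ t = -2 → T20 m t Y = 0 := by
      intro t ht
      have : ph2 m t = 0 := by unfold ph2; rcases ht with rfl | rfl | rfl <;> ring
      unfold T20; rw [this]; ring
    have hA1 := Ev_nat hA 1 (by simp [Sb]; omega)
    have hA2 := Ev_nat hA 2 (by simp [Sb]; omega)
    have hA3 := Ev_nat hA 3 (by simp [Sb]; omega)
    have r1 := R4 m Y
    have r2 := R5 m Y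
    refine cast_cases3 (P := fun t => trm (fun X => T40 m X Y) A A 4 t + trm (fun X => T20 m X Y) A A 2 t = 0) hk ?_ ?_ ?_ ?_
    · simp only [trm, neg_zero]
      push_cast at hA2 ⊢
      rw [zero_sub, zero_sub, hA2]
      have : T40 m 0 Y * A (-4) = T40 m 0 Y * A 4 := by
        by_cases h1 : m = 1
        · subst h1
          have : ph4 ((1 : ℕ) : ℂ) 0 = 0 := by unfold ph4; push_cast; ring
          unfold T40; rw [this]; ring
        · have hA4 := Ev_nat hA 4 (by simp [Sb]; omega)
          push_cast at hA4
          rw [hA4]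
      simp only [zero_add]
      linear_combination -this
    · simp only [trm, z 1 (by simp)]
      push_cast at hA1 hA3 ⊢
      norm_num at hA1 hA3 ⊢
      rw [hA1, hA3]
      linear_combination (A 3 - A 1) * r1
    · simp only [trm, z 2 (by simp), zv 2 (by simp), zv (-2) (by simp)]
      push_cast at hA2 ⊢
      norm_num at hA2 ⊢
      rw [hA2]; simp
    · simp only [trm, z 3 (by simp), zv 3 (by simp)]
      push_cast at hA1 ⊢
      norm_num at hA1 ⊢
      rw [hA1]
      linear_combination -(A 1 - A 3) * r2

/-- Divisibility-type facts in the first variable. -/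
theorem goodX (m : ℕ) (hm : 1 ≤ m) (μ : ℂ) (f : ℂ → ℂ → ℂ)
    (hd : ∀ Y, Differentiable ℂ (fun X => f X Y)) (he : ∀ Y, Ev (Sb m) (fun X => f X Y)) (Y : ℂ) :
    Good 3 (Sb m) (fun X => opE m μ f X Y) := by
  have A1 := groupA m hm Y (he (Y + 2)) (he Y) (hd _) (hd _)
  have A2 := groupA m hm (-Y) (he (Y - 2)) (he Y) (hd _) (hd _)
  have B1 := groupB m hm Y (he (Y + 1)) (he Y) (hd _) (hd _)
  have B2 := groupB m hm (-Y) (he (Y - 1)) (he Y) (hd _) (hd _)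
  have C1 := groupC m hm Y (he Y) (hd _)
  have D1 : Good 3 (Sb m) (fun X => Den X Y * f X Y) := by
    refine Good.den (D := fun X => Den X Y) (f0 := fun X => f X Y) (dDen (by fun_prop) (by fun_prop))
      (fun X => Den_oddX X Y) (fun k hk => ?_) (hd Y) (he Y)
    refine cast_cases3 (P := fun t => Den t Y = 0) hk ?_ ?_ ?_ ?_ <;> simp [Den, p7]
  have := (((((A1.add (A2.smul (-1))).add B1).add (B2.smul (-1))).add C1).add (D1.smul (-μ)))
  convert this using 1
  funext X
  simp only [opE, trm, T02_odd]
  push_cast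
  simp only [add_zero, sub_zero]
  ring
end

section
theorem cond_ch2 (m : ℕ) (_hm : 1 ≤ m) (u R : ℂ → ℂ) (hu : u = fun X => ch2 m X * R X)
    (hR : Differentiable ℂ R) : CondT 1 (Sa m) u 2 := by
  intro s hs
  constructor
  · by_cases hb : s + 2 ∈ Sa m
    · right; right; exact_mod_cast hb
    left
    have hc : s = m - 1 ∨ s = m := by
      simp only [Sa, Set.mem_ofPred_eq] at hs hb; omega
    have h1 : 1 ≤ s := by simp only [Sa, Set.mem_ofPred_eq] at hs; omega
    refine dbl_cases hu s hR s ?_ ?_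
    · unfold ch2
      rcases hc with hc | hc
      · have : (m : ℂ) = s + 1 := by norm_cast; omega
        simp [this]
      · simp [hc]
    · intro h3
      have : (m = 1 ∧ s = 1) ∨ (m = 2 ∧ s = 1) := by omega
      rcases this with ⟨rfl, rfl⟩ | ⟨rfl, rfl⟩
      · refine ⟨fun X => (X - 1) * X, by fun_prop, by simp, fun X => ?_⟩
        unfold ch2; push_cast; ring
      · refine ⟨fun X => (X - 1) * (X - 2), by fun_prop, by simp, fun X => ?_⟩
        unfold ch2; push_cast; ring
  · right
    simp only [Sa, Set.mem_ofPred_eq, InS] at hs ⊢; omega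

theorem cond_ch1 (m : ℕ) (_hm : 1 ≤ m) (u R : ℂ → ℂ) (hu : u = fun X => ch1 m X * R X)
    (hR : Differentiable ℂ R) : CondT 1 (Sa m) u 1 := by
  intro s hs
  constructor
  · by_cases hb : s + 1 ∈ Sa m
    · right; right; exact_mod_cast hb
    left
    have hc : s = m := by
      simp only [Sa, Set.mem_ofPred_eq] at hs hb; omega
    refine dbl_cases hu s hR s ?_ ?_
    · unfold ch1
      simp [hc]
    · intro h3
      have : (m = 1 ∧ s = 1) := by omega
      rcases this with ⟨rfl, rfl⟩
      refine ⟨fun X => (X - 1) * (X + 1), by fun_prop, by simp, fun X => ?_⟩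
      unfold ch1; push_cast; ring
  · right
    simp only [Sa, Set.mem_ofPred_eq, InS] at hs ⊢; omega

theorem cast_cases1 {k : ℕ} (hk : k ≤ 1) {P : ℂ → Prop} (h0 : P 0) (h1 : P 1) :
    P k := by
  have : k = 0 ∨ k = 1 := by omega
  rcases this with rfl | rfl
  · simpa using h0
  · simpa using h1

theorem zero_p2 (m : ℕ) (_hm : 1 ≤ m) (u R : ℂ → ℂ) (hu : u = fun X => ch2 m X * R X)
    {A : ℂ → ℂ} (hA : Ev (Sa m) A) : u 0 * A (-2) = u 0 * A 2 := by
  by_cases h1 : m = 1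
  · subst h1
    have : ch2 ((1 : ℕ) : ℂ) 0 = 0 := by unfold ch2; push_cast; ring
    rw [hu]; simp only [this]; ring
  · have hA4 := Ev_nat hA 2 (by simp [Sa]; omega)
    push_cast at hA4
    rw [hA4]

theorem group0 (m : ℕ) (hm : 1 ≤ m) (X : ℂ) {F : ℂ → ℂ}
    (hF : Ev (Sa m) F) (dF : Differentiable ℂ F) :
    Good 1 (Sa m) (fun Y => trm (fun Y => T02 m X Y) F F 2 Y + trm (fun _ => 0) F F 0 Y) := by
  have hu : (fun Y => T02 m X Y) = fun Y => ch2 m Y * (3 * m * (m + 1) * ph0 X *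
      ph3 m ((X + 3 * Y) / 2) * ph3 m ((3 * Y - X) / 2) * ch1 m ((X + Y) / 2) *
      ch1 m ((Y - X) / 2)) := by
    funext Y; unfold T02; ring
  refine good_of_group (cond_ch2 m hm _ _ hu ?_) (cond_p0 _ _ _)
    (dT02 m (by fun_prop) (by fun_prop)) (by fun_prop) ?_ hF hF dF dF
  · have h1 := dph3 m; have h2 := dph0; have h3 := dch2 m; have h4 := dch1 m
    fun_prop
  · intro A B hAB hA hB k hk
    obtain rfl := hAB rfl
    have hA1 := Ev_nat hA 1 (by simp [Sa]; omega)
    have z2 := zero_p2 m hm _ _ hu hA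
    have z1 : T02 m X 1 = 0 := by simp [T02, ch2]
    refine cast_cases1 (P := fun t => trm (fun Y => T02 m X Y) A A 2 t + trm (fun _ => 0) A A 0 t = 0) hk ?_ ?_
    · simp only [trm, neg_zero]
      push_cast
      rw [zero_sub, zero_add]
      linear_combination -z2
    · simp only [trm, z1]
      push_cast at hA1 ⊢
      norm_num at hA1 ⊢
      rw [hA1]; simp

theorem group2 (m : ℕ) (hm : 1 ≤ m) (X : ℂ) {F f0 : ℂ → ℂ}
    (hF : Ev (Sa m) F) (h0 : Ev (Sa m) f0) (dF : Differentiable ℂ F) (d0 : Differentiable ℂ f0) :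
    Good 1 (Sa m) (fun Y => trm (fun Y => T22 m X Y) F f0 2 Y
      + trm (fun Y => T20 m X Y / 2) F f0 0 Y) := by
  have hu : (fun Y => T22 m X Y) = fun Y => ch2 m Y * (8 * pg2 m X * ph4 m ((X + 3 * Y) / 2) *
      pg2 m ((3 * Y - X) / 2) * ch2 m ((X + Y) / 2) * p3 ((Y - X) / 2)) := by
    funext Y; unfold T22; ring
  have dv := dT20 m (a := fun _ => X) (b := fun Y => Y) (by fun_prop) (by fun_prop)
  refine good_of_group (cond_ch2 m hm _ _ hu ?_) (cond_p0 _ _ _)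
    (dT22 m (by fun_prop) (by fun_prop)) (by fun_prop) ?_ hF h0 dF d0
  · have h1 := dph4 m; have h2 := dpg2 m; have h3 := dp3; have h4 := dch2 m
    fun_prop
  · intro A B _ hA hB k hk
    have hA1 := Ev_nat hA 1 (by simp [Sa]; omega)
    have z2 := zero_p2 m hm _ _ hu hA
    have z1 : T22 m X 1 = 0 := by simp [T22, ch2]
    have z0 : T20 m X 0 = 0 := by simp [T20, ch0]
    have r := R6 m X
    have o := T20_odd m X 1
    refine cast_cases1 (P := fun t => trm (fun Y => T22 m X Y) A B 2 t + trm (fun Y => T20 m X Y / 2) A B 0 t = 0) hk ?_ ?_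
    · simp only [trm, neg_zero, z0]
      push_cast
      rw [zero_sub, zero_add]
      linear_combination -z2
    · simp only [trm, z1]
      push_cast at hA1 ⊢
      norm_num at hA1 ⊢
      rw [hA1]
      linear_combination (- (A 1 - B 1)) * r + ((A 1 - B 1)/2) * o

theorem group1 (m : ℕ) (hm : 1 ≤ m) (u R : ℂ → ℂ) (hu : u = fun X => ch1 m X * R X)
    (hR : Differentiable ℂ R) {F f0 : ℂ → ℂ}
    (hF : Ev (Sa m) F) (h0 : Ev (Sa m) f0) (dF : Differentiable ℂ F) (d0 : Differentiable ℂ f0) :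
    Good 1 (Sa m) (fun Y => trm u F f0 1 Y + trm (fun _ => 0) F f0 0 Y) := by
  refine good_of_group (cond_ch1 m hm _ _ hu hR) (cond_p0 _ _ _)
    (by rw [hu]; have := dch1 m; fun_prop) (by fun_prop) ?_ hF h0 dF d0
  intro A B _ hA hB k hk
  have hA1 := Ev_nat hA 1 (by simp [Sa]; omega)
  refine cast_cases1 (P := fun t => trm u A B 1 t + trm (fun _ => 0) A B 0 t = 0) hk ?_ ?_
  · simp only [trm, neg_zero]
    push_cast at hA1 ⊢
    rw [zero_sub, zero_add, hA1]; ring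
  · have z1 : u 1 = 0 := by simp [hu, ch1]
    have z2 : u (-1) = 0 := by simp [hu, ch1]
    simp [trm, z1, z2]

theorem group4 (m : ℕ) (v : ℂ → ℂ) (dv : Differentiable ℂ v) (v0 : v 0 = 0) (v1 : v 1 = 0)
    (v2 : v (-1) = 0) {F f0 : ℂ → ℂ}
    (hF : Ev (Sa m) F) (h0 : Ev (Sa m) f0) (dF : Differentiable ℂ F) (d0 : Differentiable ℂ f0) :
    Good 1 (Sa m) (fun Y => trm v F f0 0 Y + trm (fun _ => 0) F f0 0 Y) := by
  refine good_of_group (cond_p0 _ _ _) (cond_p0 _ _ _) dv (by fun_prop) ?_ hF h0 dF d0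
  intro A B _ hA hB k hk
  refine cast_cases1 (P := fun t => trm v A B 0 t + trm (fun _ => 0) A B 0 t = 0) hk ?_ ?_
  · simp [trm, v0]
  · simp [trm, v1, v2]

theorem goodY (m : ℕ) (hm : 1 ≤ m) (μ : ℂ) (f : ℂ → ℂ → ℂ)
    (hd : ∀ X, Differentiable ℂ (fun Y => f X Y)) (he : ∀ X, Ev (Sa m) (fun Y => f X Y)) (X : ℂ) :
    Good 1 (Sa m) (fun Y => opE m μ f X Y) := by
  have A0 := group0 m hm X (he X) (hd _)
  have A1 := group2 m hm X (he (X + 2)) (he X) (hd _) (hd _)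
  have A2 := group2 m hm (-X) (he (X - 2)) (he X) (hd _) (hd _)
  have h11 : ∀ X : ℂ, ∀ F f0 : ℂ → ℂ, Ev (Sa m) F → Ev (Sa m) f0 → Differentiable ℂ F →
      Differentiable ℂ f0 → Good 1 (Sa m) (fun Y => trm (fun Y => T11 m X Y) F f0 1 Y + trm (fun _ => 0) F f0 0 Y) := by
    intro X F f0 a b c d
    refine group1 m hm _ (fun Y => 9 * m * (m + 1) * ph1 m X * ph2 m ((X + 3 * Y) / 2) *
      ph1 m ((3 * Y - X) / 2) * ch1 m ((X + Y) / 2) * ch0 ((Y - X) / 2)) ?_ ?_ a b c d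
    · funext Y; unfold T11; ring
    · have h1 := dph1 m; have h2 := dph2 m; have h3 := dch0; have h4 := dch1 m
      fun_prop
  have h31 : ∀ X : ℂ, ∀ F f0 : ℂ → ℂ, Ev (Sa m) F → Ev (Sa m) f0 → Differentiable ℂ F →
      Differentiable ℂ f0 → Good 1 (Sa m) (fun Y => trm (fun Y => T31 m X Y) F f0 1 Y + trm (fun _ => 0) F f0 0 Y) := by
    intro X F f0 a b c d
    refine group1 m hm _ (fun Y => 3 * m * (m + 1) * ph3 m X * ph3 m ((X + 3 * Y) / 2) *
      ph0 ((X - 3 * Y) / 2) * ch2 m ((X + Y) / 2) * ch1 m ((X - Y) / 2)) ?_ ?_ a b c d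
    · funext Y; unfold T31; ring
    · have h1 := dph3 m; have h2 := dph0; have h3 := dch2 m; have h4 := dch1 m
      fun_prop
  have h40 : ∀ X : ℂ, ∀ F f0 : ℂ → ℂ, Ev (Sa m) F → Ev (Sa m) f0 → Differentiable ℂ F →
      Differentiable ℂ f0 → Good 1 (Sa m) (fun Y => trm (fun Y => T40 m X Y / 2) F f0 0 Y + trm (fun _ => 0) F f0 0 Y) := by
    intro X F f0 a b c d
    have dv := dT40 m (a := fun _ => X) (b := fun Y => Y) (by fun_prop) (by fun_prop)
    refine group4 m _ (by fun_prop) ?_ ?_ ?_ a b c d <;> simp [T40, p3]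
  have B1 := h11 X _ _ (he (X + 1)) (he X) (hd _) (hd _)
  have B2 := h11 (-X) _ _ (he (X - 1)) (he X) (hd _) (hd _)
  have C1 := h31 X _ _ (he (X + 3)) (he X) (hd _) (hd _)
  have C2 := h31 (-X) _ _ (he (X - 3)) (he X) (hd _) (hd _)
  have E1 := h40 X _ _ (he (X + 4)) (he X) (hd _) (hd _)
  have E2 := h40 (-X) _ _ (he (X - 4)) (he X) (hd _) (hd _)
  have D1 : Good 1 (Sa m) (fun Y => Den X Y * f X Y) := by
    refine Good.den (D := fun Y => Den X Y) (f0 := fun Y => f X Y) (dDen (by fun_prop) (by fun_prop))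
      (fun Y => Den_oddY X Y) (fun k hk => ?_) (hd X) (he X)
    refine cast_cases1 (P := fun t => Den X t = 0) hk ?_ ?_ <;> simp [Den, p3]
  have := ((((((((((A0.add A1).add (A2.smul (-1))).add B1).add (B2.smul (-1))).add C1).add
    (C2.smul (-1))).add E1).add (E2.smul (-1)))).add (D1.smul (-μ)))
  convert this using 1
  funext Y
  simp only [opE, trm, T20_odd, T40_odd]
  push_cast
  simp only [add_zero, sub_zero]
  ring
end

section
theorem c1 (m X Y : ℂ) : T22 m ((X - 3 * Y) / 2) ((X + Y) / 2) = T40 m X Y := by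
  unfold T22 T40; ring_nf
theorem c2 (m X Y : ℂ) : T22 m (-((X - 3 * Y) / 2)) ((X + Y) / 2) = - T22 m X Y := by
  unfold T22
  rw [show (Y - X) / 2 = -((X - Y) / 2) by ring, p3_odd]; ring_nf
theorem c3 (m X Y : ℂ) : T40 m (-((X - 3 * Y) / 2)) ((X + Y) / 2) = T22 m (-X) Y := by
  unfold T22 T40; ring_nf
theorem d1 (m X Y : ℂ) : T11 m ((X - 3 * Y) / 2) ((X + Y) / 2) = T20 m X Y := by
  unfold T11 T20; ring_nf
theorem d2 (m X Y : ℂ) : T11 m (-((X - 3 * Y) / 2)) ((X + Y) / 2) = - T11 m X Y := by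
  unfold T11
  rw [show (Y - X) / 2 = -((X - Y) / 2) by ring, ch0_odd]; ring_nf
theorem d3 (m X Y : ℂ) : T20 m (-((X - 3 * Y) / 2)) ((X + Y) / 2) = T11 m (-X) Y := by
  unfold T20 T11; ring_nf
theorem e1 (m X Y : ℂ) : T31 m (-((X - 3 * Y) / 2)) ((X + Y) / 2) = - T02 m X Y := by
  unfold T31 T02
  rw [show (-((X - 3 * Y) / 2) - 3 * ((X + Y) / 2)) / 2 = - X by ring, ph0_odd]; ring_nf
theorem e2 (m X Y : ℂ) : T02 m ((X - 3 * Y) / 2) ((X + Y) / 2) = T31 m X Y := by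
  unfold T31 T02; ring_nf
theorem e3 (m X Y : ℂ) : T31 m (-((X - 3 * Y) / 2)) (-((X + Y) / 2)) = - T31 m (-X) Y := by
  unfold T31
  rw [show (-((X - 3 * Y) / 2) - 3 * -((X + Y) / 2)) / 2 = -((-X - 3 * Y) / 2) by ring, ph0_odd]; ring_nf
theorem g1 (X Y : ℂ) : Den ((X - 3 * Y) / 2) ((X + Y) / 2) = Den X Y := by
  unfold Den
  rw [show ((X - 3 * Y) / 2 - 3 * ((X + Y) / 2)) / 2 = -((X + 3 * Y) / 2) by ring, p7_odd,
    show ((X - 3 * Y) / 2 - (X + Y) / 2) / 2 = - Y by ring, p3_odd]; ring_nf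

noncomputable def rot (f : ℂ → ℂ → ℂ) (X Y : ℂ) : ℂ := f ((X - 3 * Y) / 2) ((X + Y) / 2)

theorem opE_rot (m μ : ℂ) (f : ℂ → ℂ → ℂ) (X Y : ℂ) :
    opE m μ (rot f) X Y = rot (opE m μ f) X Y := by
  have nX : (-X - 3 * -Y) / 2 = -((X - 3 * Y) / 2) := by ring
  have nY : (-X + -Y) / 2 = -((X + Y) / 2) := by ring
  have h1 := c1 m (-X) (-Y); have h2 := c2 m (-X) (-Y); have h3 := c3 m (-X) (-Y)
  have k1 := d1 m (-X) (-Y); have k2 := d2 m (-X) (-Y); have k3 := d3 m (-X) (-Y)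
  have l1 := e1 m (-X) (-Y); have l2 := e2 m (-X) (-Y); have l3 := e3 m (-X) (-Y)
  rw [nX, nY] at h1 h2 h3 k1 k2 k3 l1 l2 l3
  simp only [neg_neg, T40_odd, T20_odd, T02_odd] at h1 h2 h3 k1 k2 k3 l1 l2 l3
  have h3' : T40 m ((X - 3 * Y) / 2) ((X + Y) / 2) = - T22 m X (-Y) := by rw [← h3, neg_neg]
  have k3' : T20 m ((X - 3 * Y) / 2) ((X + Y) / 2) = - T11 m X (-Y) := by rw [← k3, neg_neg]
  have l2' : T02 m ((X - 3 * Y) / 2) (-((X + Y) / 2)) = - T31 m (-X) (-Y) := by rw [← l2, neg_neg]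
  simp only [opE, rot, c1, c2, c3, d1, d2, d3, e1, e2, e3, g1, h1, h2, h3', k1, k2, k3', l1, l2', l3]
  rw [show (X + 4 - 3 * Y) / 2 = (X - 3 * Y) / 2 + 2 by ring,
    show (X - 4 - 3 * Y) / 2 = (X - 3 * Y) / 2 - 2 by ring,
    show (X + 4 + Y) / 2 = (X + Y) / 2 + 2 by ring,
    show (X - 4 + Y) / 2 = (X + Y) / 2 - 2 by ring,
    show (X + 2 - 3 * Y) / 2 = (X - 3 * Y) / 2 + 1 by ring,
    show (X - 2 - 3 * Y) / 2 = (X - 3 * Y) / 2 - 1 by ring,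
    show (X + 2 + Y) / 2 = (X + Y) / 2 + 1 by ring,
    show (X - 2 + Y) / 2 = (X + Y) / 2 - 1 by ring,
    show (X + 2 - 3 * (Y + 2)) / 2 = (X - 3 * Y) / 2 - 2 by ring,
    show (X - 2 - 3 * (Y + 2)) / 2 = (X - 3 * Y) / 2 - 4 by ring,
    show (X + 2 - 3 * (Y - 2)) / 2 = (X - 3 * Y) / 2 + 4 by ring,
    show (X - 2 - 3 * (Y - 2)) / 2 = (X - 3 * Y) / 2 + 2 by ring,
    show (X + 2 + (Y + 2)) / 2 = (X + Y) / 2 + 2 by ring,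
    show (X - 2 + (Y + 2)) / 2 = (X + Y) / 2 by ring,
    show (X + 2 + (Y - 2)) / 2 = (X + Y) / 2 by ring,
    show (X - 2 + (Y - 2)) / 2 = (X + Y) / 2 - 2 by ring,
    show (X + 1 - 3 * (Y + 1)) / 2 = (X - 3 * Y) / 2 - 1 by ring,
    show (X - 1 - 3 * (Y + 1)) / 2 = (X - 3 * Y) / 2 - 2 by ring,
    show (X + 1 - 3 * (Y - 1)) / 2 = (X - 3 * Y) / 2 + 2 by ring,
    show (X - 1 - 3 * (Y - 1)) / 2 = (X - 3 * Y) / 2 + 1 by ring,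
    show (X + 1 + (Y + 1)) / 2 = (X + Y) / 2 + 1 by ring,
    show (X - 1 + (Y + 1)) / 2 = (X + Y) / 2 by ring,
    show (X + 1 + (Y - 1)) / 2 = (X + Y) / 2 by ring,
    show (X - 1 + (Y - 1)) / 2 = (X + Y) / 2 - 1 by ring,
    show (X + 3 - 3 * (Y + 1)) / 2 = (X - 3 * Y) / 2 by ring,
    show (X - 3 - 3 * (Y + 1)) / 2 = (X - 3 * Y) / 2 - 3 by ring,
    show (X + 3 - 3 * (Y - 1)) / 2 = (X - 3 * Y) / 2 + 3 by ring,
    show (X - 3 - 3 * (Y - 1)) / 2 = (X - 3 * Y) / 2 by ring,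
    show (X + 3 + (Y + 1)) / 2 = (X + Y) / 2 + 2 by ring,
    show (X - 3 + (Y + 1)) / 2 = (X + Y) / 2 - 1 by ring,
    show (X + 3 + (Y - 1)) / 2 = (X + Y) / 2 + 1 by ring,
    show (X - 3 + (Y - 1)) / 2 = (X + Y) / 2 - 2 by ring,
    show (X - 3 * (Y + 2)) / 2 = (X - 3 * Y) / 2 - 3 by ring,
    show (X - 3 * (Y - 2)) / 2 = (X - 3 * Y) / 2 + 3 by ring,
    show (X + (Y + 2)) / 2 = (X + Y) / 2 + 1 by ring,
    show (X + (Y - 2)) / 2 = (X + Y) / 2 - 1 by ring]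
  have t1 := T40_odd m (-X) Y
  have t2 := T20_odd m (-X) Y
  have t3 := T02_odd m X (-Y)
  ring
end

section
structure Asy (d : ℕ) (F G : ℂ → ℂ → ℂ) : Prop where
  l : F ∈ QQ (d + 1)
  r : G ∈ QQ (d + 1)
  s : F - G ∈ QQ d

theorem Asy.symm {d F G} (h : Asy d F G) : Asy d G F :=
  ⟨h.r, h.l, by rw [← neg_sub]; exact (QQ d).neg_mem h.s⟩
theorem Asy.trans {d F G H} (h : Asy d F G) (h' : Asy d G H) : Asy d F H :=
  ⟨h.l, h'.r, by rw [← sub_add_sub_cancel F G H]; exact (QQ d).add_mem h.s h'.s⟩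
theorem Asy.mul {d e F G F' G'} (h : Asy d F G) (h' : Asy e F' G') : Asy (d + e) (F * F') (G * G') := by
  refine ⟨?_, ?_, ?_⟩
  · have := QQ_mul h.l h'.l
    rwa [show d + 1 + e = d + e + 1 by ring] at this
  · have := QQ_mul h.r h'.r
    rwa [show d + 1 + e = d + e + 1 by ring] at this
  · have e1 : F * F' - G * G' = (F - G) * F' + (F' - G') * G := by ring
    rw [e1]
    refine (QQ _).add_mem (QQ_mul h.s h'.l) ?_
    have := QQ_mul h'.s h.r
    rwa [add_comm] at this
theorem Asy.smul {d F G} (c : ℂ) (h : Asy d F G) : Asy d (c • F) (c • G) :=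
  ⟨(QQ _).smul_mem c h.l, (QQ _).smul_mem c h.r, by rw [← smul_sub]; exact (QQ _).smul_mem c h.s⟩
theorem Asy.comp {d F G} (h : Asy d F G) (a b c e : ℂ) :
    Asy d (fun X Y => F (a * X + b * Y) (c * X + e * Y)) (fun X Y => G (a * X + b * Y) (c * X + e * Y)) :=
  ⟨QQ_comp a b c e h.l, QQ_comp a b c e h.r, QQ_comp a b c e h.s⟩
theorem Asy.refl {d F} (h : F ∈ QQ (d + 1)) : Asy d F F := ⟨h, h, by simp⟩

theorem Asy_lin (a b c : ℂ) : Asy 1 (fun X Y => a * X + b * Y + c) (fun X Y => a * X + b * Y) := by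
  have h1 : (fun X Y : ℂ => a * X + b * Y) ∈ QQ 2 := HH_le 1 (HH_lin a b)
  have h2 : (fun X Y : ℂ => a * X + b * Y + c) - (fun X Y : ℂ => a * X + b * Y) ∈ QQ 1 := by
    have := QQ_const c
    convert this using 1
    funext X Y; simp
  refine ⟨?_, h1, h2⟩
  have := (QQ 2).add_mem h1 (QQ_mono (by norm_num) h2)
  convert this using 1
  funext X Y; simp

theorem Asy.pow {d F G} (h : Asy d F G) : ∀ n : ℕ, Asy (n * d) (F ^ n) (G ^ n)
  | 0 => by
    have : (1 : ℂ → ℂ → ℂ) ∈ QQ (0 + 1) := HH_le 0 HH_one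
    simpa using Asy.refl this
  | n + 1 => by
    have := (Asy.pow h n).mul h
    rwa [← pow_succ, ← pow_succ, show n * d + d = (n + 1) * d by ring] at this

theorem Asy_shift {d : ℕ} {F : ℂ → ℂ → ℂ} (hF : F ∈ QQ (d + 1)) (p q : ℂ) :
    Asy d (fun X Y => F (X + p) (Y + q)) F := by
  unfold QQ SP at hF
  induction hF using Submodule.span_induction with
  | mem x hx =>
    obtain ⟨⟨i, j⟩, hij, rfl⟩ := hx
    have hij' : i + j ≤ d := by
      have : i + j < d + 1 := hij
      omega
    have h1 := ((Asy_lin 1 0 p).pow i).mul ((Asy_lin 0 1 q).pow j)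
    have h2 : Asy (i + j) (fun X Y => (X + p) ^ i * (Y + q) ^ j) (fun X Y => X ^ i * Y ^ j) := by
      convert h1 using 1
      · ring
      · funext X Y; simp
      · funext X Y; simp
    exact ⟨QQ_mono (by omega) h2.l, QQ_mono (by omega) h2.r, QQ_mono hij' h2.s⟩
  | zero => exact ⟨(QQ _).zero_mem, (QQ _).zero_mem, by convert (QQ d).zero_mem using 1; funext X Y; simp⟩
  | add x y hx hy ihx ihy =>
    refine ⟨(QQ _).add_mem ihx.l ihy.l, (QQ _).add_mem ihx.r ihy.r, ?_⟩
    convert (QQ _).add_mem ihx.s ihy.s using 1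
    funext X Y; simp only [Pi.sub_apply, Pi.add_apply]; ring
  | smul c x hx ih =>
    refine ⟨(QQ _).smul_mem c ih.l, (QQ _).smul_mem c ih.r, ?_⟩
    convert (QQ _).smul_mem c ih.s using 1
    funext X Y; simp only [Pi.sub_apply, Pi.smul_apply, smul_eq_mul]; ring

def Mo (n : ℕ) (g : ℂ → ℂ) : Prop :=
  ∀ a b : ℂ, Asy n (fun X Y => g (a * X + b * Y)) (fun X Y => (a * X + b * Y) ^ n)

theorem Mo.mul {n k g h} (hg : Mo n g) (hh : Mo k h) : Mo (n + k) (fun t => g t * h t) := by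
  intro a b
  have := (hg a b).mul (hh a b)
  convert this using 1
  · funext X Y; simp only [Pi.mul_apply]
  · funext X Y; simp only [Pi.mul_apply, pow_add]

theorem Mo1 (c : ℂ) : Mo 1 (fun t => t + c) := by
  intro a b
  simpa using Asy_lin a b c

theorem Mo3 {g : ℂ → ℂ} (c1 c2 c3 : ℂ) (h : ∀ t, g t = (t + c1) * (t + c2) * (t + c3)) : Mo 3 g := by
  obtain rfl : g = fun t => (t + c1) * (t + c2) * (t + c3) := funext h
  exact ((Mo1 c1).mul (Mo1 c2)).mul (Mo1 c3)
theorem Mo7 {g : ℂ → ℂ} (c1 c2 c3 c4 c5 c6 c7 : ℂ) (h : ∀ t, g t = (t + c1) * (t + c2) * (t + c3)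
    * (t + c4) * (t + c5) * (t + c6) * (t + c7)) : Mo 7 g := by
  obtain rfl := funext h
  exact ((((((Mo1 c1).mul (Mo1 c2)).mul (Mo1 c3)).mul (Mo1 c4)).mul (Mo1 c5)).mul (Mo1 c6)).mul (Mo1 c7)

theorem Mo_p7 : Mo 7 p7 := Mo7 0 (-1) 1 (-2) 2 (-3) 3 (fun t => by unfold p7; ring)
theorem Mo_p3 : Mo 3 p3 := Mo3 0 (-1) 1 (fun t => by unfold p3; ring)
theorem Mo_ph4 (m : ℂ) : Mo 7 (ph4 m) := Mo7 (-3*m-2) (1-3*m) (-3*m) (3-3*m) (-1) (-2) (-3) (fun t => by unfold ph4; ring)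
theorem Mo_ph2 (m : ℂ) : Mo 7 (ph2 m) := Mo7 (-3*m-2) (1-3*m) 7 (-5) (-2) 2 (-3) (fun t => by unfold ph2; ring)
theorem Mo_pg2 (m : ℂ) : Mo 7 (pg2 m) := Mo7 (-3*m-2) (1-3*m) (-1) (-2) 2 (-3) 3 (fun t => by unfold pg2; ring)
theorem Mo_ph1 (m : ℂ) : Mo 7 (ph1 m) := Mo7 (-3*m-2) (3*m+2) (-3*m) 1 (-2) (-3) 3 (fun t => by unfold ph1; ring)
theorem Mo_ph3 (m : ℂ) : Mo 7 (ph3 m) := Mo7 (-3*m-2) (-3*m) (2-3*m) (-1) (-2) (-3) 3 (fun t => by unfold ph3; ring)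
theorem Mo_ph0 : Mo 7 ph0 := Mo7 (-7) 7 0 (-2) 2 (-3) 3 (fun t => by unfold ph0; ring)
theorem Mo_ch2 (m : ℂ) : Mo 3 (ch2 m) := Mo3 (-m) (1-m) (-1) (fun t => by unfold ch2; ring)
theorem Mo_ch1 (m : ℂ) : Mo 3 (ch1 m) := Mo3 (-m) (-1) 1 (fun t => by unfold ch1; ring)
theorem Mo_ch0 : Mo 3 ch0 := Mo3 0 (-5/3) (5/3) (fun t => by unfold ch0; ring)

/-- Leading term of the common denominator. -/
noncomputable def DenTop (X Y : ℂ) : ℂ := X ^ 7 * ((X + 3 * Y) / 2) ^ 7 * ((X - 3 * Y) / 2) ^ 7 *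
  Y ^ 3 * ((X + Y) / 2) ^ 3 * ((X - Y) / 2) ^ 3

theorem Asy_six {g1 g2 g3 h1 h2 h3 : ℂ → ℂ} (c : ℂ) (k1 : Mo 7 g1) (k2 : Mo 7 g2) (k3 : Mo 7 g3)
    (l1 : Mo 3 h1) (l2 : Mo 3 h2) (l3 : Mo 3 h3) :
    Asy 30 (fun X Y => c * g1 X * g2 ((X + 3 * Y) / 2) * g3 ((X - 3 * Y) / 2) * h1 Y * h2 ((X + Y) / 2) *
      h3 ((X - Y) / 2)) (c • DenTop) := by
  have := (((((((k1 1 0).mul (k2 (1/2) (3/2))).mul (k3 (1/2) (-3/2))).mul (l1 0 1)).mul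
    (l2 (1/2) (1/2))).mul (l3 (1/2) (-1/2)))).smul c
  convert this using 1
  · funext X Y
    simp only [Pi.smul_apply, Pi.mul_apply, smul_eq_mul]
    rw [show 1 * X + 0 * Y = X by ring, show 0 * X + 1 * Y = Y by ring,
      show 1/2 * X + 3/2 * Y = (X + 3 * Y) / 2 by ring, show 1/2 * X + -3/2 * Y = (X - 3 * Y) / 2 by ring,
      show 1/2 * X + 1/2 * Y = (X + Y) / 2 by ring, show 1/2 * X + -1/2 * Y = (X - Y) / 2 by ring]
    ring
  · funext X Y
    simp only [Pi.smul_apply, Pi.mul_apply, smul_eq_mul, DenTop]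
    rw [show 1 * X + 0 * Y = X by ring, show 0 * X + 1 * Y = Y by ring,
      show 1/2 * X + 3/2 * Y = (X + 3 * Y) / 2 by ring, show 1/2 * X + -3/2 * Y = (X - 3 * Y) / 2 by ring,
      show 1/2 * X + 1/2 * Y = (X + Y) / 2 by ring, show 1/2 * X + -1/2 * Y = (X - Y) / 2 by ring]

theorem Mo_neg7 {g : ℂ → ℂ} (h : Mo 7 g) : Mo 7 (fun t => - g (-t)) := by
  intro a b
  have := (h (-a) (-b)).smul (-1)
  convert this using 1
  · funext X Y
    simp only [Pi.smul_apply, smul_eq_mul]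
    rw [show -a * X + -b * Y = -(a * X + b * Y) by ring]; ring
  · funext X Y
    simp only [Pi.smul_apply, smul_eq_mul]; ring
theorem Mo_neg3 {g : ℂ → ℂ} (h : Mo 3 g) : Mo 3 (fun t => - g (-t)) := by
  intro a b
  have := (h (-a) (-b)).smul (-1)
  convert this using 1
  · funext X Y
    simp only [Pi.smul_apply, smul_eq_mul]
    rw [show -a * X + -b * Y = -(a * X + b * Y) by ring]; ring
  · funext X Y
    simp only [Pi.smul_apply, smul_eq_mul]; ring

theorem Asy_Den : Asy 30 Den DenTop := by
  have := Asy_six 1 Mo_p7 Mo_p7 Mo_p7 Mo_p3 Mo_p3 Mo_p3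
  convert this using 1
  · funext X Y; unfold Den; ring
  · simp

theorem Asy_fin {T : ℂ → ℂ → ℂ} {c : ℂ} (h : Asy 30 T (c • DenTop)) : Asy 30 T (c • Den) :=
  h.trans (Asy_Den.symm.smul c)

theorem Asy_T40 (m : ℂ) : Asy 30 (T40 m) ((8 : ℂ) • Den) :=
  Asy_fin (Asy_six 8 (Mo_ph4 m) (Mo_pg2 m) (Mo_pg2 m) Mo_p3 (Mo_ch2 m) (Mo_ch2 m))
theorem Asy_T20 (m : ℂ) : Asy 30 (T20 m) ((9 * m * (m + 1)) • Den) :=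
  Asy_fin (Asy_six _ (Mo_ph2 m) (Mo_ph1 m) (Mo_ph1 m) Mo_ch0 (Mo_ch1 m) (Mo_ch1 m))
theorem Asy_T31 (m : ℂ) : Asy 30 (T31 m) ((3 * m * (m + 1)) • Den) :=
  Asy_fin (Asy_six _ (Mo_ph3 m) (Mo_ph3 m) Mo_ph0 (Mo_ch1 m) (Mo_ch2 m) (Mo_ch1 m))
theorem Asy_T22 (m : ℂ) : Asy 30 (T22 m) ((8 : ℂ) • Den) := by
  have := Asy_fin (Asy_six 8 (Mo_pg2 m) (Mo_ph4 m) (Mo_neg7 (Mo_pg2 m)) (Mo_ch2 m) (Mo_ch2 m) (Mo_neg3 Mo_p3))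
  convert this using 1
  funext X Y; unfold T22
  rw [show -((X - 3 * Y) / 2) = (3 * Y - X) / 2 by ring, show -((X - Y) / 2) = (Y - X) / 2 by ring]; ring
theorem Asy_T11 (m : ℂ) : Asy 30 (T11 m) ((9 * m * (m + 1)) • Den) := by
  have := Asy_fin (Asy_six (9 * m * (m + 1)) (Mo_ph1 m) (Mo_ph2 m) (Mo_neg7 (Mo_ph1 m)) (Mo_ch1 m) (Mo_ch1 m) (Mo_neg3 Mo_ch0))
  convert this using 1
  funext X Y; unfold T11
  rw [show -((X - 3 * Y) / 2) = (3 * Y - X) / 2 by ring, show -((X - Y) / 2) = (Y - X) / 2 by ring]; ring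
theorem Asy_T02 (m : ℂ) : Asy 30 (T02 m) ((3 * m * (m + 1)) • Den) := by
  have := Asy_fin (Asy_six (3 * m * (m + 1)) Mo_ph0 (Mo_ph3 m) (Mo_neg7 (Mo_ph3 m)) (Mo_ch2 m) (Mo_ch1 m) (Mo_neg3 (Mo_ch1 m)))
  convert this using 1
  funext X Y; unfold T02
  rw [show -((X - 3 * Y) / 2) = (3 * Y - X) / 2 by ring, show -((X - Y) / 2) = (Y - X) / 2 by ring]; ring

/-- one term of the operator -/
theorem term_deg {D : ℕ} {T F0 : ℂ → ℂ → ℂ} {c : ℂ} (hT : Asy 30 T (c • Den)) (hF : F0 ∈ QQ (D + 1))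
    (p q e : ℂ) :
    (fun X Y => T X Y * (F0 (X + p) (Y + q) * e - F0 X Y) - c * (e - 1) * (Den X Y * F0 X Y)) ∈ QQ (D + 30) := by
  have h1 := (hT.mul (Asy_shift hF p q)).s
  have h2 := (hT.mul (Asy.refl hF)).s
  have := (QQ _).sub_mem ((QQ _).smul_mem e h1) h2
  rw [add_comm 30 D] at this
  convert this using 1
  funext X Y
  simp only [Pi.sub_apply, Pi.smul_apply, Pi.mul_apply, smul_eq_mul]; ring

theorem Asy_sgn {T : ℂ → ℂ → ℂ} {c : ℂ} (hT : Asy 30 T (c • Den)) :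
    Asy 30 (fun X Y => - T (-X) Y) (c • Den) ∧ Asy 30 (fun X Y => - T X (-Y)) (c • Den) ∧
    Asy 30 (fun X Y => T (-X) (-Y)) (c • Den) := by
  refine ⟨?_, ?_, ?_⟩
  · convert (hT.comp (-1) 0 0 1).smul (-1) using 1
    · funext X Y; simp
    · funext X Y; simp [Den_oddX]
  · convert (hT.comp 1 0 0 (-1)).smul (-1) using 1
    · funext X Y; simp
    · funext X Y; simp [Den_oddY]
  · convert (hT.comp (-1) 0 0 (-1)) using 1
    · funext X Y; simp
    · funext X Y; simp [Den_oddY, Den_oddX]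

/-- the eigenvalue in coordinates -/
noncomputable def muE (m a b : ℂ) : ℂ :=
  8 * (Complex.exp (4 * a) - 1) + 8 * (Complex.exp (-(4 * a)) - 1)
  + (9 * m * (m + 1) * (Complex.exp (2 * a) - 1) + 9 * m * (m + 1) * (Complex.exp (-(2 * a)) - 1))
  + (8 * (Complex.exp (2 * a + 2 * b) - 1) + 8 * (Complex.exp (-(2 * a) + 2 * b) - 1)
    + 8 * (Complex.exp (2 * a - 2 * b) - 1) + 8 * (Complex.exp (-(2 * a) - 2 * b) - 1))
  + (9 * m * (m + 1) * (Complex.exp (a + b) - 1) + 9 * m * (m + 1) * (Complex.exp (-a + b) - 1)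
    + 9 * m * (m + 1) * (Complex.exp (a - b) - 1) + 9 * m * (m + 1) * (Complex.exp (-a - b) - 1))
  + (3 * m * (m + 1) * (Complex.exp (3 * a + b) - 1) + 3 * m * (m + 1) * (Complex.exp (-(3 * a) + b) - 1)
    + 3 * m * (m + 1) * (Complex.exp (3 * a - b) - 1) + 3 * m * (m + 1) * (Complex.exp (-(3 * a) - b) - 1))
  + (3 * m * (m + 1) * (Complex.exp (2 * b) - 1) + 3 * m * (m + 1) * (Complex.exp (-(2 * b)) - 1))

theorem opE_deg (m a b : ℂ) {D : ℕ} {F0 : ℂ → ℂ → ℂ} (hF : F0 ∈ QQ (D + 1)) :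
    ∃ F ∈ QQ (D + 30), ∀ X Y, opE m (muE m a b) (fun X Y => F0 X Y * Complex.exp (a * X + b * Y)) X Y
      = F X Y * Complex.exp (a * X + b * Y) := by
  have t40 := Asy_T40 m
  have t20 := Asy_T20 m
  have t22 := Asy_T22 m
  have t11 := Asy_T11 m
  have t31 := Asy_T31 m
  have t02 := Asy_T02 m
  have M := fun {x y} => @Submodule.add_mem ℂ _ _ _ _ (QQ (D + 30)) x y
  refine ⟨_, M (M (M (M (M (M (M (M (M (M (M (M (M (M (M (M (M
    (term_deg t40 hF 4 0 (Complex.exp (4 * a))) (term_deg (Asy_sgn t40).1 hF (-4) 0 (Complex.exp (-(4 * a)))))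
    (term_deg t20 hF 2 0 (Complex.exp (2 * a)))) (term_deg (Asy_sgn t20).1 hF (-2) 0 (Complex.exp (-(2 * a)))))
    (term_deg t22 hF 2 2 (Complex.exp (2 * a + 2 * b))))
    (term_deg (Asy_sgn t22).1 hF (-2) 2 (Complex.exp (-(2 * a) + 2 * b))))
    (term_deg (Asy_sgn t22).2.1 hF 2 (-2) (Complex.exp (2 * a - 2 * b))))
    (term_deg (Asy_sgn t22).2.2 hF (-2) (-2) (Complex.exp (-(2 * a) - 2 * b))))
    (term_deg t11 hF 1 1 (Complex.exp (a + b))))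
    (term_deg (Asy_sgn t11).1 hF (-1) 1 (Complex.exp (-a + b))))
    (term_deg (Asy_sgn t11).2.1 hF 1 (-1) (Complex.exp (a - b))))
    (term_deg (Asy_sgn t11).2.2 hF (-1) (-1) (Complex.exp (-a - b))))
    (term_deg t31 hF 3 1 (Complex.exp (3 * a + b))))
    (term_deg (Asy_sgn t31).1 hF (-3) 1 (Complex.exp (-(3 * a) + b))))
    (term_deg (Asy_sgn t31).2.1 hF 3 (-1) (Complex.exp (3 * a - b))))
    (term_deg (Asy_sgn t31).2.2 hF (-3) (-1) (Complex.exp (-(3 * a) - b))))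
    (term_deg t02 hF 0 2 (Complex.exp (2 * b))))
    (term_deg (Asy_sgn t02).2.1 hF 0 (-2) (Complex.exp (-(2 * b)))), fun X Y => ?_⟩
  simp only [Pi.add_apply, opE, muE]
  rw [show a * (X + 4) + b * Y = 4 * a + (a * X + b * Y) by ring,
    show a * (X - 4) + b * Y = -(4 * a) + (a * X + b * Y) by ring,
    show a * (X + 2) + b * Y = 2 * a + (a * X + b * Y) by ring,
    show a * (X - 2) + b * Y = -(2 * a) + (a * X + b * Y) by ring,
    show a * (X + 2) + b * (Y + 2) = (2 * a + 2 * b) + (a * X + b * Y) by ring,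
    show a * (X - 2) + b * (Y + 2) = (-(2 * a) + 2 * b) + (a * X + b * Y) by ring,
    show a * (X + 2) + b * (Y - 2) = (2 * a - 2 * b) + (a * X + b * Y) by ring,
    show a * (X - 2) + b * (Y - 2) = (-(2 * a) - 2 * b) + (a * X + b * Y) by ring,
    show a * (X + 1) + b * (Y + 1) = (a + b) + (a * X + b * Y) by ring,
    show a * (X - 1) + b * (Y + 1) = (-a + b) + (a * X + b * Y) by ring,
    show a * (X + 1) + b * (Y - 1) = (a - b) + (a * X + b * Y) by ring,
    show a * (X - 1) + b * (Y - 1) = (-a - b) + (a * X + b * Y) by ring,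
    show a * (X + 3) + b * (Y + 1) = (3 * a + b) + (a * X + b * Y) by ring,
    show a * (X - 3) + b * (Y + 1) = (-(3 * a) + b) + (a * X + b * Y) by ring,
    show a * (X + 3) + b * (Y - 1) = (3 * a - b) + (a * X + b * Y) by ring,
    show a * (X - 3) + b * (Y - 1) = (-(3 * a) - b) + (a * X + b * Y) by ring,
    show a * X + b * (Y + 2) = 2 * b + (a * X + b * Y) by ring,
    show a * X + b * (Y - 2) = -(2 * b) + (a * X + b * Y) by ring]
  simp only [Complex.exp_add _ (a * X + b * Y), ← sub_eq_add_neg, add_zero]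
  generalize Complex.exp (a * X + b * Y) = E
  generalize muE m a b = M
  ring
end

section
section
open Polynomial

/-- The polynomial with simple roots at the integers between `-r` and `r`. -/
noncomputable def zp (r : ℕ) : ℂ[X] := ∏ k ∈ Finset.Icc (-(r : ℤ)) r, (X - C (k : ℂ))

theorem zp_deg (r : ℕ) : (zp r).natDegree = 2 * r + 1 := by
  unfold zp
  rw [natDegree_prod_of_monic _ _ (fun k _ => monic_X_sub_C _)]
  simp only [natDegree_X_sub_C, Finset.sum_const, Int.card_Icc, smul_eq_mul, mul_one]
  omega

theorem zp_ne (r : ℕ) : zp r ≠ 0 := by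
  unfold zp
  exact (monic_prod_of_monic _ _ (fun k _ => monic_X_sub_C _)).ne_zero

theorem zp_odd (r : ℕ) (x : ℂ) : (zp r).eval (-x) = -(zp r).eval x := by
  unfold zp
  rw [eval_prod, eval_prod]
  have h1 : ∏ k ∈ Finset.Icc (-(r : ℤ)) r, eval x (X - C (k : ℂ))
      = ∏ k ∈ Finset.Icc (-(r : ℤ)) r, eval x (X - C ((-k : ℤ) : ℂ)) := by
    refine Finset.prod_nbij' (fun k => -k) (fun k => -k) ?_ ?_ ?_ ?_ ?_
    · intro k hk; simp only [Finset.mem_Icc] at hk ⊢; omega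
    · intro k hk; simp only [Finset.mem_Icc] at hk ⊢; omega
    · intro k _; simp
    · intro k _; simp
    · intro k _; simp
  rw [h1]
  have h2 : ∀ k : ℤ, eval (-x) (X - C (k : ℂ)) = (-1) * eval x (X - C ((-k : ℤ) : ℂ)) := by
    intro k; simp; ring
  simp only [h2]
  rw [Finset.prod_mul_distrib, Finset.prod_const, Int.card_Icc]
  rw [show ((r : ℤ) + 1 - -(r : ℤ)).toNat = 2 * r + 1 by omega]
  rw [pow_succ, pow_mul]; norm_num

theorem zp_root (r s : ℕ) (h : (zp r).eval (s : ℂ) = 0) : s ≤ r := by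
  unfold zp at h
  rw [eval_prod, Finset.prod_eq_zero_iff] at h
  obtain ⟨k, hk, h⟩ := h
  simp only [eval_sub, eval_X, eval_C, sub_eq_zero] at h
  have : (s : ℤ) = k := by exact_mod_cast h
  simp only [Finset.mem_Icc] at hk; omega

theorem zp_sep (r : ℕ) (x : ℂ) : (zp r).eval x ≠ 0 ∨ (zp r).derivative.eval x ≠ 0 := by
  have h : (zp r).Separable := by
    unfold zp
    rw [separable_prod_X_sub_C_iff']
    intro a _ b _ hab
    exact_mod_cast hab
  obtain ⟨a, b, hab⟩ := h
  by_contra hc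
  push Not at hc
  have := congrArg (eval x) hab
  simp [hc.1, hc.2] at this

theorem zp_dvd (r : ℕ) (f : ℂ[X]) (h : ∀ k ∈ (Finset.Icc (-(r : ℤ)) r).image (fun k : ℤ => (k : ℂ)), f.eval k = 0) :
    zp r ∣ f := by
  unfold zp
  refine Finset.prod_dvd_of_coprime ?_ ?_
  · intro a _ b _ hab
    exact pairwise_coprime_X_sub_C (s := fun k : ℤ => (k : ℂ)) (fun a b h => Int.cast_injective h) hab
  · intro k hk
    rw [dvd_iff_isRoot]
    exact h _ (Finset.mem_image_of_mem _ hk)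

theorem dirG (r M : ℕ) (S : Set ℕ) (hr : ∀ s, 1 ≤ s → s ≤ r → s ∈ S) (a b : ℂ)
    (core : ∀ g : ℂ[X], g.degree < M →
      (∀ s ∈ S, g.eval (s : ℂ) * Complex.exp (a * s) = g.eval (-(s : ℂ)) * Complex.exp (-(a * s))) → g = 0)
    (F T : ℂ → ℂ → ℂ) (d : ℕ) (hT : T ∈ HH d) (hFT : F - T ∈ QQ d)
    (h : ∀ Y, Good r S (fun X => F X Y * Complex.exp (a * X + b * Y))) :
    ∃ N, ∃ G ∈ QQ N, ∀ X Y, T X Y = X ^ (M + (2 * r + 1)) * G X Y := by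
  refine dir_lemma (zp r) (2 * r + 1) M (zp_deg r) (zp_ne r) (zp_odd r)
    ((Finset.Icc (-(r : ℤ)) r).image (fun k : ℤ => (k : ℂ))) (zp_dvd r) S (fun s _ => zp_sep r s) a b core F T d
    hT hFT ?_ ?_ ?_
  · intro k0 hk0 Y
    obtain ⟨k, hk, rfl⟩ := Finset.mem_image.1 hk0
    rw [Finset.mem_Icc] at hk
    have key : ∀ n : ℕ, n ≤ r → F n Y = 0 := fun n hn => by
      have := (h Y).z n hn
      simpa [Complex.exp_ne_zero] using this
    obtain ⟨n, rfl | rfl⟩ := k.eq_nat_or_neg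
    · exact_mod_cast key n (by omega)
    · rcases Nat.eq_zero_or_pos n with rfl | hn
      · simpa using key 0 (by omega)
      · have h1 := (h Y).v n (hr n hn (by omega))
        have h2 := (h Y).z n (by omega)
        rw [h2, zero_add] at h1
        push_cast
        simpa [Complex.exp_ne_zero] using h1
  · intro s hs Y; exact (h Y).v s hs
  · intro s hs h0 Y; exact (h Y).d s hs (zp_root r s h0)

theorem dirX (m : ℕ) (hm : 1 ≤ m) (a b : ℂ) (ha : Complex.sinh a ≠ 0) (ha2 : Complex.sinh (2 * a) ≠ 0)
    (F T : ℂ → ℂ → ℂ) (d : ℕ) (hT : T ∈ HH d) (hFT : F - T ∈ QQ d)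
    (h : ∀ Y, Good 3 (Sb m) (fun X => F X Y * Complex.exp (a * X + b * Y))) :
    ∃ N, ∃ G ∈ QQ N, ∀ X Y, T X Y = X ^ (3 * m + 8) * G X Y := by
  refine dirG 3 (3 * m + 1) (Sb m) ?_ a b ?_ F T d hT hFT h
  · intro s h1 h2; left; omega
  · intro g hg hs
    exact core_beta a ha ha2 (3 * m) g hg hs

theorem dirY (m : ℕ) (hm : 1 ≤ m) (a b : ℂ) (hb : Complex.sinh b ≠ 0)
    (F T : ℂ → ℂ → ℂ) (d : ℕ) (hT : T ∈ HH d) (hFT : F - T ∈ QQ d)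
    (h : ∀ X, Good 1 (Sa m) (fun Y => F X Y * Complex.exp (a * X + b * Y))) :
    ∃ N, ∃ G ∈ QQ N, ∀ X Y, T X Y = Y ^ (m + 3) * G X Y := by
  have hT' := HH_comp 0 1 1 0 hT
  have hFT' := QQ_comp 0 1 1 0 hFT
  obtain ⟨N, G, hG, hG2⟩ := dirG 1 m (Sa m) (fun s h1 h2 => ⟨h1, h2.trans hm⟩) b a
    (fun g hg hs => core_alpha b hb m g hg (fun s h1 h2 => hs s ⟨h1, h2⟩))
    (fun X Y => F (0 * X + 1 * Y) (1 * X + 0 * Y)) _ d hT' hFT' (fun X => by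
      have := h X
      simpa [add_comm] using this)
  refine ⟨N, _, QQ_comp 0 1 1 0 hG, fun X Y => ?_⟩
  have := hG2 Y X
  simpa using this

theorem line_dvd {N e : ℕ} {G : ℂ → ℂ → ℂ} (hG : G ∈ QQ N) (ρ c α β γ δ : ℂ) (w : ℂ[X])
    (h : ∀ r, w.eval r = (c * (r - ρ)) ^ e * G (α * r + β) (γ * r + δ)) : (X - C ρ) ^ e ∣ w := by
  obtain ⟨v, hv⟩ := QQ_line hG α β γ δ
  refine ⟨C (c ^ e) * v, Polynomial.funext fun r => ?_⟩
  rw [h]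
  simp [hv, mul_pow]
  ring

theorem six_dvd (w : ℂ[X]) (n k : ℕ) (hw : w.natDegree < 3 * n + 3 * k)
    (h1 : (X - C 0) ^ n ∣ w) (h2 : (X - C (-3/7)) ^ n ∣ w) (h3 : (X - C (-3/5)) ^ n ∣ w)
    (h4 : (X - C (-1/2)) ^ k ∣ w) (h5 : (X - C (-1)) ^ k ∣ w) (h6 : (X - C (-1/3)) ^ k ∣ w) : w = 0 := by
  by_contra hw0
  set ρ : Fin 6 → ℂ := ![0, -3/7, -3/5, -1/2, -1, -1/3] with hρ
  set e : Fin 6 → ℕ := ![n, n, n, k, k, k] with he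
  have hinj : Function.Injective ρ := by
    intro i j hij
    fin_cases i <;> fin_cases j <;> first | rfl | (exfalso; revert hij; simp [hρ]; try norm_num)
  have hd : ∏ i, (X - C (ρ i)) ^ e i ∣ w := by
    refine Fintype.prod_dvd_of_coprime ?_ ?_
    · intro i j hij
      exact (pairwise_coprime_X_sub_C hinj hij).pow
    · intro i
      fin_cases i
      · exact h1
      · exact h2
      · exact h3
      · exact h4
      · exact h5
      · exact h6
  have := natDegree_le_of_dvd hd hw0
  rw [natDegree_prod_of_monic _ _ (fun i _ => (monic_X_sub_C _).pow _)] at this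
  simp only [natDegree_pow, natDegree_X_sub_C, mul_one, Fin.sum_univ_succ, he] at this
  simp at this
  omega

/-- Multiplication by an exponential. -/
noncomputable def emul (a b : ℂ) (F : ℂ → ℂ → ℂ) (X Y : ℂ) : ℂ := F X Y * Complex.exp (a * X + b * Y)

theorem rot_emul (a b : ℂ) (F : ℂ → ℂ → ℂ) : rot (emul a b F) = emul ((a + b) / 2) ((b - 3 * a) / 2) (rot F) := by
  funext X Y
  simp only [rot, emul]
  congr 2; ring

theorem rot_QQ {d : ℕ} {F : ℂ → ℂ → ℂ} (h : F ∈ QQ d) : rot F ∈ QQ d := by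
  convert QQ_comp (1/2) (-3/2) (1/2) (1/2) h using 1
  funext X Y; simp only [rot]; congr 1 <;> ring

theorem rot_HH {d : ℕ} {F : ℂ → ℂ → ℂ} (h : F ∈ HH d) : rot F ∈ HH d := by
  convert HH_comp (1/2) (-3/2) (1/2) (1/2) h using 1
  funext X Y; simp only [rot]; congr 1 <;> ring

theorem rot_sub (F G : ℂ → ℂ → ℂ) : rot F - rot G = rot (F - G) := by
  funext X Y; simp [rot]

theorem QQ_diffX {d : ℕ} {F : ℂ → ℂ → ℂ} (h : F ∈ QQ d) (a b Y : ℂ) : Differentiable ℂ (fun X => emul a b F X Y) := by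
  obtain ⟨w, hw⟩ := QQ_line h 1 0 0 Y
  have : (fun X => emul a b F X Y) = fun X => w.eval X * Complex.exp (a * X + b * Y) := by
    funext X; rw [hw]; simp [emul]
  rw [this]
  exact w.differentiable.mul (by fun_prop)

theorem QQ_diffY {d : ℕ} {F : ℂ → ℂ → ℂ} (h : F ∈ QQ d) (a b X : ℂ) : Differentiable ℂ (fun Y => emul a b F X Y) := by
  obtain ⟨w, hw⟩ := QQ_line h 0 X 1 0
  have : (fun Y => emul a b F X Y) = fun Y => w.eval Y * Complex.exp (a * X + b * Y) := by
    funext X; rw [hw]; simp [emul]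
  rw [this]
  exact w.differentiable.mul (by fun_prop)

theorem vanish (m : ℕ) (hm : 1 ≤ m) (a b a1 b1 a2 b2 : ℂ)
    (ha : Complex.sinh a ≠ 0) (ha' : Complex.sinh (2 * a) ≠ 0) (hb : Complex.sinh b ≠ 0)
    (ha1 : Complex.sinh a1 ≠ 0) (ha1' : Complex.sinh (2 * a1) ≠ 0) (hb1 : Complex.sinh b1 ≠ 0)
    (ha2 : Complex.sinh a2 ≠ 0) (ha2' : Complex.sinh (2 * a2) ≠ 0) (hb2 : Complex.sinh b2 ≠ 0)
    (F : ℂ → ℂ → ℂ)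
    (g0 : ∀ Y, Good 3 (Sb m) (fun X => emul a b F X Y))
    (k0 : ∀ X, Good 1 (Sa m) (fun Y => emul a b F X Y))
    (g1 : ∀ Y, Good 3 (Sb m) (fun X => emul a1 b1 (rot F) X Y))
    (k1 : ∀ X, Good 1 (Sa m) (fun Y => emul a1 b1 (rot F) X Y))
    (g2 : ∀ Y, Good 3 (Sb m) (fun X => emul a2 b2 (rot (rot F)) X Y))
    (k2 : ∀ X, Good 1 (Sa m) (fun Y => emul a2 b2 (rot (rot F)) X Y)) :
    ∀ d ≤ 12 * m + 33, F ∈ QQ d → F = 0 := by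
  intro d
  induction d with
  | zero => intro _ h; exact QQ_zero h
  | succ d ih =>
    intro hd hF
    refine ih (by omega) ?_
    obtain ⟨T, hT, hFT⟩ := QQ_split hF
    have hT1 := rot_HH hT
    have hT2 := rot_HH hT1
    have hF1 := rot_QQ hFT
    have hF2 := rot_QQ hF1
    rw [← rot_sub] at hF1 hF2
    obtain ⟨N1, G1, hG1, e1⟩ := dirX m hm a b ha ha' F T d hT hFT g0
    obtain ⟨N2, G2, hG2, e2⟩ := dirY m hm a b hb F T d hT hFT k0
    obtain ⟨N3, G3, hG3, e3⟩ := dirX m hm a1 b1 ha1 ha1' _ _ d hT1 hF1 g1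
    obtain ⟨N4, G4, hG4, e4⟩ := dirY m hm a1 b1 hb1 _ _ d hT1 hF1 k1
    obtain ⟨N5, G5, hG5, e5⟩ := dirX m hm a2 b2 ha2 ha2' _ _ d hT2 hF2 g2
    obtain ⟨N6, G6, hG6, e6⟩ := dirY m hm a2 b2 hb2 _ _ d hT2 hF2 k2
    obtain ⟨w, hwd, hw⟩ := HH_line hT 1 0 2 1
    have hw' : ∀ r, w.eval r = T r (2 * r + 1) := fun r => by rw [hw]; simp
    have r1 : ∀ x y, T x y = rot T ((x + 3 * y) / 2) ((y - x) / 2) := fun x y => by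
      simp only [rot]; congr 1 <;> ring
    have r2 : ∀ x y, T x y = rot (rot T) ((3 * y - x) / 2) (-(x + y) / 2) := fun x y => by
      simp only [rot]; congr 1 <;> ring
    have hw0 : w = 0 := by
      apply six_dvd w (3 * m + 8) (m + 3) (by omega)
      · refine line_dvd hG1 0 1 1 0 2 1 w (fun r => ?_)
        rw [hw', e1]; congr 2 <;> ring
      · refine line_dvd hG3 (-3/7) (7/2) (7/2) (3/2) (1/2) (1/2) w (fun r => ?_)
        rw [hw', r1, e3]; congr 2 <;> ring
      · refine line_dvd hG5 (-3/5) (5/2) (5/2) (3/2) (-3/2) (-1/2) w (fun r => ?_)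
        rw [hw', r2, e5]; congr 2 <;> ring
      · refine line_dvd hG2 (-1/2) 2 1 0 2 1 w (fun r => ?_)
        rw [hw', e2]; congr 2 <;> ring
      · refine line_dvd hG4 (-1) (1/2) (7/2) (3/2) (1/2) (1/2) w (fun r => ?_)
        rw [hw', r1, e4]; congr 2 <;> ring
      · refine line_dvd hG6 (-1/3) (-3/2) (5/2) (3/2) (-3/2) (-1/2) w (fun r => ?_)
        rw [hw', r2, e6]; congr 2 <;> ring
    have hT0 : T = 0 := HH_zero_of_line hT (fun r => by rw [← hw', hw0]; simp)
    rwa [hT0, sub_zero] at hFT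

theorem opE_zero (m : ℕ) (hm : 1 ≤ m) (a b : ℂ)
    (ha : Complex.sinh a ≠ 0) (ha' : Complex.sinh (2 * a) ≠ 0) (hb : Complex.sinh b ≠ 0)
    (ha1 : Complex.sinh ((a + b) / 2) ≠ 0) (ha1' : Complex.sinh (2 * ((a + b) / 2)) ≠ 0)
    (hb1 : Complex.sinh ((b - 3 * a) / 2) ≠ 0)
    (ha2 : Complex.sinh ((b - a) / 2) ≠ 0) (ha2' : Complex.sinh (2 * ((b - a) / 2)) ≠ 0)
    (hb2 : Complex.sinh (-(3 * a + b) / 2) ≠ 0)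
    (F0 : ℂ → ℂ → ℂ) (hF0 : F0 ∈ QQ (12 * m + 3 + 1)) (f : ℂ → ℂ → ℂ) (hf : f = emul a b F0)
    (g0 : ∀ Y, Ev (Sb m) (fun X => f X Y)) (k0 : ∀ X, Ev (Sa m) (fun Y => f X Y))
    (g1 : ∀ Y, Ev (Sb m) (fun X => rot f X Y)) (k1 : ∀ X, Ev (Sa m) (fun Y => rot f X Y))
    (g2 : ∀ Y, Ev (Sb m) (fun X => rot (rot f) X Y)) (k2 : ∀ X, Ev (Sa m) (fun Y => rot (rot f) X Y))
    (X Y : ℂ) : opE m (muE m a b) f X Y = 0 := by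
  obtain ⟨F, hF, hFe⟩ := opE_deg m a b hF0
  set μ := muE (m : ℂ) a b
  have E0 : opE m μ f = emul a b F := by
    funext X Y; rw [hf]; exact hFe X Y
  have q1 : rot f = emul ((a + b) / 2) ((b - 3 * a) / 2) (rot F0) := by rw [hf, rot_emul]
  have q2 : rot (rot f) = emul ((b - a) / 2) (-(3 * a + b) / 2) (rot (rot F0)) := by
    rw [q1, rot_emul]; congr 1 <;> ring
  have E1 : opE m μ (rot f) = emul ((a + b) / 2) ((b - 3 * a) / 2) (rot F) := by
    rw [← rot_emul, ← E0]; funext X Y; exact opE_rot m μ f X Y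
  have E2 : opE m μ (rot (rot f)) = emul ((b - a) / 2) (-(3 * a + b) / 2) (rot (rot F)) := by
    have : emul ((b - a) / 2) (-(3 * a + b) / 2) (rot (rot F)) = rot (emul ((a + b) / 2) ((b - 3 * a) / 2) (rot F)) := by
      rw [rot_emul]; congr 1 <;> ring
    rw [this, ← E1]; funext X Y; exact opE_rot m μ (rot f) X Y
  have hR1 := rot_QQ hF0
  have hR2 := rot_QQ hR1
  have hFz : F = 0 := by
    refine vanish m hm a b ((a + b) / 2) ((b - 3 * a) / 2) ((b - a) / 2) (-(3 * a + b) / 2)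
      ha ha' hb ha1 ha1' hb1 ha2 ha2' hb2 F ?_ ?_ ?_ ?_ ?_ ?_ (12 * m + 3 + 30) (by omega) hF
    · intro Y; rw [← E0]; exact goodX m hm μ f (fun Y => by rw [hf]; exact QQ_diffX hF0 _ _ _) g0 Y
    · intro X; rw [← E0]; exact goodY m hm μ f (fun Y => by rw [hf]; exact QQ_diffY hF0 _ _ _) k0 X
    · intro Y; rw [← E1]; exact goodX m hm μ _ (fun Y => by rw [q1]; exact QQ_diffX hR1 _ _ _) g1 Y
    · intro X; rw [← E1]; exact goodY m hm μ _ (fun Y => by rw [q1]; exact QQ_diffY hR1 _ _ _) k1 X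
    · intro Y; rw [← E2]; exact goodX m hm μ _ (fun Y => by rw [q2]; exact QQ_diffX hR2 _ _ _) g2 Y
    · intro X; rw [← E2]; exact goodY m hm μ _ (fun Y => by rw [q2]; exact QQ_diffY hR2 _ _ _) k2 X
  rw [E0, hFz]; simp [emul]
end
end

section
noncomputable section
open Complex

def V (X Y : ℂ) : Fin 2 → ℂ := ![X, rt3 * Y]

theorem rt3_sq : rt3 * rt3 = 3 := by
  unfold rt3
  rw [← Complex.ofReal_mul, Real.mul_self_sqrt (by norm_num)]; norm_num
theorem rt3_ne : rt3 ≠ 0 := by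
  intro h
  have := rt3_sq
  rw [h] at this; norm_num at this

theorem bilV (a b c d : ℂ) : bil (V a b) (V c d) = a * c + 3 * (b * d) := by
  simp only [bil, V, Matrix.cons_val_zero, Matrix.cons_val_one]
  linear_combination (b * d) * rt3_sq

theorem V_inj (a b c d : ℂ) : V a b = V c d ↔ a = c ∧ b = d := by
  constructor
  · intro h
    have h0 := congrFun h 0
    have h1 := congrFun h 1
    simp only [V, Matrix.cons_val_zero, Matrix.cons_val_one] at h0 h1
    exact ⟨h0, mul_left_cancel₀ rt3_ne h1⟩
  · rintro ⟨rfl, rfl⟩; rfl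

theorem V_smul (c a b : ℂ) : c • V a b = V (c * a) (c * b) := by
  funext i; fin_cases i <;> simp [V]; ring
theorem V_neg (a b : ℂ) : - V a b = V (-a) (-b) := by
  funext i; fin_cases i <;> simp [V]
theorem V_add (a b c d : ℂ) : V a b + V c d = V (a + c) (b + d) := by
  funext i; fin_cases i <;> simp [V]; ring
theorem V_sub (a b c d : ℂ) : V a b - V c d = V (a - c) (b - d) := by
  funext i; fin_cases i <;> simp [V]; ring
theorem V_surj (z : Fin 2 → ℂ) : V (z 0) (z 1 / rt3) = z := by
  funext i; fin_cases i
  · simp [V]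
  · simp [V, mul_div_cancel₀ _ rt3_ne]

theorem va1 : vα₁ = V 0 1 := by simp [vα₁, V]
theorem va2 : vα₂ = V (-3/2) (1/2) := by simp [vα₂, V]; constructor <;> ring
theorem va3 : vα₃ = V (3/2) (1/2) := by simp [vα₃, V]; try ring
theorem vb1 : vβ₁ = V 1 0 := by simp [vβ₁, V]
theorem vb2 : vβ₂ = V (1/2) (1/2) := by simp [vβ₂, V]; try ring
theorem vb3 : vβ₃ = V (-1/2) (1/2) := by simp [vβ₃, V]; constructor <;> ring

theorem short_eq : shortRoots = [V 1 0, V (1/2) (1/2), V (-1/2) (1/2), V (-1) 0, V (-1/2) (-1/2), V (1/2) (-1/2)] := by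
  simp only [shortRoots, vb1, vb2, vb3, V_neg]; norm_num
theorem long_eq : longRoots = [V 0 1, V (-3/2) (1/2), V (3/2) (1/2), V 0 (-1), V (3/2) (-1/2), V (-3/2) (-1/2)] := by
  simp only [longRoots, va1, va2, va3, V_neg]; norm_num
theorem four_eq : fourShort = [V 4 0, V 2 2, V (-2) 2, V (-4) 0, V (-2) (-2), V 2 (-2)] := by
  simp only [fourShort, short_eq, List.map, V_smul]; norm_num
theorem twoS_eq : twoShort = [V 2 0, V 1 1, V (-1) 1, V (-2) 0, V (-1) (-1), V 1 (-1)] := by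
  simp only [twoShort, short_eq, List.map, V_smul]; norm_num
theorem twoL_eq : twoLong = [V 0 2, V (-3) 1, V 3 1, V 0 (-2), V 3 (-1), V (-3) (-1)] := by
  simp only [twoLong, long_eq, List.map, V_smul]; norm_num
theorem twoAG_eq : twoAG2 = [V 0 2, V (-3) 1, V 3 1, V 0 (-2), V 3 (-1), V (-3) (-1),
    V 2 0, V 1 1, V (-1) 1, V (-2) 0, V (-1) (-1), V 1 (-1),
    V 4 0, V 2 2, V (-2) 2, V (-4) 0, V (-2) (-2), V 2 (-2)] := by
  have : twoG2 = twoLong ++ twoShort := by simp [twoG2, G2all, twoLong, twoShort]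
  rw [twoAG2, this, four_eq, twoS_eq, twoL_eq]; rfl

theorem lam_four (m : ℕ) (τ) (h : τ ∈ fourShort) : lamD2 m τ = 8 := by
  have h1 := h
  rw [four_eq] at h1
  rw [lamD2, if_pos h]
  simp only [List.mem_cons, List.not_mem_nil, or_false] at h1
  rcases h1 with rfl | rfl | rfl | rfl | rfl | rfl <;> rw [V_smul, bilV] <;> norm_num
theorem lam_twoS (m : ℕ) (τ) (h : τ ∈ twoShort) : lamD2 m τ = 9 * m * (m + 1) := by
  have h1 := h
  rw [twoS_eq] at h1
  have h2 : τ ∉ fourShort := by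
    rw [four_eq]
    simp only [List.mem_cons, List.not_mem_nil, or_false] at h1 ⊢
    rcases h1 with rfl | rfl | rfl | rfl | rfl | rfl <;> norm_num [V_inj]
  rw [lamD2, if_neg h2, if_pos h]
  simp only [List.mem_cons, List.not_mem_nil, or_false] at h1
  rcases h1 with rfl | rfl | rfl | rfl | rfl | rfl <;> rw [V_smul, bilV] <;> norm_num
theorem twoL_not (τ) (h : τ ∈ twoLong) : τ ∉ fourShort ∧ τ ∉ twoShort := by
  rw [twoL_eq] at h
  rw [four_eq, twoS_eq]
  simp only [List.mem_cons, List.not_mem_nil, or_false] at h ⊢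
  rcases h with rfl | rfl | rfl | rfl | rfl | rfl <;> norm_num [V_inj]
theorem lam_twoL (m : ℕ) (τ) (h : τ ∈ twoLong) : lamD2 m τ = 3 * m * (m + 1) := by
  rw [lamD2, if_neg (twoL_not τ h).1, if_neg (twoL_not τ h).2]
  rw [twoL_eq] at h
  simp only [List.mem_cons, List.not_mem_nil, or_false] at h
  rcases h with rfl | rfl | rfl | rfl | rfl | rfl <;> rw [V_smul, bilV] <;> ring

end
end

section
noncomputable section
open Complex

theorem bil_xV (x : Fin 2 → ℂ) (p q : ℂ) : bil x (V p q) = x 0 * p + rt3 * x 1 * q := by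
  simp only [bil, V, Matrix.cons_val_zero, Matrix.cons_val_one]; ring

theorem mu_eq (m : ℕ) (x : Fin 2 → ℂ) : muD2 m x = muE m (x 0) (rt3 * x 1) := by
  have f : ∀ τ ∈ [V 4 0, V 2 2, V (-2) 2, V (-4) 0, V (-2) (-2), V 2 (-2)], lamD2 m τ = 8 := by
    rw [← four_eq]; exact lam_four m
  have s : ∀ τ ∈ [V 2 0, V 1 1, V (-1) 1, V (-2) 0, V (-1) (-1), V 1 (-1)], lamD2 m τ = 9 * m * (m + 1) := by
    rw [← twoS_eq]; exact lam_twoS m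
  have l : ∀ τ ∈ [V 0 2, V (-3) 1, V 3 1, V 0 (-2), V 3 (-1), V (-3) (-1)], lamD2 m τ = 3 * m * (m + 1) := by
    rw [← twoL_eq]; exact lam_twoL m
  simp only [List.forall_mem_cons, List.not_mem_nil, false_imp_iff, implies_true, and_true] at f s l
  obtain ⟨f1, f2, f3, f4, f5, f6⟩ := f
  obtain ⟨s1, s2, s3, s4, s5, s6⟩ := s
  obtain ⟨l1, l2, l3, l4, l5, l6⟩ := l
  rw [muD2, twoAG_eq]
  simp only [List.map, List.sum_cons, List.sum_nil, f1, f2, f3, f4, f5, f6, s1, s2, s3, s4, s5, s6,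
    l1, l2, l3, l4, l5, l6, bil_xV]
  unfold muE
  ring_nf

def L2 (m t : ℂ) : ℂ := (1 - m * 3 / t) * (1 - m * 3 / (t + 3))
def L1 (m t : ℂ) : ℂ := 1 - m * 3 / t
def L0 (t : ℂ) : ℂ := (1 - 2 / 3 * 3 / (t - 3)) * (1 - 2 / 3 * 3 / (-t - 3))
def S2 (m t : ℂ) : ℂ := (1 - (3 * m + 2) / t) * (1 - 3 * m / (t + 1))
def S1 (m t : ℂ) : ℂ := (1 - (3 * m + 2) / t) * (1 + 3 * m / (t + 2)) * (1 - (3 * m - 1) / (t - 1))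
def S3 (m t : ℂ) : ℂ := (1 - (3 * m + 2) / t) * (1 - (3 * m + 1) / (t + 1)) * (1 - 3 * m / (t + 2))
def S0 (t : ℂ) : ℂ := (1 - 6 / (t - 1)) * (1 - 6 / (-t - 1))
def S4 (m t : ℂ) : ℂ := (1 - (3 * m + 2) / t) * (1 - 3 * m / (t + 1)) * (1 - (3 * m + 2) / (t + 2)) * (1 - 3 * m / (t + 3))
def SS2 (m t : ℂ) : ℂ := (1 - (3 * m + 2) / t) * (1 - 3 * m / (t + 1)) * (1 + 4 / (t + 3)) * (1 - 4 / (t - 1))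

theorem L0_even (t : ℂ) : L0 (-t) = L0 t := by simp only [L0, neg_neg]; ring
theorem S0_even (t : ℂ) : S0 (-t) = S0 t := by simp only [S0, neg_neg]; ring

def A40 (m X Y : ℂ) : ℂ := 8 * S4 m X * S2 m ((X + 3 * Y) / 2) * S2 m ((X - 3 * Y) / 2)
  * L2 m (3 * ((X + Y) / 2)) * L2 m (3 * ((X - Y) / 2))
def A22 (m X Y : ℂ) : ℂ := 8 * S2 m X * S4 m ((X + 3 * Y) / 2) * S2 m ((3 * Y - X) / 2)
  * L2 m (3 * Y) * L2 m (3 * ((X + Y) / 2))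
def A20 (m X Y : ℂ) : ℂ := 9 * m * (m + 1) * SS2 m X * S1 m ((X + 3 * Y) / 2) * S1 m ((X - 3 * Y) / 2)
  * L0 (3 * Y) * L1 m (3 * ((X + Y) / 2)) * L1 m (3 * ((X - Y) / 2))
def A11 (m X Y : ℂ) : ℂ := 9 * m * (m + 1) * S1 m X * SS2 m ((X + 3 * Y) / 2) * S1 m ((3 * Y - X) / 2)
  * L1 m (3 * Y) * L1 m (3 * ((X + Y) / 2)) * L0 (3 * ((Y - X) / 2))
def A02 (m X Y : ℂ) : ℂ := 3 * m * (m + 1) * S0 X * S3 m ((X + 3 * Y) / 2) * S3 m ((3 * Y - X) / 2)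
  * L2 m (3 * Y) * L1 m (3 * ((X + Y) / 2)) * L1 m (3 * ((Y - X) / 2))
def A31 (m X Y : ℂ) : ℂ := 3 * m * (m + 1) * S3 m X * S3 m ((X + 3 * Y) / 2) * S0 ((X - 3 * Y) / 2)
  * L1 m (3 * Y) * L2 m (3 * ((X + Y) / 2)) * L1 m (3 * ((X - Y) / 2))

open scoped Classical in
theorem four_form (m : ℕ) (τ h g1 g2 g3 g4 z : Fin 2 → ℂ) (hτ : τ ∈ fourShort) (hh : (4⁻¹ : ℂ) • τ = h)
    (n0 : bil h h = 1) (n1 : bil g1 g1 = 3) (n2 : bil g2 g2 = 3) (n3 : bil g3 g3 = 1) (n4 : bil g4 g4 = 1)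
    (f1 : longRoots.filter (fun γ => bil τ γ = 2 * bil γ γ) = [g1, g2])
    (f2 : shortRoots.filter (fun γ => bil τ γ = 2 * bil γ γ) = [g3, g4]) :
    aD2 m τ z = 8 * (L2 m (bil g1 z) * L2 m (bil g2 z)) * (S2 m (bil g3 z) * S2 m (bil g4 z)) * S4 m (bil h z) := by
  rw [aD2, if_pos hτ]
  simp only [hh, f1, f2, List.map, List.prod_cons, List.prod_nil, n0, n1, n2, n3, n4, mul_one, L2, S2, S4]

open scoped Classical in
theorem twoS_form (m : ℕ) (τ h g0 g0' g1 g2 g3 g4 z : Fin 2 → ℂ) (hτ : τ ∈ twoShort) (hτ' : τ ∉ fourShort)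
    (hh : (2⁻¹ : ℂ) • τ = h) (n0 : bil h h = 1) (n1 : bil g1 g1 = 3) (n2 : bil g2 g2 = 3)
    (n3 : bil g3 g3 = 1) (n4 : bil g4 g4 = 1) (n5 : bil g0 g0 = 3) (n6 : bil g0' g0' = 3)
    (n7 : bil g0' z = - bil g0 z)
    (f0 : longRoots.filter (fun γ => bil τ γ = 0) = [g0, g0'])
    (f1 : longRoots.filter (fun γ => bil τ γ = bil γ γ) = [g1, g2])
    (f2 : shortRoots.filter (fun γ => bil τ γ = bil γ γ) = [g3, g4]) :
    aD2 m τ z = 9 * m * (m + 1) * L0 (bil g0 z) * (L1 m (bil g1 z) * L1 m (bil g2 z)) *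
      (S1 m (bil g3 z) * S1 m (bil g4 z)) * SS2 m (bil h z) := by
  rw [aD2, if_neg hτ', if_pos hτ]
  simp only [hh, f0, f1, f2, List.map, List.prod_cons, List.prod_nil, n0, n1, n2, n3, n4, n5, n6, n7, mul_one,
    L0, L1, S1, SS2]

open scoped Classical in
theorem twoL_form (m : ℕ) (τ h g0 g0' g1 g2 g3 g4 z : Fin 2 → ℂ) (hτ : τ ∈ twoLong)
    (hh : (2⁻¹ : ℂ) • τ = h) (n0 : bil h h = 3) (n1 : bil g1 g1 = 3) (n2 : bil g2 g2 = 3)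
    (n3 : bil g3 g3 = 1) (n4 : bil g4 g4 = 1) (n5 : bil g0 g0 = 1) (n6 : bil g0' g0' = 1)
    (n7 : bil g0' z = - bil g0 z)
    (f0 : shortRoots.filter (fun γ => bil τ γ = 0) = [g0, g0'])
    (f1 : longRoots.filter (fun γ => bil τ γ = bil γ γ) = [g1, g2])
    (f2 : shortRoots.filter (fun γ => bil τ γ = 3 * bil γ γ) = [g3, g4]) :
    aD2 m τ z = m * (m + 1) * 3 * (S3 m (bil g3 z) * S3 m (bil g4 z)) * S0 (bil g0 z) *
      (L1 m (bil g1 z) * L1 m (bil g2 z)) * L2 m (bil h z) := by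
  rw [aD2, if_neg (twoL_not τ hτ).1, if_neg (twoL_not τ hτ).2]
  simp only [hh, f0, f1, f2, List.map, List.prod_cons, List.prod_nil, n0, n1, n2, n3, n4, n5, n6, n7, mul_one,
    L1, L2, S3, S0]

theorem evA40pp (m : ℕ) (X Y : ℂ) : aD2 m (V 4 0) (V X Y) = A40 m X Y := by
  rw [four_form m (V 4 0) (V 1 0) (V (3/2) (1/2)) (V (3/2) (-1/2)) (V (1/2) (1/2)) (V (1/2) (-1/2)) (V X Y)
    (by rw [four_eq]; simp) (by rw [V_smul]; norm_num)
    (by norm_num [bilV]) (by norm_num [bilV]) (by norm_num [bilV]) (by norm_num [bilV]) (by norm_num [bilV])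
    (by rw [long_eq]; norm_num [List.filter_cons, bilV]) (by rw [short_eq]; norm_num [List.filter_cons, bilV])]
  simp only [bilV, A40]; ring_nf

theorem evA40np (m : ℕ) (X Y : ℂ) : aD2 m (V (-4) 0) (V X Y) = A40 m (-X) Y := by
  rw [four_form m (V (-4) 0) (V (-1) 0) (V (-3/2) (1/2)) (V (-3/2) (-1/2)) (V (-1/2) (1/2)) (V (-1/2) (-1/2)) (V X Y)
    (by rw [four_eq]; simp) (by rw [V_smul]; norm_num)
    (by norm_num [bilV]) (by norm_num [bilV]) (by norm_num [bilV]) (by norm_num [bilV]) (by norm_num [bilV])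
    (by rw [long_eq]; norm_num [List.filter_cons, bilV]) (by rw [short_eq]; norm_num [List.filter_cons, bilV])]
  simp only [bilV, A40]; ring_nf

theorem evA22pp (m : ℕ) (X Y : ℂ) : aD2 m (V 2 2) (V X Y) = A22 m X Y := by
  rw [four_form m (V 2 2) (V (1/2) (1/2)) (V 0 1) (V (3/2) (1/2)) (V 1 0) (V (-1/2) (1/2)) (V X Y)
    (by rw [four_eq]; simp) (by rw [V_smul]; norm_num)
    (by norm_num [bilV]) (by norm_num [bilV]) (by norm_num [bilV]) (by norm_num [bilV]) (by norm_num [bilV])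
    (by rw [long_eq]; norm_num [List.filter_cons, bilV]) (by rw [short_eq]; norm_num [List.filter_cons, bilV])]
  simp only [bilV, A22]; ring_nf

theorem evA22pn (m : ℕ) (X Y : ℂ) : aD2 m (V 2 (-2)) (V X Y) = A22 m X (-Y) := by
  rw [four_form m (V 2 (-2)) (V (1/2) (-1/2)) (V 0 (-1)) (V (3/2) (-1/2)) (V 1 0) (V (-1/2) (-1/2)) (V X Y)
    (by rw [four_eq]; simp) (by rw [V_smul]; norm_num)
    (by norm_num [bilV]) (by norm_num [bilV]) (by norm_num [bilV]) (by norm_num [bilV]) (by norm_num [bilV])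
    (by rw [long_eq]; norm_num [List.filter_cons, bilV]) (by rw [short_eq]; norm_num [List.filter_cons, bilV])]
  simp only [bilV, A22]; ring_nf

theorem evA22np (m : ℕ) (X Y : ℂ) : aD2 m (V (-2) 2) (V X Y) = A22 m (-X) Y := by
  rw [four_form m (V (-2) 2) (V (-1/2) (1/2)) (V 0 1) (V (-3/2) (1/2)) (V (1/2) (1/2)) (V (-1) 0) (V X Y)
    (by rw [four_eq]; simp) (by rw [V_smul]; norm_num)
    (by norm_num [bilV]) (by norm_num [bilV]) (by norm_num [bilV]) (by norm_num [bilV]) (by norm_num [bilV])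
    (by rw [long_eq]; norm_num [List.filter_cons, bilV]) (by rw [short_eq]; norm_num [List.filter_cons, bilV])]
  simp only [bilV, A22]; ring_nf

theorem evA22nn (m : ℕ) (X Y : ℂ) : aD2 m (V (-2) (-2)) (V X Y) = A22 m (-X) (-Y) := by
  rw [four_form m (V (-2) (-2)) (V (-1/2) (-1/2)) (V 0 (-1)) (V (-3/2) (-1/2)) (V (-1) 0) (V (1/2) (-1/2)) (V X Y)
    (by rw [four_eq]; simp) (by rw [V_smul]; norm_num)
    (by norm_num [bilV]) (by norm_num [bilV]) (by norm_num [bilV]) (by norm_num [bilV]) (by norm_num [bilV])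
    (by rw [long_eq]; norm_num [List.filter_cons, bilV]) (by rw [short_eq]; norm_num [List.filter_cons, bilV])]
  simp only [bilV, A22]; ring_nf

theorem evA20pp (m : ℕ) (X Y : ℂ) : aD2 m (V 2 0) (V X Y) = A20 m X Y := by
  rw [twoS_form m (V 2 0) (V 1 0) (V 0 1) (V 0 (-1)) (V (3/2) (1/2)) (V (3/2) (-1/2)) (V (1/2) (1/2)) (V (1/2) (-1/2)) (V X Y)
    (by rw [twoS_eq]; simp) (by rw [four_eq]; norm_num [V_inj]) (by rw [V_smul]; norm_num)
    (by norm_num [bilV]) (by norm_num [bilV]) (by norm_num [bilV]) (by norm_num [bilV]) (by norm_num [bilV]) (by norm_num [bilV]) (by norm_num [bilV]) (by simp only [bilV]; ring)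
    (by rw [long_eq]; norm_num [List.filter_cons, bilV]) (by rw [long_eq]; norm_num [List.filter_cons, bilV]) (by rw [short_eq]; norm_num [List.filter_cons, bilV])]
  simp only [bilV, A20]; ring_nf

theorem evA20np (m : ℕ) (X Y : ℂ) : aD2 m (V (-2) 0) (V X Y) = A20 m (-X) Y := by
  rw [twoS_form m (V (-2) 0) (V (-1) 0) (V 0 1) (V 0 (-1)) (V (-3/2) (1/2)) (V (-3/2) (-1/2)) (V (-1/2) (1/2)) (V (-1/2) (-1/2)) (V X Y)
    (by rw [twoS_eq]; simp) (by rw [four_eq]; norm_num [V_inj]) (by rw [V_smul]; norm_num)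
    (by norm_num [bilV]) (by norm_num [bilV]) (by norm_num [bilV]) (by norm_num [bilV]) (by norm_num [bilV]) (by norm_num [bilV]) (by norm_num [bilV]) (by simp only [bilV]; ring)
    (by rw [long_eq]; norm_num [List.filter_cons, bilV]) (by rw [long_eq]; norm_num [List.filter_cons, bilV]) (by rw [short_eq]; norm_num [List.filter_cons, bilV])]
  simp only [bilV, A20]; ring_nf

theorem evA11pp (m : ℕ) (X Y : ℂ) : aD2 m (V 1 1) (V X Y) = A11 m X Y := by
  rw [twoS_form m (V 1 1) (V (1/2) (1/2)) (V (-3/2) (1/2)) (V (3/2) (-1/2)) (V 0 1) (V (3/2) (1/2)) (V 1 0) (V (-1/2) (1/2)) (V X Y)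
    (by rw [twoS_eq]; simp) (by rw [four_eq]; norm_num [V_inj]) (by rw [V_smul]; norm_num)
    (by norm_num [bilV]) (by norm_num [bilV]) (by norm_num [bilV]) (by norm_num [bilV]) (by norm_num [bilV]) (by norm_num [bilV]) (by norm_num [bilV]) (by simp only [bilV]; ring)
    (by rw [long_eq]; norm_num [List.filter_cons, bilV]) (by rw [long_eq]; norm_num [List.filter_cons, bilV]) (by rw [short_eq]; norm_num [List.filter_cons, bilV])]
  simp only [bilV, A11]; ring_nf

theorem evA11pn (m : ℕ) (X Y : ℂ) : aD2 m (V 1 (-1)) (V X Y) = A11 m X (-Y) := by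
  rw [twoS_form m (V 1 (-1)) (V (1/2) (-1/2)) (V (3/2) (1/2)) (V (-3/2) (-1/2)) (V 0 (-1)) (V (3/2) (-1/2)) (V 1 0) (V (-1/2) (-1/2)) (V X Y)
    (by rw [twoS_eq]; simp) (by rw [four_eq]; norm_num [V_inj]) (by rw [V_smul]; norm_num)
    (by norm_num [bilV]) (by norm_num [bilV]) (by norm_num [bilV]) (by norm_num [bilV]) (by norm_num [bilV]) (by norm_num [bilV]) (by norm_num [bilV]) (by simp only [bilV]; ring)
    (by rw [long_eq]; norm_num [List.filter_cons, bilV]) (by rw [long_eq]; norm_num [List.filter_cons, bilV]) (by rw [short_eq]; norm_num [List.filter_cons, bilV]), ← L0_even]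
  simp only [bilV, A11]; ring_nf

theorem evA11np (m : ℕ) (X Y : ℂ) : aD2 m (V (-1) 1) (V X Y) = A11 m (-X) Y := by
  rw [twoS_form m (V (-1) 1) (V (-1/2) (1/2)) (V (3/2) (1/2)) (V (-3/2) (-1/2)) (V 0 1) (V (-3/2) (1/2)) (V (1/2) (1/2)) (V (-1) 0) (V X Y)
    (by rw [twoS_eq]; simp) (by rw [four_eq]; norm_num [V_inj]) (by rw [V_smul]; norm_num)
    (by norm_num [bilV]) (by norm_num [bilV]) (by norm_num [bilV]) (by norm_num [bilV]) (by norm_num [bilV]) (by norm_num [bilV]) (by norm_num [bilV]) (by simp only [bilV]; ring)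
    (by rw [long_eq]; norm_num [List.filter_cons, bilV]) (by rw [long_eq]; norm_num [List.filter_cons, bilV]) (by rw [short_eq]; norm_num [List.filter_cons, bilV])]
  simp only [bilV, A11]; ring_nf

theorem evA11nn (m : ℕ) (X Y : ℂ) : aD2 m (V (-1) (-1)) (V X Y) = A11 m (-X) (-Y) := by
  rw [twoS_form m (V (-1) (-1)) (V (-1/2) (-1/2)) (V (-3/2) (1/2)) (V (3/2) (-1/2)) (V 0 (-1)) (V (-3/2) (-1/2)) (V (-1) 0) (V (1/2) (-1/2)) (V X Y)
    (by rw [twoS_eq]; simp) (by rw [four_eq]; norm_num [V_inj]) (by rw [V_smul]; norm_num)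
    (by norm_num [bilV]) (by norm_num [bilV]) (by norm_num [bilV]) (by norm_num [bilV]) (by norm_num [bilV]) (by norm_num [bilV]) (by norm_num [bilV]) (by simp only [bilV]; ring)
    (by rw [long_eq]; norm_num [List.filter_cons, bilV]) (by rw [long_eq]; norm_num [List.filter_cons, bilV]) (by rw [short_eq]; norm_num [List.filter_cons, bilV]), ← L0_even]
  simp only [bilV, A11]; ring_nf

theorem evA02pp (m : ℕ) (X Y : ℂ) : aD2 m (V 0 2) (V X Y) = A02 m X Y := by
  rw [twoL_form m (V 0 2) (V 0 1) (V 1 0) (V (-1) 0) (V (-3/2) (1/2)) (V (3/2) (1/2)) (V (1/2) (1/2)) (V (-1/2) (1/2)) (V X Y)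
    (by rw [twoL_eq]; simp) (by rw [V_smul]; norm_num)
    (by norm_num [bilV]) (by norm_num [bilV]) (by norm_num [bilV]) (by norm_num [bilV]) (by norm_num [bilV]) (by norm_num [bilV]) (by norm_num [bilV]) (by simp only [bilV]; ring)
    (by rw [short_eq]; norm_num [List.filter_cons, bilV]) (by rw [long_eq]; norm_num [List.filter_cons, bilV]) (by rw [short_eq]; norm_num [List.filter_cons, bilV])]
  simp only [bilV, A02]; ring_nf

theorem evA02pn (m : ℕ) (X Y : ℂ) : aD2 m (V 0 (-2)) (V X Y) = A02 m X (-Y) := by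
  rw [twoL_form m (V 0 (-2)) (V 0 (-1)) (V 1 0) (V (-1) 0) (V (3/2) (-1/2)) (V (-3/2) (-1/2)) (V (-1/2) (-1/2)) (V (1/2) (-1/2)) (V X Y)
    (by rw [twoL_eq]; simp) (by rw [V_smul]; norm_num)
    (by norm_num [bilV]) (by norm_num [bilV]) (by norm_num [bilV]) (by norm_num [bilV]) (by norm_num [bilV]) (by norm_num [bilV]) (by norm_num [bilV]) (by simp only [bilV]; ring)
    (by rw [short_eq]; norm_num [List.filter_cons, bilV]) (by rw [long_eq]; norm_num [List.filter_cons, bilV]) (by rw [short_eq]; norm_num [List.filter_cons, bilV])]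
  simp only [bilV, A02]; ring_nf

theorem evA31pp (m : ℕ) (X Y : ℂ) : aD2 m (V 3 1) (V X Y) = A31 m X Y := by
  rw [twoL_form m (V 3 1) (V (3/2) (1/2)) (V (-1/2) (1/2)) (V (1/2) (-1/2)) (V 0 1) (V (3/2) (-1/2)) (V 1 0) (V (1/2) (1/2)) (V X Y)
    (by rw [twoL_eq]; simp) (by rw [V_smul]; norm_num)
    (by norm_num [bilV]) (by norm_num [bilV]) (by norm_num [bilV]) (by norm_num [bilV]) (by norm_num [bilV]) (by norm_num [bilV]) (by norm_num [bilV]) (by simp only [bilV]; ring)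
    (by rw [short_eq]; norm_num [List.filter_cons, bilV]) (by rw [long_eq]; norm_num [List.filter_cons, bilV]) (by rw [short_eq]; norm_num [List.filter_cons, bilV]), ← S0_even]
  simp only [bilV, A31]; ring_nf

theorem evA31pn (m : ℕ) (X Y : ℂ) : aD2 m (V 3 (-1)) (V X Y) = A31 m X (-Y) := by
  rw [twoL_form m (V 3 (-1)) (V (3/2) (-1/2)) (V (1/2) (1/2)) (V (-1/2) (-1/2)) (V (3/2) (1/2)) (V 0 (-1)) (V 1 0) (V (1/2) (-1/2)) (V X Y)
    (by rw [twoL_eq]; simp) (by rw [V_smul]; norm_num)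
    (by norm_num [bilV]) (by norm_num [bilV]) (by norm_num [bilV]) (by norm_num [bilV]) (by norm_num [bilV]) (by norm_num [bilV]) (by norm_num [bilV]) (by simp only [bilV]; ring)
    (by rw [short_eq]; norm_num [List.filter_cons, bilV]) (by rw [long_eq]; norm_num [List.filter_cons, bilV]) (by rw [short_eq]; norm_num [List.filter_cons, bilV])]
  simp only [bilV, A31]; ring_nf

theorem evA31np (m : ℕ) (X Y : ℂ) : aD2 m (V (-3) 1) (V X Y) = A31 m (-X) Y := by
  rw [twoL_form m (V (-3) 1) (V (-3/2) (1/2)) (V (1/2) (1/2)) (V (-1/2) (-1/2)) (V 0 1) (V (-3/2) (-1/2)) (V (-1/2) (1/2)) (V (-1) 0) (V X Y)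
    (by rw [twoL_eq]; simp) (by rw [V_smul]; norm_num)
    (by norm_num [bilV]) (by norm_num [bilV]) (by norm_num [bilV]) (by norm_num [bilV]) (by norm_num [bilV]) (by norm_num [bilV]) (by norm_num [bilV]) (by simp only [bilV]; ring)
    (by rw [short_eq]; norm_num [List.filter_cons, bilV]) (by rw [long_eq]; norm_num [List.filter_cons, bilV]) (by rw [short_eq]; norm_num [List.filter_cons, bilV]), ← S0_even]
  simp only [bilV, A31]; ring_nf

theorem evA31nn (m : ℕ) (X Y : ℂ) : aD2 m (V (-3) (-1)) (V X Y) = A31 m (-X) (-Y) := by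
  rw [twoL_form m (V (-3) (-1)) (V (-3/2) (-1/2)) (V (-1/2) (1/2)) (V (1/2) (-1/2)) (V (-3/2) (1/2)) (V 0 (-1)) (V (-1) 0) (V (-1/2) (-1/2)) (V X Y)
    (by rw [twoL_eq]; simp) (by rw [V_smul]; norm_num)
    (by norm_num [bilV]) (by norm_num [bilV]) (by norm_num [bilV]) (by norm_num [bilV]) (by norm_num [bilV]) (by norm_num [bilV]) (by norm_num [bilV]) (by simp only [bilV]; ring)
    (by rw [short_eq]; norm_num [List.filter_cons, bilV]) (by rw [long_eq]; norm_num [List.filter_cons, bilV]) (by rw [short_eq]; norm_num [List.filter_cons, bilV])]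
  simp only [bilV, A31]; ring_nf

end
end

section
noncomputable section
open Complex

theorem p7_ne {t : ℂ} (h : p7 t ≠ 0) : t ≠ 0 ∧ t - 1 ≠ 0 ∧ t + 1 ≠ 0 ∧ t - 2 ≠ 0 ∧ t + 2 ≠ 0 ∧ t - 3 ≠ 0 ∧ t + 3 ≠ 0 := by
  simpa only [p7, mul_ne_zero_iff, and_assoc] using h
theorem p3_ne {t : ℂ} (h : p3 t ≠ 0) : t ≠ 0 ∧ t - 1 ≠ 0 ∧ t + 1 ≠ 0 := by
  simpa only [p3, mul_ne_zero_iff, and_assoc] using h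

theorem clS4 (m t : ℂ) (h : p7 t ≠ 0) : S4 m t * p7 t = ph4 m t := by
  obtain ⟨h0, h1, h2, h3, h4, h5, h6⟩ := p7_ne h
  unfold S4 p7 ph4
  field_simp
  ring
theorem clSS2 (m t : ℂ) (h : p7 t ≠ 0) : SS2 m t * p7 t = ph2 m t := by
  obtain ⟨h0, h1, h2, h3, h4, h5, h6⟩ := p7_ne h
  unfold SS2 p7 ph2
  field_simp
  ring
theorem clS2 (m t : ℂ) (h : p7 t ≠ 0) : S2 m t * p7 t = pg2 m t := by
  obtain ⟨h0, h1, h2, h3, h4, h5, h6⟩ := p7_ne h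
  unfold S2 p7 pg2
  field_simp
  ring
theorem clS1 (m t : ℂ) (h : p7 t ≠ 0) : S1 m t * p7 t = ph1 m t := by
  obtain ⟨h0, h1, h2, h3, h4, h5, h6⟩ := p7_ne h
  unfold S1 p7 ph1
  field_simp
  ring
theorem clS3 (m t : ℂ) (h : p7 t ≠ 0) : S3 m t * p7 t = ph3 m t := by
  obtain ⟨h0, h1, h2, h3, h4, h5, h6⟩ := p7_ne h
  unfold S3 p7 ph3
  field_simp
  ring
theorem clS0 (t : ℂ) (h : p7 t ≠ 0) : S0 t * p7 t = ph0 t := by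
  obtain ⟨h0, h1, h2, h3, h4, h5, h6⟩ := p7_ne h
  have h2' : -t - 1 ≠ 0 := by rw [show -t - 1 = -(t + 1) by ring]; exact neg_ne_zero.2 h2
  unfold S0 p7 ph0
  field_simp
  ring
theorem clL2 (m t : ℂ) (h : p3 t ≠ 0) : L2 m (3 * t) * p3 t = ch2 m t := by
  obtain ⟨h0, h1, h2⟩ := p3_ne h
  unfold L2 p3 ch2
  rw [show 3 * t + 3 = 3 * (t + 1) by ring]
  field_simp
theorem clL1 (m t : ℂ) (h : p3 t ≠ 0) : L1 m (3 * t) * p3 t = ch1 m t := by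
  obtain ⟨h0, h1, h2⟩ := p3_ne h
  unfold L1 p3 ch1
  field_simp
theorem clL0 (t : ℂ) (h : p3 t ≠ 0) : L0 (3 * t) * p3 t = ch0 t := by
  obtain ⟨h0, h1, h2⟩ := p3_ne h
  have h2' : -t - 1 ≠ 0 := by rw [show -t - 1 = -(t + 1) by ring]; exact neg_ne_zero.2 h2
  unfold L0 p3 ch0
  rw [show 3 * t - 3 = 3 * (t - 1) by ring, show -(3 * t) - 3 = 3 * (-t - 1) by ring]
  field_simp
  ring

theorem Den_ne {X Y : ℂ} (h : Den X Y ≠ 0) : p7 X ≠ 0 ∧ p7 ((X + 3 * Y) / 2) ≠ 0 ∧ p7 ((X - 3 * Y) / 2) ≠ 0 ∧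
    p3 Y ≠ 0 ∧ p3 ((X + Y) / 2) ≠ 0 ∧ p3 ((X - Y) / 2) ≠ 0 := by
  simpa only [Den, mul_ne_zero_iff, and_assoc] using h
theorem Den_alt (X Y : ℂ) : Den X Y = p7 X * p7 ((X + 3 * Y) / 2) * p7 ((3 * Y - X) / 2) *
    p3 Y * p3 ((X + Y) / 2) * p3 ((Y - X) / 2) := by
  rw [Den, show (3 * Y - X) / 2 = -((X - 3 * Y) / 2) by ring, show (Y - X) / 2 = -((X - Y) / 2) by ring, p7_odd,
    p3_odd]; ring
theorem Den_ne' {X Y : ℂ} (h : Den X Y ≠ 0) : p7 ((3 * Y - X) / 2) ≠ 0 ∧ p3 ((Y - X) / 2) ≠ 0 := by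
  rw [Den_alt] at h
  simp only [mul_ne_zero_iff, and_assoc] at h
  exact ⟨h.2.2.1, h.2.2.2.2.2⟩

theorem cl40 (m X Y : ℂ) (h : Den X Y ≠ 0) : A40 m X Y * Den X Y = T40 m X Y := by
  obtain ⟨h1, h2, h3, h4, h5, h6⟩ := Den_ne h
  rw [A40, T40, Den, ← clS4 m _ h1, ← clS2 m _ h2, ← clS2 m _ h3, ← clL2 m _ h5, ← clL2 m _ h6]; ring
theorem cl20 (m X Y : ℂ) (h : Den X Y ≠ 0) : A20 m X Y * Den X Y = T20 m X Y := by
  obtain ⟨h1, h2, h3, h4, h5, h6⟩ := Den_ne h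
  rw [A20, T20, Den, ← clSS2 m _ h1, ← clS1 m _ h2, ← clS1 m _ h3, ← clL0 _ h4, ← clL1 m _ h5, ← clL1 m _ h6]; ring
theorem cl31 (m X Y : ℂ) (h : Den X Y ≠ 0) : A31 m X Y * Den X Y = T31 m X Y := by
  obtain ⟨h1, h2, h3, h4, h5, h6⟩ := Den_ne h
  rw [A31, T31, Den, ← clS3 m _ h1, ← clS3 m _ h2, ← clS0 _ h3, ← clL1 m _ h4, ← clL2 m _ h5, ← clL1 m _ h6]; ring
theorem cl22 (m X Y : ℂ) (h : Den X Y ≠ 0) : A22 m X Y * Den X Y = T22 m X Y := by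
  obtain ⟨h1, h2, -, h4, h5, -⟩ := Den_ne h
  obtain ⟨h3, h6⟩ := Den_ne' h
  rw [A22, T22, Den_alt, ← clS2 m _ h1, ← clS4 m _ h2, ← clS2 m _ h3, ← clL2 m _ h4, ← clL2 m _ h5]; ring
theorem cl11 (m X Y : ℂ) (h : Den X Y ≠ 0) : A11 m X Y * Den X Y = T11 m X Y := by
  obtain ⟨h1, h2, -, h4, h5, -⟩ := Den_ne h
  obtain ⟨h3, h6⟩ := Den_ne' h
  rw [A11, T11, Den_alt, ← clS1 m _ h1, ← clSS2 m _ h2, ← clS1 m _ h3, ← clL1 m _ h4, ← clL1 m _ h5, ← clL0 _ h6]; ring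
theorem cl02 (m X Y : ℂ) (h : Den X Y ≠ 0) : A02 m X Y * Den X Y = T02 m X Y := by
  obtain ⟨h1, h2, -, h4, h5, -⟩ := Den_ne h
  obtain ⟨h3, h6⟩ := Den_ne' h
  rw [A02, T02, Den_alt, ← clS0 _ h1, ← clS3 m _ h2, ← clS3 m _ h3, ← clL2 m _ h4, ← clL1 m _ h5, ← clL1 m _ h6]; ring

theorem clX {A T : ℂ → ℂ → ℂ} (cl : ∀ X Y, Den X Y ≠ 0 → A X Y * Den X Y = T X Y) {X Y : ℂ} (h : Den X Y ≠ 0) :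
    A X Y * Den X Y = T X Y ∧ A (-X) Y * Den X Y = - T (-X) Y ∧ A X (-Y) * Den X Y = - T X (-Y) ∧
    A (-X) (-Y) * Den X Y = T (-X) (-Y) := by
  have e1 := Den_oddX X Y
  have e2 := Den_oddY X Y
  have e3 : Den (-X) (-Y) = Den X Y := by rw [Den_oddY, e1, neg_neg]
  refine ⟨cl X Y h, ?_, ?_, ?_⟩
  · have := cl (-X) Y (by rw [e1]; exact neg_ne_zero.2 h)
    rw [e1] at this; linear_combination -this
  · have := cl X (-Y) (by rw [e2]; exact neg_ne_zero.2 h)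
    rw [e2] at this; linear_combination -this
  · have := cl (-X) (-Y) (by rwa [e3])
    rwa [e3] at this

theorem Den_reg (X Y : ℂ) (h : D2Reg (V X Y)) : Den X Y ≠ 0 := by
  unfold D2Reg G2plus at h
  rw [va1, va2, va3, vb1, vb2, vb3] at h
  simp only [List.forall_mem_cons, bilV] at h
  obtain ⟨a1, a2, a3, b1, b2, b3, -⟩ := h
  have K7 : ∀ t : ℂ, t ≠ 0 → t ≠ 1 → t ≠ -1 → t ≠ 2 → t ≠ -2 → t ≠ 3 → t ≠ -3 → p7 t ≠ 0 := by
    intro t h0 h1 h2 h3 h4 h5 h6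
    simp only [p7, mul_ne_zero_iff, sub_ne_zero, and_assoc, ne_eq, add_eq_zero_iff_eq_neg]
    exact ⟨h0, h1, h2, h3, h4, h5, h6⟩
  have K3 : ∀ t : ℂ, t ≠ 0 → t ≠ 1 → t ≠ -1 → p3 t ≠ 0 := by
    intro t h0 h1 h2
    simp only [p3, mul_ne_zero_iff, sub_ne_zero, and_assoc, ne_eq, add_eq_zero_iff_eq_neg]
    exact ⟨h0, h1, h2⟩
  have k1 : p7 X ≠ 0 := by
    obtain ⟨h0, h1, h2, h3, h4, h5, h6⟩ := b1
    apply K7 <;> intro e <;> subst e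
    · exact h0 (by ring)
    · exact h1 (by ring)
    · exact h2 (by ring)
    · exact h3 (by ring)
    · exact h4 (by ring)
    · exact h5 (by ring)
    · exact h6 (by ring)
  have k2 : p7 ((X + 3 * Y) / 2) ≠ 0 := by
    obtain ⟨h0, h1, h2, h3, h4, h5, h6⟩ := b2
    apply K7 <;> intro e
    · exact h0 (by linear_combination e)
    · exact h1 (by linear_combination e)
    · exact h2 (by linear_combination e)
    · exact h3 (by linear_combination e)
    · exact h4 (by linear_combination e)
    · exact h5 (by linear_combination e)
    · exact h6 (by linear_combination e)
  have k3 : p7 ((X - 3 * Y) / 2) ≠ 0 := by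
    obtain ⟨h0, h1, h2, h3, h4, h5, h6⟩ := b3
    apply K7 <;> intro e
    · exact h0 (by linear_combination -e)
    · exact h2 (by linear_combination -e)
    · exact h1 (by linear_combination -e)
    · exact h4 (by linear_combination -e)
    · exact h3 (by linear_combination -e)
    · exact h6 (by linear_combination -e)
    · exact h5 (by linear_combination -e)
  have k4 : p3 Y ≠ 0 := by
    obtain ⟨h0, h1, h2, -⟩ := a1
    apply K3 <;> intro e
    · exact h0 (by linear_combination 3 * e)
    · exact h1 (by linear_combination 3 * e)
    · exact h2 (by linear_combination 3 * e)
  have k5 : p3 ((X + Y) / 2) ≠ 0 := by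
    obtain ⟨h0, h1, h2, -⟩ := a3
    apply K3 <;> intro e
    · exact h0 (by linear_combination 3 * e)
    · exact h1 (by linear_combination 3 * e)
    · exact h2 (by linear_combination 3 * e)
  have k6 : p3 ((X - Y) / 2) ≠ 0 := by
    obtain ⟨h0, h1, h2, -⟩ := a2
    apply K3 <;> intro e
    · exact h0 (by linear_combination -3 * e)
    · exact h2 (by linear_combination -3 * e)
    · exact h1 (by linear_combination -3 * e)
  simp only [Den, mul_ne_zero_iff, and_assoc]
  exact ⟨k1, k2, k3, k4, k5, k6⟩

theorem link (m : ℕ) (ψ : (Fin 2 → ℂ) → ℂ) (μ X Y : ℂ) (hD : Den X Y ≠ 0)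
    (h : opE m μ (fun X Y => ψ (V X Y)) X Y = 0) :
    (twoAG2.map (fun τ => aD2 m τ (V X Y) * (ψ (V X Y + τ) - ψ (V X Y)))).sum = μ * ψ (V X Y) := by
  rw [twoAG_eq]
  simp only [List.map, List.sum_cons, List.sum_nil, V_add, evA40pp, evA40np, evA22pp, evA22pn, evA22np, evA22nn,
    evA20pp, evA20np, evA11pp, evA11pn, evA11np, evA11nn, evA02pp, evA02pn, evA31pp, evA31pn, evA31np, evA31nn]
  obtain ⟨f1, f2, -, -⟩ := clX (cl40 m) hD
  obtain ⟨s1, s2, -, -⟩ := clX (cl20 m) hD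
  obtain ⟨l1, -, l2, -⟩ := clX (cl02 m) hD
  obtain ⟨f3, f4, f5, f6⟩ := clX (cl22 m) hD
  obtain ⟨s3, s4, s5, s6⟩ := clX (cl11 m) hD
  obtain ⟨l3, l4, l5, l6⟩ := clX (cl31 m) hD
  simp only [opE, sub_eq_add_neg] at h
  simp only [sub_eq_add_neg, add_zero] at h ⊢
  apply mul_right_cancel₀ hD
  generalize ψ (V X Y) = c at *
  generalize A40 m X Y = w1 at *
  generalize A40 m (-X) Y = w2 at *
  linear_combination h + (ψ (V (X + 4) Y) - c) * f1 + (ψ (V (X + -4) Y) - c) * f2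
    + (ψ (V (X + 2) Y) - c) * s1 + (ψ (V (X + -2) Y) - c) * s2
    + (ψ (V X (Y + 2)) - c) * l1 + (ψ (V X (Y + -2)) - c) * l2
    + (ψ (V (X + 2) (Y + 2)) - c) * f3 + (ψ (V (X + -2) (Y + 2)) - c) * f4
    + (ψ (V (X + 2) (Y + -2)) - c) * f5 + (ψ (V (X + -2) (Y + -2)) - c) * f6
    + (ψ (V (X + 1) (Y + 1)) - c) * s3 + (ψ (V (X + -1) (Y + 1)) - c) * s4
    + (ψ (V (X + 1) (Y + -1)) - c) * s5 + (ψ (V (X + -1) (Y + -1)) - c) * s6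
    + (ψ (V (X + 3) (Y + 1)) - c) * l3 + (ψ (V (X + -3) (Y + 1)) - c) * l4
    + (ψ (V (X + 3) (Y + -1)) - c) * l5 + (ψ (V (X + -3) (Y + -1)) - c) * l6
end
end

section
noncomputable section
open Complex

theorem Ev_of (S : Set ℕ) (g : ℂ → ℂ) (h : ∀ s ∈ S, g (s : ℂ) = g (-(s : ℂ))) : Ev S g := by
  intro k hk
  rcases hk with rfl | hk
  · simp
  · have := h _ hk
    obtain ⟨n, rfl | rfl⟩ := k.eq_nat_or_neg
    · simpa using this
    · simpa using this.symm

theorem QQ_eval (P : MvPolynomial (Fin 2) ℂ) (d : ℕ) (h : P.totalDegree ≤ d) :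
    (fun X Y => MvPolynomial.eval (V X Y) P) ∈ QQ (d + 1) := by
  have e : (fun X Y => MvPolynomial.eval (V X Y) P) = ∑ s ∈ P.support,
      (P.coeff s * rt3 ^ (s 1)) • (fun X Y : ℂ => X ^ (s 0) * Y ^ (s 1)) := by
    funext X Y
    rw [MvPolynomial.eval_eq', Finset.sum_apply, Finset.sum_apply]
    refine Finset.sum_congr rfl (fun s _ => ?_)
    simp [V, mul_pow]; ring
  rw [e]
  refine Submodule.sum_mem _ (fun s hs => Submodule.smul_mem _ _ (SP_mono_mem _ _ _ ?_))
  have := MvPolynomial.le_totalDegree hs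
  rw [Finsupp.sum_fintype _ _ (by simp), Fin.sum_univ_two] at this
  change s 0 + s 1 < d + 1
  omega

theorem final (m : ℕ) (hm : 1 ≤ m) (x : Fin 2 → ℂ)
    (hx : ∀ γ ∈ AG2plus, Complex.sinh (bil γ x) ≠ 0)
    (ψ : (Fin 2 → ℂ) → ℂ) (hψ : IsBAFunction m x ψ) :
    ∀ z : Fin 2 → ℂ, D2Reg z →
      (twoAG2.map (fun τ => aD2 m τ z * (ψ (z + τ) - ψ z))).sum
        = muD2 m x * ψ z := by
  intro z hz
  rw [← V_surj z] at hz ⊢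
  generalize z 0 = X at *
  generalize z 1 / rt3 = Y at *
  obtain ⟨P, hP, -, hPψ, hqa, hqb⟩ := hψ
  have hD := Den_reg X Y hz
  rw [mu_eq]
  apply link m ψ _ X Y hD
  have bx : ∀ p q, bil (V p q) x = p * x 0 + q * (rt3 * x 1) := by
    intro p q
    simp only [bil, V, Matrix.cons_val_zero, Matrix.cons_val_one]; ring
  unfold AG2plus G2plus at hx
  rw [va1, va2, va3, vb1, vb2, vb3] at hx
  simp only [List.cons_append, List.nil_append, List.forall_mem_cons, V_smul, bx] at hx
  obtain ⟨a1, a2, a3, b1, b2, b3, c1, c2, c3, -⟩ := hx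
  rw [va1, va2, va3] at hqa
  rw [vb1, vb2, vb3] at hqb
  simp only [List.forall_mem_cons, List.not_mem_nil, false_imp_iff, implies_true, and_true] at hqa hqb
  obtain ⟨q1, q2, q3⟩ := hqa
  obtain ⟨r1, r2, r3⟩ := hqb
  set a := x 0
  set b := rt3 * x 1
  refine opE_zero m hm a b ?_ ?_ ?_ ?_ ?_ ?_ ?_ ?_ ?_ (fun X Y => MvPolynomial.eval (V X Y) P)
    (QQ_eval P _ hP.le) _ ?_ ?_ ?_ ?_ ?_ ?_ ?_ X Y
  · convert b1 using 2; ring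
  · convert c1 using 2; ring
  · convert a1 using 2; ring
  · convert b2 using 2; ring
  · convert c2 using 2; ring
  · convert a2 using 2; ring
  · convert b3 using 2; ring
  · convert c3 using 2; ring
  · intro h
    apply a3
    rw [show 3 / 2 * a + 1 / 2 * b = -(-(3 * a + b) / 2) by ring, Complex.sinh_neg, h, neg_zero]
  · funext X Y
    rw [hPψ, bx, mul_comm X, mul_comm Y]
    simp only [emul]
  · intro Y
    refine Ev_of _ _ fun s hs => ?_
    have := r1 s hs (V 0 Y) (by rw [bilV]; ring)
    simp only [V_smul, V_add, V_sub] at this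
    convert this using 2 <;> congr 1 <;> ring
  · intro X
    refine Ev_of _ _ fun s hs => ?_
    have := q1 s hs.1 hs.2 (V X 0) (by rw [bilV]; ring)
    simp only [V_smul, V_add, V_sub] at this
    convert this using 2 <;> congr 1 <;> ring
  · intro Y
    refine Ev_of _ _ fun s hs => ?_
    have := r2 s hs (V (-3/2*Y) (Y/2)) (by rw [bilV]; ring)
    simp only [V_smul, V_add, V_sub] at this
    simp only [rot]
    convert this using 2 <;> congr 1 <;> ring
  · intro X
    refine Ev_of _ _ fun s hs => ?_
    have := q2 s hs.1 hs.2 (V (X/2) (X/2)) (by rw [bilV]; ring)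
    simp only [V_smul, V_add, V_sub] at this
    simp only [rot]
    convert this using 2 <;> congr 1 <;> ring
  · intro Y
    refine Ev_of _ _ fun s hs => ?_
    have := r3 s hs (V (-3/2*Y) (-Y/2)) (by rw [bilV]; ring)
    simp only [V_smul, V_add, V_sub] at this
    simp only [rot]
    convert this using 2 <;> congr 1 <;> ring
  · intro X
    refine Ev_of _ _ fun s hs => ?_
    have := (q3 s hs.1 hs.2 (V (-X/2) (X/2)) (by rw [bilV]; ring)).symm
    simp only [V_smul, V_add, V_sub] at this
    simp only [rot]
    convert this using 2 <;> congr 1 <;> ring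
end
end

/-- The Baker–Akhiezer function for `AG₂` is an eigenfunction
of the dual difference operator `D₂` with eigenvalue `μ₂(x)`. -/
theorem stmt_16 (m : ℕ) (hm : 1 ≤ m) (x : Fin 2 → ℂ)
    (hx : ∀ γ ∈ AG2plus, Complex.sinh (bil γ x) ≠ 0)
    (ψ : (Fin 2 → ℂ) → ℂ) (hψ : IsBAFunction m x ψ) :
    ∀ z : Fin 2 → ℂ, D2Reg z →
      (twoAG2.map (fun τ => aD2 m τ z * (ψ (z + τ) - ψ z))).sum
        = muD2 m x * ψ z := by
  exact final m hm x hx ψ hψ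

end
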